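/- arXiv:2104.07633 — 2 statements merged into one kernel-verified Lean document; each statement's English description precedes it below -/
import Mathlib

section
/- There is an absolute constant c > 0 such that for every integer n ≥ 4 and every simple graph G on n vertices that contains a Hamilton cycle and in which every vertex has degree at least 3, the number of distinct lengths of cycles in G is at least c · n / 2^{6·√(log₂ n · log₂ log₂ n)}. -/
open scoped Pointwise


def Pth (R : SimpleGraph ℕ) (u v : ℕ) (S : Set ℕ) (l : ℕ) : Prop :=
  ∃ p : R.Walk u v, p.IsPath ∧ (∀ w ∈ p.support, w ∈ S) ∧ p.length = l

lemma Pth.refl (R : SimpleGraph ℕ) {u : ℕ} {S : Set ℕ} (h : u ∈ S) : Pth R u u S 0 :=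
  ⟨SimpleGraph.Walk.nil, by simp, by simpa using h, rfl⟩

lemma Pth.mono {R : SimpleGraph ℕ} {u v : ℕ} {S T : Set ℕ} {l : ℕ} (h : Pth R u v S l)
    (hST : S ⊆ T) : Pth R u v T l := by
  obtain ⟨p, h1, h2, h3⟩ := h
  exact ⟨p, h1, fun w hw => hST (h2 w hw), h3⟩

lemma Pth.symm {R : SimpleGraph ℕ} {u v : ℕ} {S : Set ℕ} {l : ℕ} (h : Pth R u v S l) :
    Pth R v u S l := by
  obtain ⟨p, h1, h2, h3⟩ := h
  exact ⟨p.reverse, h1.reverse, by simpa using h2, by simpa using h3⟩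

lemma Pth.concat {R : SimpleGraph ℕ} {u v v' w : ℕ} {S S' : Set ℕ} {l l' : ℕ}
    (h : Pth R u v S l) (hvv : R.Adj v v') (h' : Pth R v' w S' l') (hd : Disjoint S S') :
    Pth R u w (S ∪ S') (l + 1 + l') := by
  obtain ⟨p, h1, h2, h3⟩ := h
  obtain ⟨q, k1, k2, k3⟩ := h'
  refine ⟨p.append (SimpleGraph.Walk.cons hvv q), ?_, ?_, ?_⟩
  · rw [SimpleGraph.Walk.isPath_def, SimpleGraph.Walk.support_append,
      SimpleGraph.Walk.support_cons, List.tail_cons, List.nodup_append]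
    refine ⟨h1.support_nodup, k1.support_nodup, ?_⟩
    intro a ha b hb hab
    subst hab
    exact Set.disjoint_left.mp hd (h2 a ha) (k2 a hb)
  · intro x hx
    rw [SimpleGraph.Walk.support_append,
      SimpleGraph.Walk.support_cons, List.tail_cons, List.mem_append] at hx
    rcases hx with hx | hx
    · exact Or.inl (h2 x hx)
    · exact Or.inr (k2 x hx)
  · rw [SimpleGraph.Walk.length_append, SimpleGraph.Walk.length_cons]; omega

/-- consecutive vertices adjacent -/
def Ham (R : SimpleGraph ℕ) (n : ℕ) : Prop := ∀ i, i + 1 < n → R.Adj i (i+1)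

lemma Pth.interval {R : SimpleGraph ℕ} {n : ℕ} (hR : Ham R n) {a : ℕ} (k : ℕ)
    (hb : a + k < n) : Pth R a (a+k) (Set.Icc a (a+k)) k := by
  induction k with
  | zero => exact Pth.refl R (by simp)
  | succ k ih =>
    have h1 := ih (by omega)
    have h2 : R.Adj (a+k) (a+k+1) := hR _ (by omega)
    have h3 := h1.concat h2 (Pth.refl R (S := {a+k+1}) rfl) (by
      rw [Set.disjoint_singleton_right]; simp)
    refine h3.mono ?_
    intro x hx
    rcases hx with hx | hx
    · rw [Set.mem_Icc] at *; omega
    · rw [Set.mem_singleton_iff] at hx; rw [Set.mem_Icc]; omega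

lemma Pth.ivl {R : SimpleGraph ℕ} {n : ℕ} (hR : Ham R n) {a b : ℕ} (hab : a ≤ b)
    (hb : b < n) : Pth R a b (Set.Icc a b) (b - a) := by
  have := Pth.interval hR (a := a) (b - a) (by omega)
  rwa [Nat.add_sub_cancel' hab] at this

lemma Pth.length_lt {R : SimpleGraph ℕ} {n : ℕ} {u v : ℕ} {S : Set ℕ} {l : ℕ}
    (h : Pth R u v S l) (hS : ∀ w ∈ S, w < n) : l < n := by
  obtain ⟨p, h1, h2, h3⟩ := h
  have h4 : p.support.toFinset ⊆ Finset.range n := by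
    intro x hx
    rw [List.mem_toFinset] at hx
    exact Finset.mem_range.mpr (hS x (h2 x hx))
  have h5 := Finset.card_le_card h4
  rw [List.toFinset_card_of_nodup h1.support_nodup, SimpleGraph.Walk.length_support,
    Finset.card_range] at h5
  omega

lemma Pth.start_mem {R : SimpleGraph ℕ} {u v : ℕ} {S : Set ℕ} {l : ℕ}
    (h : Pth R u v S l) : u ∈ S := by
  obtain ⟨p, h1, h2, h3⟩ := h
  exact h2 _ p.start_mem_support

lemma Pth.end_mem {R : SimpleGraph ℕ} {u v : ℕ} {S : Set ℕ} {l : ℕ}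
    (h : Pth R u v S l) : v ∈ S := by
  obtain ⟨p, h1, h2, h3⟩ := h
  exact h2 _ p.end_mem_support

/-- The path followed by a piece which may share the end vertex: append ascending piece. -/
lemma Pth.join {R : SimpleGraph ℕ} {u v w : ℕ} {S S' : Set ℕ} {l l' : ℕ}
    (h : Pth R u v S l) (h' : Pth R v w S' l') (hd : ∀ x, x ∈ S → x ∈ S' → x = v) :
    Pth R u w (S ∪ S') (l + l') := by
  obtain ⟨p, h1, h2, h3⟩ := h
  obtain ⟨q, k1, k2, k3⟩ := h'
  refine ⟨p.append q, ?_, ?_, ?_⟩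
  · rw [SimpleGraph.Walk.isPath_def, SimpleGraph.Walk.support_append, List.nodup_append]
    have hq := k1.support_nodup
    rw [← SimpleGraph.Walk.cons_tail_support, List.nodup_cons] at hq
    refine ⟨h1.support_nodup, hq.2, ?_⟩
    intro a ha b hb hab
    subst hab
    have := hd a (h2 a ha) (k2 a (List.mem_of_mem_tail hb))
    subst this
    exact hq.1 hb
  · intro x hx
    rw [SimpleGraph.Walk.mem_support_append_iff] at hx
    rcases hx with hx | hx
    · exact Or.inl (h2 x hx)
    · exact Or.inr (k2 x hx)
  · rw [SimpleGraph.Walk.length_append]; omega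

structure Good (R : SimpleGraph ℕ) (n m : ℕ) (P : Finset (ℕ × ℕ)) : Prop where
  ham : Ham R n
  adj : ∀ p ∈ P, R.Adj p.1 p.2
  lt1 : ∀ p ∈ P, p.1 < m
  le2 : ∀ p ∈ P, m ≤ p.2
  ltn : ∀ p ∈ P, p.2 < n
  gap : ∀ p ∈ P, p.1 + 2 ≤ p.2
  inj : ∀ p ∈ P, ∀ q ∈ P, p.1 = q.1 → p = q

lemma Good.mono {R : SimpleGraph ℕ} {n m : ℕ} {P Q : Finset (ℕ × ℕ)} (h : Good R n m P)
    (hQ : Q ⊆ P) : Good R n m Q :=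
  ⟨h.ham, fun p hp => h.adj p (hQ hp), fun p hp => h.lt1 p (hQ hp), fun p hp => h.le2 p (hQ hp),
    fun p hp => h.ltn p (hQ hp), fun p hp => h.gap p (hQ hp),
    fun p hp q hq => h.inj p (hQ hp) q (hQ hq)⟩

def HAm (R : SimpleGraph ℕ) (P : Finset (ℕ × ℕ)) (v : ℤ) : Prop :=
  ∃ p1 ∈ P, ∃ p2 ∈ P, ∃ p3 ∈ P, ∃ p4 ∈ P, ∃ l : ℕ, p1.1 ≤ p2.1 ∧ p3.2 ≤ p4.2 ∧
    Pth R p1.1 p4.2 (Set.Icc p1.1 p2.1 ∪ Set.Icc p3.2 p4.2) l ∧ v = l + p1.1 - p4.2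

open Classical in
noncomputable def HA (R : SimpleGraph ℕ) (n : ℕ) (P : Finset (ℕ × ℕ)) : Finset ℤ :=
  (Finset.Icc (-(n:ℤ)) n).filter (HAm R P)

lemma Good.mem_HA {R : SimpleGraph ℕ} {n m : ℕ} {P : Finset (ℕ × ℕ)} (h : Good R n m P) (v : ℤ) :
    v ∈ HA R n P ↔ HAm R P v := by
  classical
  unfold HA
  rw [Finset.mem_filter, Finset.mem_Icc, and_iff_right_iff_imp]
  rintro ⟨p1, h1, p2, h2, p3, h3, p4, h4, l, h5, h6, h7, h8⟩
  have a1 := h.lt1 _ h1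
  have a2 := h.lt1 _ h2
  have a4 := h.ltn _ h4
  have a5 := h.le2 _ h4
  have a6 := h7.length_lt (n := n) (by
    intro w hw
    simp only [Set.mem_union, Set.mem_Icc] at hw
    omega)
  omega

lemma HA_card_le (R : SimpleGraph ℕ) (n : ℕ) (P : Finset (ℕ × ℕ)) :
    (HA R n P).card ≤ 2 * n + 1 := by
  classical
  unfold HA
  refine (Finset.card_filter_le _ _).trans ?_
  rw [Int.card_Icc]
  omega

lemma HAm.mono {R : SimpleGraph ℕ} {P Q : Finset (ℕ × ℕ)} {v : ℤ} (h : HAm R Q v) (hQ : Q ⊆ P) :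
    HAm R P v := by
  obtain ⟨p1, h1, p2, h2, p3, h3, p4, h4, l, h5⟩ := h
  exact ⟨p1, hQ h1, p2, hQ h2, p3, hQ h3, p4, hQ h4, l, h5⟩

lemma HA_mono {R : SimpleGraph ℕ} {n : ℕ} {P Q : Finset (ℕ × ℕ)} (hQ : Q ⊆ P) :
    HA R n Q ⊆ HA R n P := by
  classical
  unfold HA
  intro v hv
  rw [Finset.mem_filter] at *
  exact ⟨hv.1, hv.2.mono hQ⟩

lemma Good.single {R : SimpleGraph ℕ} {n m : ℕ} {P : Finset (ℕ × ℕ)} (h : Good R n m P)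
    {p : ℕ × ℕ} (hp : p ∈ P) : (1 + p.1 - p.2 : ℤ) ∈ HA R n P := by
  rw [h.mem_HA]
  refine ⟨p, hp, p, hp, p, hp, p, hp, 1, le_rfl, le_rfl, ?_, by push_cast; ring⟩
  have a1 := h.lt1 _ hp
  have a2 := h.le2 _ hp
  have := (Pth.refl R (u := p.1) (S := Set.Icc p.1 p.1) (by simp)).concat (h.adj p hp)
    (Pth.refl R (u := p.2) (S := Set.Icc p.2 p.2) (by simp)) (by
      rw [Set.disjoint_left]; intro x hx hy
      simp only [Set.mem_Icc] at *; omega)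
  exact this

lemma Good.ne_sum {R : SimpleGraph ℕ} {n m : ℕ} {P P1 P2 : Finset (ℕ × ℕ)} (h : Good R n m P)
    (h1 : P1 ⊆ P) (h2 : P2 ⊆ P) {e : ℕ × ℕ} (he : e ∈ P)
    (k1 : ∀ p ∈ P1, p.1 < e.1 ∧ p.2 < e.2) (k2 : ∀ p ∈ P2, e.1 < p.1 ∧ e.2 < p.2)
    {v1 v2 : ℤ} (hv1 : HAm R P1 v1) (hv2 : HAm R P2 v2) :
    HAm R P (v1 + v2 + (e.2 - e.1) + 1) := by
  obtain ⟨a1, ha1, b1, hb1, c1, hc1, d1, hd1, l1, hab1, hcd1, q1, e1⟩ := hv1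
  obtain ⟨a2, ha2, b2, hb2, c2, hc2, d2, hd2, l2, hab2, hcd2, q2, e2⟩ := hv2
  have u1 := k1 _ ha1
  have u2 := k1 _ hb1
  have u3 := k1 _ hc1
  have u4 := k1 _ hd1
  have w1 := k2 _ ha2
  have w2 := k2 _ hb2
  have w3 := k2 _ hc2
  have w4 := k2 _ hd2
  have x1 := h.le2 _ (h1 hc1)
  have x2 := h.lt1 _ (h2 ha2)
  have x3 := h.ltn _ (h2 hd2)
  have x4 := h.lt1 _ (h2 hb2)
  have x5 := h.lt1 _ he
  have x6 := h.le2 _ he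
  have x7 := h.ltn _ he
  have r1 := q1.join (Pth.ivl h.ham (a := d1.2) (b := e.2) (by omega) (by omega)) (by
    intro x hx hy
    simp only [Set.mem_union, Set.mem_Icc] at *; omega)
  have r2 := r1.concat (h.adj _ he).symm
    (Pth.ivl h.ham (a := e.1) (b := a2.1) (by omega) (by omega)) (by
      rw [Set.disjoint_left]; intro x hx hy
      simp only [Set.mem_union, Set.mem_Icc] at *; omega)
  have r3 := r2.join q2 (by
    intro x hx hy
    simp only [Set.mem_union, Set.mem_Icc] at *; omega)
  refine ⟨a1, h1 ha1, b2, h2 hb2, c1, h1 hc1, d2, h2 hd2, _, by omega, by omega, r3.mono ?_, ?_⟩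
  · intro x hx
    simp only [Set.mem_union, Set.mem_Icc] at *; omega
  · omega

lemma Good.se_step {R : SimpleGraph ℕ} {n m : ℕ} {P Q W : Finset (ℕ × ℕ)} (h : Good R n m P)
    (hQ : Q ⊆ P) (hW : W ⊆ P) {e f : ℕ × ℕ} (he : e ∈ Q) (hf : f ∈ Q)
    (k : ∀ q ∈ Q, ∀ w ∈ W, q.1 < w.1 ∧ w.2 < q.2) (hef : e.1 < f.1 ∧ e.2 < f.2)
    {v : ℤ} (hv : HAm R W v) :
    HAm R (W ∪ Q) (v + (2 - ((f.1 + f.2) - (e.1 + e.2)))) := by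
  classical
  obtain ⟨a, ha, b, hb, c, hc, d, hd, l, hab, hcd, q, e1⟩ := hv
  have u1 := k _ hf _ ha
  have u2 := k _ he _ hb
  have u3 := k _ he _ hc
  have u4 := k _ he _ hd
  have x1 := h.le2 _ (hW hc)
  have x2 := h.lt1 _ (hW hb)
  have x3 := h.ltn _ (hQ hf)
  have x4 := h.ltn _ (hQ he)
  have r1 := (Pth.refl R (u := e.1) (S := Set.Icc e.1 e.1) (by simp)).concat (h.adj _ (hQ he))
    (Pth.ivl h.ham (a := d.2) (b := e.2) (by omega) (by omega)).symm (by
      rw [Set.disjoint_left]; intro x hx hy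
      simp only [Set.mem_union, Set.mem_Icc] at *; omega)
  have r2 := r1.join q.symm (by
    intro x hx hy
    simp only [Set.mem_union, Set.mem_Icc] at *; omega)
  have r3 := r2.join (Pth.ivl h.ham (a := f.1) (b := a.1) (by omega) (by omega)).symm (by
    intro x hx hy
    simp only [Set.mem_union, Set.mem_Icc] at *; omega)
  have r4 := r3.concat (h.adj _ (hQ hf)) (Pth.refl R (u := f.2) (S := Set.Icc f.2 f.2) (by simp))
    (by
      rw [Set.disjoint_left]; intro x hx hy
      simp only [Set.mem_union, Set.mem_Icc] at *; omega)
  refine ⟨e, by simp [he], b, by simp [hb], c, by simp [hc], f, by simp [hf], _, by omega,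
    by omega, r4.mono ?_, ?_⟩
  · intro x hx
    simp only [Set.mem_union, Set.mem_Icc] at *; omega
  · omega

def tset (Q : Finset (ℕ × ℕ)) : Finset ℤ := Q.image (fun p => (1 + p.1 - p.2 : ℤ))

def nX (Q : Finset (ℕ × ℕ)) : Finset ℤ :=
  insert 0 (((Q ×ˢ Q).filter (fun ef => ef.1.1 < ef.2.1 ∧ ef.1.2 < ef.2.2)).image
    (fun ef => (2 - ((ef.2.1 + ef.2.2) - (ef.1.1 + ef.1.2)) : ℤ)))

lemma mem_nX {Q : Finset (ℕ × ℕ)} {e f : ℕ × ℕ} (he : e ∈ Q) (hf : f ∈ Q)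
    (h : e.1 < f.1 ∧ e.2 < f.2) : (2 - ((f.1 + f.2) - (e.1 + e.2)) : ℤ) ∈ nX Q := by
  unfold nX
  refine Finset.mem_insert_of_mem (Finset.mem_image.mpr ⟨(e, f), ?_, rfl⟩)
  simp [he, hf, h]

lemma zero_mem_nX (Q : Finset (ℕ × ℕ)) : (0:ℤ) ∈ nX Q := Finset.mem_insert_self _ _

lemma ediv_near {a b h : ℤ} (hh : 0 < h) (h1 : a < b + h) : a / h ≤ b / h + 1 := by
  have : a / h ≤ (b + h) / h := Int.ediv_le_ediv hh (by omega)
  have h2 : (b + h) / h = b / h + 1 := by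
    have := Int.add_mul_ediv_right b 1 hh.ne'
    simpa using this
  omega

lemma same_ediv {a b h : ℤ} (hh : 0 < h) (h1 : a / h = b / h) : a < b + h := by
  have e1 := Int.emod_add_mul_ediv a h
  have e2 := Int.emod_add_mul_ediv b h
  have := Int.emod_lt_of_pos a hh
  have := Int.emod_nonneg b hh.ne'
  rw [h1] at e1
  linarith

lemma lemmaZ {R : SimpleGraph ℕ} {n m : ℕ} {Q : Finset (ℕ × ℕ)} (hg : Good R n m Q) (K : ℕ)
    (hK : 2 * n ≤ 2 ^ K) : Q.card ≤ 2 * (K + 1) * (tset Q + nX Q).card := by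
  classical
  set t : ℕ × ℕ → ℤ := fun p => (p.1 : ℤ) - p.2 with ht
  set s : ℕ × ℕ → ℤ := fun p => (p.1 : ℤ) + p.2 with hs
  set E : ℕ → ℕ × ℕ → Prop := fun i p => ∃ f ∈ Q, t f / 2 ^ i = t p / 2 ^ i ∧ s p + 2 ^ i ≤ s f
    with hE
  have hEK : ∀ p ∈ Q, ¬ E K p := by
    rintro p hp ⟨f, hf, -, h2⟩
    have a1 := hg.ltn _ hf
    have a2 := hg.gap _ hf
    have : ((2 * n : ℕ) : ℤ) ≤ ((2 ^ K : ℕ) : ℤ) := by exact_mod_cast hK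
    push_cast at this
    simp only [hs] at h2
    omega
  have hex : ∀ p ∈ Q, ∃ i, ¬ E i p := fun p hp => ⟨K, hEK p hp⟩
  set idx : ℕ × ℕ → ℕ := fun p => if h : ∃ i, ¬ E i p then Nat.find h else 0 with hidx
  have hi1 : ∀ p ∈ Q, ¬ E (idx p) p := by
    intro p hp
    simp only [hidx, dif_pos (hex p hp)]
    exact Nat.find_spec (hex p hp)
  have hi2 : ∀ p ∈ Q, ∀ i, i < idx p → E i p := by
    intro p hp i hi
    simp only [hidx, dif_pos (hex p hp)] at hi
    exact not_not.mp (Nat.find_min (hex p hp) hi)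
  have hmaps : ∀ p ∈ Q, idx p ∈ Finset.range (K+1) := by
    intro p hp
    rw [Finset.mem_range]
    by_contra hc
    exact hEK p hp (hi2 p hp K (by omega))
  rw [Finset.card_eq_sum_card_fiberwise hmaps]
  have key : ∀ i ∈ Finset.range (K+1), (Q.filter (fun p => idx p = i)).card
      ≤ 2 * (tset Q + nX Q).card := by
    intro i _
    rcases i with _ | i
    · have : (Q.filter (fun p => idx p = 0)).card ≤ (tset Q + nX Q).card := by
        refine Finset.card_le_card_of_injOn (fun p => (1 + p.1 - p.2 : ℤ)) ?_ ?_
        · intro p hp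
          simp only [Finset.coe_filter, Set.mem_ofPred_eq] at hp
          have := Finset.add_mem_add (s := tset Q) (t := nX Q)
            (Finset.mem_image_of_mem _ hp.1) (zero_mem_nX Q)
          rw [add_zero] at this; exact this
        · intro p hp q hq hpq
          simp only [Finset.coe_filter, Set.mem_ofPred_eq] at hp hq hpq
          have h1 := hi1 p hp.1
          have h2 := hi1 q hq.1
          rw [hp.2] at h1
          rw [hq.2] at h2
          simp only [hE, not_exists, not_and, pow_zero, Int.ediv_one] at h1 h2
          have h3 := h1 q hq.1 (by simp only [ht]; omega)
          have h4 := h2 p hp.1 (by simp only [ht]; omega)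
          simp only [hs] at h3 h4
          exact hg.inj _ hp.1 _ hq.1 (by omega)
      omega
    · set h : ℤ := 2 ^ i with hh
      have hpos : 0 < h := by positivity
      have hF : ∀ k : ℤ, ∃ F : ℕ × ℕ, (∃ f ∈ Q, t f / h = k) → (F ∈ Q ∧ t F / h = k ∧
          ∀ f ∈ Q, t f / h = k → s f ≤ s F) := by
        intro k
        by_cases hk : ∃ f ∈ Q, t f / h = k
        · obtain ⟨f, hf, hfk⟩ := hk
          obtain ⟨F, hF1, hF2⟩ := Finset.exists_max_image (Q.filter (fun f => t f / h = k)) s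
            ⟨f, by simp [hf, hfk]⟩
          rw [Finset.mem_filter] at hF1
          refine ⟨F, fun _ => ⟨hF1.1, hF1.2, fun g hg1 hg2 => hF2 g ?_⟩⟩
          simp [hg1, hg2]
        · exact ⟨(0,0), fun h => absurd h hk⟩
      choose F hF using hF
      have hprop : ∀ p ∈ Q, idx p = i + 1 → F (t p / h) ∈ Q ∧ p.1 < (F (t p / h)).1 ∧
          p.2 < (F (t p / h)).2 ∧ s p + h ≤ s (F (t p / h)) ∧ s (F (t p / h)) < s p + 2 * h := by
        intro p hp hip
        obtain ⟨f1, f2, f3⟩ := hF (t p / h) ⟨p, hp, rfl⟩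
        obtain ⟨g, g1, g2, g3⟩ := hi2 p hp i (by omega)
        have g4 := f3 g g1 g2
        have g5 : s p + h ≤ s (F (t p / h)) := le_trans g3 g4
        have g6 := hi1 p hp
        rw [hip] at g6
        simp only [hE, not_exists, not_and, not_le] at g6
        have g7 := g6 _ f1 (by
          rw [pow_succ, ← hh, ← Int.ediv_ediv_of_nonneg hpos.le, ← Int.ediv_ediv_of_nonneg hpos.le, f2])
        rw [pow_succ, ← hh] at g7
        have g8 := same_ediv hpos f2
        have g9 := same_ediv hpos f2.symm
        refine ⟨f1, ?_, ?_, g5, by linarith⟩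
        · simp only [ht, hs] at g5 g8 g9 ⊢
          omega
        · simp only [ht, hs] at g5 g8 g9 ⊢
          omega
      have hc : (Q.filter (fun p => idx p = i + 1)).card
          ≤ ((tset Q + nX Q) ×ˢ (Finset.Ico (0:ℤ) 2)).card := by
        refine Finset.card_le_card_of_injOn (fun p => ((1 + p.1 - p.2 : ℤ) +
          (2 - (((F (t p / h)).1 + (F (t p / h)).2) - (p.1 + p.2)) : ℤ), (t p / h) % 2)) ?_ ?_
        · intro p hp
          simp only [Finset.coe_filter, Set.mem_ofPred_eq] at hp
          obtain ⟨f1, f2, f3, f4, f5⟩ := hprop p hp.1 hp.2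
          simp only [Finset.coe_product, Set.mem_prod, Finset.mem_coe]
          refine ⟨Finset.add_mem_add (Finset.mem_image_of_mem _ hp.1) (mem_nX hp.1 f1 ⟨f2, f3⟩), ?_⟩
          rw [Finset.mem_Ico]; omega
        · intro p hp q hq hpq
          simp only [Finset.coe_filter, Set.mem_ofPred_eq, Prod.mk.injEq] at hp hq hpq
          obtain ⟨f1, f2, f3, f4, f5⟩ := hprop p hp.1 hp.2
          obtain ⟨g1, g2, g3, g4, g5⟩ := hprop q hq.1 hq.2
          obtain ⟨e1, e2⟩ := hpq
          have k1 : t p / h ≤ t q / h + 1 := ediv_near hpos (by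
            simp only [ht, hs] at *; linarith)
          have k2 : t q / h ≤ t p / h + 1 := ediv_near hpos (by
            simp only [ht, hs] at *; linarith)
          have k3 : t p / h = t q / h := by omega
          rw [k3] at e1
          exact hg.inj _ hp.1 _ hq.1 (by omega)
      rw [Finset.card_product, Int.card_Ico] at hc
      simp at hc
      omega
  calc _ ≤ ∑ i ∈ Finset.range (K+1), 2 * (tset Q + nX Q).card := Finset.sum_le_sum key
    _ = 2 * (K + 1) * (tset Q + nX Q).card := by
      rw [Finset.sum_const, Finset.card_range, smul_eq_mul]; ring

def Msum (Q : ℕ → Finset (ℕ × ℕ)) : ℕ → Finset ℤ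
  | 0 => {0}
  | j+1 => Msum Q j + nX (Q j)

lemma msum_HA {R : SimpleGraph ℕ} {n m : ℕ} {P : Finset (ℕ × ℕ)} (hg : Good R n m P)
    (Q : ℕ → Finset (ℕ × ℕ)) (b : ℕ) (hQ : ∀ i < b, Q i ⊆ P)
    (hsep : ∀ i j, i < j → j < b → ∀ q ∈ Q i, ∀ w ∈ Q j, q.1 < w.1 ∧ w.2 < q.2) :
    ∀ j ≤ b, ∀ W ⊆ P, (∀ i < j, ∀ q ∈ Q i, ∀ w ∈ W, q.1 < w.1 ∧ w.2 < q.2) →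
      ∀ v, HAm R W v → ∀ x ∈ Msum Q j, HAm R P (v + x) := by
  intro j
  induction j with
  | zero =>
    intro _ W hW _ v hv x hx
    simp only [Msum, Finset.mem_singleton] at hx
    subst hx
    rw [add_zero]
    exact hv.mono hW
  | succ j ih =>
    intro hj W hW hs v hv x hx
    simp only [Msum] at hx
    obtain ⟨y, hy, z, hz, rfl⟩ := Finset.mem_add.mp hx
    unfold nX at hz
    rw [Finset.mem_insert] at hz
    rcases hz with rfl | hz
    · rw [add_zero]
      exact ih (by omega) W hW (fun i hi => hs i (by omega)) v hv y hy
    · obtain ⟨⟨e, f⟩, hef, rfl⟩ := Finset.mem_image.mp hz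
      rw [Finset.mem_filter, Finset.mem_product] at hef
      have h1 := hg.se_step (hQ j (by omega)) hW hef.1.1 hef.1.2 (hs j (by omega)) hef.2 hv
      have h2 := ih (by omega) (W ∪ Q j) (Finset.union_subset hW (hQ j (by omega))) (by
        intro i hi q hq w hw
        rcases Finset.mem_union.mp hw with hw | hw
        · exact hs i (by omega) q hq w hw
        · exact hsep i j hi (by omega) q hq w hw) _ h1 y hy
      convert h2 using 1
      simp only
      ring

lemma success {R : SimpleGraph ℕ} {n m : ℕ} {P : Finset (ℕ × ℕ)} (hg : Good R n m P)
    (Q : ℕ → Finset (ℕ × ℕ)) (b K : ℕ) (hQ : ∀ i < b + 1, Q i ⊆ P)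
    (hne : ∀ i < b + 1, (Q i).Nonempty)
    (hsep : ∀ i j, i < j → j < b + 1 → ∀ q ∈ Q i, ∀ w ∈ Q j, q.1 < w.1 ∧ w.2 < q.2)
    (hb : 2 * n + 1 < 2 ^ b) (hK : 2 * n ≤ 2 ^ K) :
    ∃ j < b + 1, (Q j).card ≤ 4 * (K + 1) * (HA R n P).card := by
  have h1 := msum_HA hg Q (b+1) hQ hsep
  have hT : ∀ j < b + 1, tset (Q j) + Msum Q j ⊆ HA R n P := by
    intro j hj v hv
    obtain ⟨y, hy, z, hz, rfl⟩ := Finset.mem_add.mp hv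
    obtain ⟨p, hp, rfl⟩ := Finset.mem_image.mp hy
    rw [hg.mem_HA]
    refine h1 j (by omega) (Q j) (hQ j hj) (fun i hi => hsep i j hi hj) _ ?_ z hz
    have hgj := hg.mono (hQ j hj)
    rw [← hgj.mem_HA]
    exact hgj.single hp
  have hM : ∀ j, (Msum Q j).Nonempty := by
    intro j
    induction j with
    | zero => exact ⟨0, by simp [Msum]⟩
    | succ j ih => exact ih.add ⟨0, zero_mem_nX _⟩
  have hMc : ∀ j < b + 1, (Msum Q j).card ≤ 2 * n + 1 := by
    intro j hj
    have h2 := Finset.card_le_card (hT j hj)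
    have h3 : (Msum Q j).card ≤ (tset (Q j) + Msum Q j).card :=
      Finset.card_le_card_add_left ((hne j hj).image _)
    have h4 := HA_card_le R n P
    omega
  obtain ⟨j, hj, hj2⟩ : ∃ j < b, (Msum Q (j+1)).card ≤ 2 * (Msum Q j).card := by
    by_contra hc
    push Not at hc
    have : ∀ j ≤ b, 2 ^ j ≤ (Msum Q j).card := by
      intro j
      induction j with
      | zero => intro _; simp [Msum]
      | succ j ih =>
        intro hj
        have h2 := hc j (by omega)
        have h3 := ih (by omega)
        rw [pow_succ]
        omega
    have h2 := this b le_rfl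
    have h3 := hMc b (by omega)
    omega
  refine ⟨j, by omega, ?_⟩
  have r := Finset.ruzsa_triangle_inequality_add_add_add (tset (Q j)) (Msum Q j) (nX (Q j))
  have r2 := Finset.card_le_card (hT j (by omega))
  have r3 : (tset (Q j) + nX (Q j)).card * (Msum Q j).card ≤
      (2 * (HA R n P).card) * (Msum Q j).card := by
    calc _ ≤ _ := r
      _ ≤ (HA R n P).card * (2 * (Msum Q j).card) := Nat.mul_le_mul r2 hj2
      _ = _ := by ring
  have r4 := Nat.le_of_mul_le_mul_right r3 (Finset.card_pos.mpr (hM j))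
  have z := lemmaZ (hg.mono (hQ j (by omega))) K hK
  calc _ ≤ _ := z
    _ ≤ 2 * (K + 1) * (2 * (HA R n P).card) := Nat.mul_le_mul_left _ r4
    _ = _ := by ring

def NE (p q : ℕ × ℕ) : Prop := p.1 < q.1 ∧ p.2 < q.2

def NEchain (C : Finset (ℕ × ℕ)) : Prop := ∀ p ∈ C, ∀ q ∈ C, p ≠ q → NE p q ∨ NE q p

open Classical in
noncomputable def cc (P : Finset (ℕ × ℕ)) : ℕ := (P.powerset.filter NEchain).sup Finset.card

lemma le_cc {P C : Finset (ℕ × ℕ)} (hC : C ⊆ P) (h : NEchain C) : C.card ≤ cc P := by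
  classical
  unfold cc
  exact Finset.le_sup (f := Finset.card) (by simp [hC, h])

lemma cc_exists (P : Finset (ℕ × ℕ)) : ∃ C ⊆ P, NEchain C ∧ C.card = cc P := by
  classical
  have hne : (P.powerset.filter NEchain).Nonempty := ⟨∅, by simp [NEchain]⟩
  obtain ⟨C, hC, hC2⟩ := Finset.exists_mem_eq_sup _ hne Finset.card
  rw [Finset.mem_filter, Finset.mem_powerset] at hC
  exact ⟨C, hC.1, hC.2, hC2.symm⟩

lemma cc_mono {P Q : Finset (ℕ × ℕ)} (h : Q ⊆ P) : cc Q ≤ cc P := by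
  obtain ⟨C, h1, h2, h3⟩ := cc_exists Q
  rw [← h3]
  exact le_cc (h1.trans h) h2

lemma cc_add {P P1 P2 : Finset (ℕ × ℕ)} (h1 : P1 ⊆ P) (h2 : P2 ⊆ P)
    (h : ∀ p ∈ P1, ∀ q ∈ P2, NE p q) : cc P1 + cc P2 ≤ cc P := by
  classical
  obtain ⟨C, a1, a2, a3⟩ := cc_exists P1
  obtain ⟨D, b1, b2, b3⟩ := cc_exists P2
  have hd : Disjoint C D := by
    rw [Finset.disjoint_left]
    intro x hx hy
    have := (h x (a1 hx) x (b1 hy)).1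
    omega
  rw [← a3, ← b3, ← Finset.card_union_of_disjoint hd]
  refine le_cc (Finset.union_subset (a1.trans h1) (b1.trans h2)) ?_
  intro p hp q hq hpq
  rcases Finset.mem_union.mp hp with hp | hp <;> rcases Finset.mem_union.mp hq with hq | hq
  · exact a2 p hp q hq hpq
  · exact Or.inl (h p (a1 hp) q (b1 hq))
  · exact Or.inr (h q (a1 hq) p (b1 hp))
  · exact b2 p hp q hq hpq

lemma cc_pos {P : Finset (ℕ × ℕ)} (h : P.Nonempty) : 1 ≤ cc P := by
  obtain ⟨p, hp⟩ := h
  have := le_cc (P := P) (C := {p}) (by simpa using hp) (by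
    intro a ha b hb hab
    simp at ha hb
    exact absurd (ha.trans hb.symm) hab)
  simpa using this

lemma cc_empty : cc ∅ = 0 := by
  obtain ⟨C, a1, a2, a3⟩ := cc_exists ∅
  rw [← a3]
  simp [Finset.subset_empty.mp a1]

noncomputable def ww (R : SimpleGraph ℕ) (n : ℕ) (P : Finset (ℕ × ℕ)) : ℕ := (HA R n P).card - 1

lemma ww_mono {R : SimpleGraph ℕ} {n : ℕ} {P Q : Finset (ℕ × ℕ)} (h : Q ⊆ P) :
    ww R n Q ≤ ww R n P := by
  unfold ww
  have := Finset.card_le_card (HA_mono (R := R) (n := n) h)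
  omega

lemma ww_empty (R : SimpleGraph ℕ) (n : ℕ) : ww R n ∅ = 0 := by
  classical
  have : HA R n ∅ = ∅ := by
    unfold HA
    rw [Finset.filter_eq_empty_iff]
    rintro x - ⟨p, hp, -⟩
    simp at hp
  unfold ww
  rw [this]; simp

lemma ww_add {R : SimpleGraph ℕ} {n m : ℕ} {P P1 P2 : Finset (ℕ × ℕ)} (h : Good R n m P)
    (h1 : P1 ⊆ P) (h2 : P2 ⊆ P) {e : ℕ × ℕ} (he : e ∈ P)
    (k1 : ∀ p ∈ P1, NE p e) (k2 : ∀ p ∈ P2, NE e p) :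
    ww R n P1 + ww R n P2 ≤ ww R n P := by
  by_cases hp1 : P1 = ∅
  · rw [hp1, ww_empty, zero_add]; exact ww_mono h2
  by_cases hp2 : P2 = ∅
  · rw [hp2, ww_empty, add_zero]; exact ww_mono h1
  have n1 : (HA R n P1).Nonempty := by
    obtain ⟨p, hp⟩ := Finset.nonempty_iff_ne_empty.mpr hp1
    exact ⟨_, (h.mono h1).single hp⟩
  have n2 : (HA R n P2).Nonempty := by
    obtain ⟨p, hp⟩ := Finset.nonempty_iff_ne_empty.mpr hp2
    exact ⟨_, (h.mono h2).single hp⟩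
  have c := cauchy_davenport_add_of_linearOrder_isCancelAdd n1 n2
  have c2 : (HA R n P1 + HA R n P2).card ≤ (HA R n P).card := by
    refine Finset.card_le_card_of_injOn (fun v => v + (e.2 - e.1) + 1) ?_ ?_
    · intro v hv
      obtain ⟨v1, hv1, v2, hv2, rfl⟩ := Finset.mem_add.mp hv
      rw [(h.mono h1).mem_HA] at hv1
      rw [(h.mono h2).mem_HA] at hv2
      rw [Finset.mem_coe, h.mem_HA]
      exact h.ne_sum h1 h2 he k1 k2 hv1 hv2
    · intro a _ b _ hab
      simp only at hab
      omega
  have := n1.card_pos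
  have := n2.card_pos
  unfold ww
  omega

noncomputable def Phi (R : SimpleGraph ℕ) (n : ℕ) (P : Finset (ℕ × ℕ)) : ℕ := ww R n P + cc P

lemma Phi_mono {R : SimpleGraph ℕ} {n : ℕ} {P Q : Finset (ℕ × ℕ)} (h : Q ⊆ P) :
    Phi R n Q ≤ Phi R n P := Nat.add_le_add (ww_mono h) (cc_mono h)

lemma HA_le_Phi {R : SimpleGraph ℕ} {n : ℕ} {P : Finset (ℕ × ℕ)} (h : P.Nonempty) :
    (HA R n P).card ≤ Phi R n P := by
  have := cc_pos h
  unfold Phi ww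
  omega

lemma ne_list {R : SimpleGraph ℕ} {n m : ℕ} {P : Finset (ℕ × ℕ)} (h : Good R n m P)
    (κ : ℕ × ℕ → ℕ) (hκ : ∀ p ∈ P, ∀ q ∈ P, κ p < κ q → NE p q) (N : ℕ) :
    ∑ k ∈ Finset.range N, Phi R n (P.filter (fun p => κ p = k)) ≤ 2 * Phi R n P := by
  have hc : ∀ N, ∑ k ∈ Finset.range N, cc (P.filter (fun p => κ p = k)) ≤
      cc (P.filter (fun p => κ p < N)) := by
    intro N
    induction N with
    | zero => simp
    | succ N ih =>
      rw [Finset.sum_range_succ]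
      refine (Nat.add_le_add_right ih _).trans (cc_add ?_ ?_ ?_)
      · intro p hp; rw [Finset.mem_filter] at *; exact ⟨hp.1, by omega⟩
      · intro p hp; rw [Finset.mem_filter] at *; exact ⟨hp.1, by omega⟩
      · intro p hp q hq; rw [Finset.mem_filter] at *
        exact hκ p hp.1 q hq.1 (by omega)
  have hw : ∀ N, (∑ k ∈ Finset.range N, ww R n (P.filter (fun p => κ p = k)) = 0 ∧
      ∀ p ∈ P, ¬ κ p < N) ∨
      ∃ e ∈ P, κ e < N ∧ ∑ k ∈ Finset.range N, ww R n (P.filter (fun p => κ p = k)) ≤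
      ww R n (P.filter (fun p => κ p < N)) + ww R n (P.filter (fun p => κ p < κ e)) := by
    intro N
    induction N with
    | zero => left; simp
    | succ N ih =>
      by_cases hN : ∃ f ∈ P, κ f = N
      · right
        obtain ⟨f, hf, hfN⟩ := hN
        refine ⟨f, hf, by omega, ?_⟩
        rw [Finset.sum_range_succ, hfN]
        rcases ih with ⟨ih, _⟩ | ⟨e, he, heN, ih⟩
        · rw [ih, zero_add]
          refine le_trans (ww_mono ?_) (Nat.le_add_right _ _)
          intro p hp; rw [Finset.mem_filter] at *; exact ⟨hp.1, by omega⟩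
        · have := ww_add (h.mono (Finset.filter_subset (fun p => κ p < N + 1) P))
            (P1 := P.filter (fun p => κ p < κ e)) (P2 := P.filter (fun p => κ p = N)) (e := e)
            (by intro p hp; rw [Finset.mem_filter] at *; exact ⟨hp.1, by omega⟩)
            (by intro p hp; rw [Finset.mem_filter] at *; exact ⟨hp.1, by omega⟩)
            (by rw [Finset.mem_filter]; exact ⟨he, by omega⟩)
            (by intro p hp; rw [Finset.mem_filter] at *; exact hκ _ hp.1 _ he hp.2)
            (by intro p hp; rw [Finset.mem_filter] at *; exact hκ _ he _ hp.1 (by omega))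
          omega
      · push Not at hN
        have e1 : P.filter (fun p => κ p = N) = ∅ := by
          rw [Finset.filter_eq_empty_iff]; exact fun {p} hp => hN p hp
        have e2 : P.filter (fun p => κ p < N + 1) = P.filter (fun p => κ p < N) := by
          apply Finset.filter_congr
          intro p hp
          have := hN p hp
          omega
        rw [Finset.sum_range_succ, e1, ww_empty, add_zero, e2]
        rcases ih with ⟨ih, ih2⟩ | ⟨e, he, heN, ih⟩
        · left
          refine ⟨ih, fun p hp => ?_⟩
          have := hN p hp
          have := ih2 p hp
          omega
        · right; exact ⟨e, he, by omega, ih⟩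
  unfold Phi
  rw [Finset.sum_add_distrib]
  have a1 := (hc N).trans (cc_mono (Finset.filter_subset _ P))
  have a2 : ∑ k ∈ Finset.range N, ww R n (P.filter (fun p => κ p = k)) ≤ 2 * ww R n P := by
    rcases hw N with h1 | ⟨e, he, h1, h2⟩
    · rw [h1.1]; omega
    · have b1 := ww_mono (R := R) (n := n) (Finset.filter_subset (fun p => κ p < N) P)
      have b2 := ww_mono (R := R) (n := n) (Finset.filter_subset (fun p => κ p < κ e) P)
      omega
  omega

lemma mirsky {α : Type*} (r : α → α → Prop) (htr : ∀ a b c, r a b → r b c → r a c) (b : ℕ) :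
    ∀ S : Finset α, (∃ g : ℕ → α, (∀ i < b + 1, g i ∈ S) ∧
      ∀ i j, i < j → j < b + 1 → r (g i) (g j)) ∨
      ∃ A ⊆ S, (∀ p ∈ A, ∀ q ∈ A, ¬ r p q) ∧ S.card ≤ b * A.card := by
  classical
  induction b with
  | zero =>
    intro S
    by_cases hS : S = ∅
    · right; exact ⟨∅, by simp, by simp, by simp [hS]⟩
    · left
      obtain ⟨p, hp⟩ := Finset.nonempty_iff_ne_empty.mpr hS
      exact ⟨fun _ => p, fun _ _ => hp, fun i j h1 h2 => by omega⟩
  | succ b ih =>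
    intro S
    set A0 := S.filter (fun p => ∀ q ∈ S, ¬ r q p) with hA0
    rcases ih (S \ A0) with ⟨g, g1, g2⟩ | ⟨A, a1, a2, a3⟩
    · left
      have h0 := g1 0 (by omega)
      rw [Finset.mem_sdiff, hA0, Finset.mem_filter] at h0
      obtain ⟨q, hq, hq2⟩ : ∃ q ∈ S, r q (g 0) := by
        by_contra hc
        push Not at hc
        exact h0.2 ⟨h0.1, hc⟩
      refine ⟨fun i => if i = 0 then q else g (i-1), ?_, ?_⟩
      · intro i hi
        rcases i with _ | i
        · simpa using hq
        · have := g1 i (by omega)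
          simp only [Nat.add_one_ne_zero, if_false, Nat.add_sub_cancel]
          exact (Finset.mem_sdiff.mp this).1
      · intro i j hij hj
        rcases j with _ | j
        · omega
        rcases i with _ | i
        · simp only [Nat.add_one_ne_zero, if_false, Nat.add_sub_cancel, if_true]
          rcases j with _ | j
          · exact hq2
          · exact htr _ _ _ hq2 (g2 0 (j+1) (by omega) (by omega))
        · simp only [Nat.add_one_ne_zero, if_false, Nat.add_sub_cancel]
          exact g2 i j (by omega) (by omega)
    · right
      have hc : S.card = A0.card + (S \ A0).card := by
        have := Finset.card_sdiff_add_card_eq_card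
          (show A0 ⊆ S from Finset.filter_subset _ _)
        omega
      by_cases hle : A0.card ≤ A.card
      · refine ⟨A, a1.trans Finset.sdiff_subset, a2, ?_⟩
        rw [hc]; nlinarith
      · refine ⟨A0, Finset.filter_subset _ _, ?_, ?_⟩
        · intro p hp q hq
          rw [hA0, Finset.mem_filter] at hp hq
          exact hq.2 p hp.1
        · rw [hc]
          push Not at hle
          have := Nat.mul_le_mul_left b hle.le
          nlinarith

lemma heavy {α β : Type*} [DecidableEq β] (P : Finset α) (κ : α → β) (T : Finset β)
    (hT : ∀ p ∈ P, κ p ∈ T) :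
    P.card ≤ 2 * (P.filter (fun p => P.card ≤ 2 * T.card *
      (P.filter (fun q => κ q = κ p)).card)).card := by
  classical
  set H := P.filter (fun p => P.card ≤ 2 * T.card * (P.filter (fun q => κ q = κ p)).card) with hH
  set L := P.filter (fun p => ¬ P.card ≤ 2 * T.card * (P.filter (fun q => κ q = κ p)).card) with hL
  have h1 : H.card + L.card = P.card := Finset.card_filter_add_card_filter_not _
  have h2 : L.card = ∑ k ∈ T, (L.filter (fun p => κ p = k)).card :=
    Finset.card_eq_sum_card_fiberwise (fun p hp => hT p (Finset.mem_filter.mp hp).1)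
  have h3 : ∀ k ∈ T, 2 * T.card * (L.filter (fun p => κ p = k)).card ≤ P.card := by
    intro k hk
    by_cases he : L.filter (fun p => κ p = k) = ∅
    · rw [he]; simp
    · obtain ⟨p, hp⟩ := Finset.nonempty_iff_ne_empty.mpr he
      rw [Finset.mem_filter, hL, Finset.mem_filter] at hp
      obtain ⟨⟨hp1, hp2⟩, rfl⟩ := hp
      have : (L.filter (fun q => κ q = κ p)).card ≤ (P.filter (fun q => κ q = κ p)).card :=
        Finset.card_le_card (Finset.filter_subset_filter _ (Finset.filter_subset _ _))
      have := Nat.mul_le_mul_left (2 * T.card) this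
      omega
  have h4 : 2 * T.card * L.card ≤ T.card * P.card := by
    rw [h2, Finset.mul_sum]
    refine (Finset.sum_le_sum h3).trans ?_
    simp
  by_cases hT0 : T.card = 0
  · have : P = ∅ := by
      by_contra hc
      obtain ⟨p, hp⟩ := Finset.nonempty_iff_ne_empty.mpr hc
      have := hT p hp
      rw [Finset.card_eq_zero.mp hT0] at this
      simp at this
    simp [this]
  · have : T.card * (2 * L.card) ≤ T.card * P.card := by
      calc _ = 2 * T.card * L.card := by ring
        _ ≤ _ := h4
    have := Nat.le_of_mul_le_mul_left this (by omega)
    omega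

def rk {α : Type*} (P : Finset α) (f : α → ℕ) (p : α) : ℕ := (P.filter (fun q => f q < f p)).card

lemma rk_lt {α : Type*} {P : Finset α} {f : α → ℕ} {p q : α} (h : rk P f p < rk P f q) :
    f p < f q := by
  by_contra hc
  push Not at hc
  have : rk P f q ≤ rk P f p := by
    apply Finset.card_le_card
    intro x hx
    rw [Finset.mem_filter] at *
    exact ⟨hx.1, by omega⟩
  omega

lemma rk_div_lt {α : Type*} {P : Finset α} {f : α → ℕ} {M : ℕ} {p q : α}
    (h : rk P f p / M < rk P f q / M) : f p < f q := by
  apply rk_lt (P := P)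
  by_contra hc
  push Not at hc
  have := Nat.div_le_div_right (c := M) hc
  omega

lemma rk_lt_card {α : Type*} {P : Finset α} {f : α → ℕ} {p : α} (hp : p ∈ P) :
    rk P f p < P.card := by
  apply Finset.card_lt_card
  refine ⟨Finset.filter_subset _ _, fun h => ?_⟩
  have := h hp
  rw [Finset.mem_filter] at this
  omega

lemma rk_class {α : Type*} (P : Finset α) (f : α → ℕ) (M : ℕ) (hM : 0 < M)
    (hf : ∀ y, (P.filter (fun p => f p = y)).card ≤ M) (k : ℕ) :
    (P.filter (fun p => rk P f p / M = k)).card ≤ 2 * M := by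
  classical
  set C := P.filter (fun p => rk P f p / M = k) with hC
  by_cases he : C = ∅
  · rw [he]; simp
  have hne := Finset.nonempty_iff_ne_empty.mpr he
  obtain ⟨p, hp, hp2⟩ := Finset.exists_max_image C f hne
  obtain ⟨q, hq, hq2⟩ := Finset.exists_min_image C f hne
  have e1 : C ⊆ P.filter (fun x => f x = f p) ∪ C.filter (fun x => f x < f p) := by
    intro x hx
    have := hp2 x hx
    rw [Finset.mem_union, Finset.mem_filter, Finset.mem_filter]
    rcases this.lt_or_eq with h | h
    · exact Or.inr ⟨hx, h⟩
    · exact Or.inl ⟨(Finset.mem_filter.mp hx).1, h⟩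
  have e2 := (Finset.card_le_card e1).trans (Finset.card_union_le _ _)
  have e3 := hf (f p)
  have e4 : rk P f q + (C.filter (fun x => f x < f p)).card ≤ rk P f p := by
    unfold rk
    rw [← Finset.card_union_of_disjoint]
    · apply Finset.card_le_card
      intro x hx
      rw [Finset.mem_union, Finset.mem_filter, Finset.mem_filter] at hx
      rw [Finset.mem_filter]
      rcases hx with hx | hx
      · have := hq2 p hp
        exact ⟨hx.1, by omega⟩
      · exact ⟨(Finset.mem_filter.mp hx.1).1, hx.2⟩
    · rw [Finset.disjoint_left]
      intro x hx hy
      rw [Finset.mem_filter] at hx hy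
      have := hq2 x hy.1
      omega
  have e5 := (Finset.mem_filter.mp hp).2
  have e6 := (Finset.mem_filter.mp hq).2
  have e7 : rk P f p < M * (k + 1) := by
    rw [← e5]; exact Nat.lt_mul_div_succ _ hM
  have e8 : M * k ≤ rk P f q := by rw [← e6]; exact Nat.mul_div_le _ _
  have : M * (k+1) = M * k + M := by ring
  omega

lemma group_bound {R : SimpleGraph ℕ} {n m : ℕ} {P : Finset (ℕ × ℕ)} (h : Good R n m P)
    (κ : ℕ × ℕ → ℕ) (hκ : ∀ p ∈ P, ∀ q ∈ P, κ p < κ q → NE p q) (N : ℕ) (hN : ∀ p ∈ P, κ p < N)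
    (X : ℕ) (hX : ∀ k, (P.filter (fun p => κ p = k)).card ≤
      X * Phi R n (P.filter (fun p => κ p = k))) :
    P.card ≤ X * (2 * Phi R n P) := by
  rw [Finset.card_eq_sum_card_fiberwise (t := Finset.range N) (f := κ)
    (fun p hp => Finset.mem_coe.mpr (Finset.mem_range.mpr (hN p hp)))]
  calc _ ≤ ∑ k ∈ Finset.range N, X * Phi R n (P.filter (fun p => κ p = k)) :=
        Finset.sum_le_sum (fun k _ => hX k)
    _ = X * ∑ k ∈ Finset.range N, Phi R n (P.filter (fun p => κ p = k)) := by
        rw [Finset.mul_sum]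
    _ ≤ _ := Nat.mul_le_mul_left _ (ne_list h κ hκ N)

theorem main_ind {R : SimpleGraph ℕ} {n m : ℕ} (D b K : ℕ) (hD : 0 < D)
    (hb : 2 * n + 1 < 2 ^ b) (hK : 2 * n ≤ 2 ^ K) (j : ℕ) :
    ∀ P : Finset (ℕ × ℕ), Good R n m P → P.card ≤ 2 * D ^ j →
      P.card ≤ (32 * D ^ 2 * (K + 1)) * (8 * b) ^ j * Phi R n P := by
  classical
  have hb0 : 0 < b := by
    rcases b with _ | b
    · simp at hb
    · omega
  induction j with
  | zero =>
    intro P hg hP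
    by_cases he : P = ∅
    · simp [he]
    have h1 := cc_pos (Finset.nonempty_iff_ne_empty.mpr he)
    have h2 : 1 ≤ Phi R n P := by unfold Phi; omega
    have h3 : 1 ≤ D ^ 2 * (K + 1) := Nat.mul_pos (by positivity) (by omega)
    simp only [pow_zero, mul_one] at hP ⊢
    nlinarith
  | succ j ih =>
    intro P hg hP
    by_cases he : P = ∅
    · simp [he]
    have hne := Finset.nonempty_iff_ne_empty.mpr he
    set ρ := 32 * D ^ 2 * (K + 1) with hρ
    set M := D ^ j with hM
    have hM0 : 0 < M := by positivity
    have hPM : P.card ≤ 2 * D * M := by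
      rw [pow_succ, ← hM] at hP
      calc _ ≤ _ := hP
        _ = _ := by ring
    -- reduce success cases
    have hsucc : P.card ≤ ρ * (HA R n P).card →
        P.card ≤ ρ * (8 * b) ^ (j+1) * Phi R n P := by
      intro h
      have h1 : 1 ≤ (8 * b) ^ (j+1) := Nat.one_le_pow _ _ (by omega)
      calc _ ≤ _ := h
        _ ≤ ρ * Phi R n P := Nat.mul_le_mul_left _ (HA_le_Phi hne)
        _ = ρ * 1 * Phi R n P := by ring
        _ ≤ _ := Nat.mul_le_mul_right _ (Nat.mul_le_mul_left _ h1)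
    by_cases hmul : ∃ y, M < (P.filter (fun p => p.2 = y)).card
    · obtain ⟨y, hy⟩ := hmul
      apply hsucc
      have h1 : (P.filter (fun p => p.2 = y)).card ≤ (HA R n P).card := by
        refine Finset.card_le_card_of_injOn (fun p => (1 + p.1 - p.2 : ℤ)) ?_ ?_
        · intro p hp
          exact hg.single (Finset.mem_filter.mp hp).1
        · intro p hp q hq hpq
          have hp := Finset.mem_filter.mp hp
          have hq := Finset.mem_filter.mp hq
          simp only at hpq
          have e1 := hp.2
          have e2 := hq.2
          exact hg.inj _ hp.1 _ hq.1 (by omega)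
      have h2 : 2 * D ≤ ρ := by
        rw [hρ]
        have h3 : D ≤ D ^ 2 := by nlinarith
        have h4 : D ^ 2 ≤ D ^ 2 * (K + 1) := Nat.le_mul_of_pos_right _ (by omega)
        nlinarith
      calc _ ≤ _ := hPM
        _ ≤ ρ * (HA R n P).card := Nat.mul_le_mul h2 (by omega)
    push Not at hmul
    have hmulx : ∀ x, (P.filter (fun p => p.1 = x)).card ≤ M := by
      intro x
      refine le_trans ?_ hM0
      rw [Finset.card_le_one]
      intro p hp q hq
      rw [Finset.mem_filter] at hp hq
      exact hg.inj _ hp.1 _ hq.1 (by omega)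
    set col : ℕ × ℕ → ℕ := fun p => rk P Prod.fst p / M with hcol
    set row : ℕ × ℕ → ℕ := fun p => rk P Prod.snd p / M with hrow
    have hcol1 : ∀ p q, col p < col q → p.1 < q.1 := fun p q h => rk_div_lt h
    have hrow1 : ∀ p q, row p < row q → p.2 < q.2 := fun p q h => rk_div_lt h
    have hcol2 : ∀ p ∈ P, col p < 2 * D := by
      intro p hp
      apply Nat.div_lt_of_lt_mul
      have := rk_lt_card (f := Prod.fst) hp
      rw [mul_comm]; omega
    have hrow2 : ∀ p ∈ P, row p < 2 * D := by
      intro p hp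
      apply Nat.div_lt_of_lt_mul
      have := rk_lt_card (f := Prod.snd) hp
      rw [mul_comm]; omega
    have hcol3 : ∀ k, (P.filter (fun p => col p = k)).card ≤ 2 * M :=
      rk_class P Prod.fst M hM0 hmulx
    have hrow3 : ∀ k, (P.filter (fun p => row p = k)).card ≤ 2 * M :=
      rk_class P Prod.snd M hM0 hmul
    set T := Finset.range (2 * D) ×ˢ Finset.range (2 * D) with hT
    have hTc : T.card = 4 * D ^ 2 := by rw [hT]; simp; ring
    have hv := heavy P (fun p => (col p, row p)) T (by
      intro p hp
      simp only [hT, Finset.mem_product, Finset.mem_range]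
      exact ⟨hcol2 p hp, hrow2 p hp⟩)
    set H := P.filter (fun p => P.card ≤ 2 * T.card *
      (P.filter (fun q => (col q, row q) = (col p, row p))).card) with hH
    rcases mirsky (fun p q => col p < col q ∧ row q < row p) (by
      intro a b c h1 h2; omega) b H with ⟨g, g1, g2⟩ | ⟨A, a1, a2, a3⟩
    · apply hsucc
      have hgP : ∀ i < b + 1, g i ∈ P := fun i hi => (Finset.mem_filter.mp (g1 i hi)).1
      obtain ⟨i, hi, hi2⟩ := success hg
        (fun i => P.filter (fun q => (col q, row q) = (col (g i), row (g i)))) b K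
        (fun i hi => Finset.filter_subset _ _)
        (fun i hi => ⟨g i, by simp [hgP i hi]⟩) (by
          intro i k hik hk q hq w hw
          simp only [Finset.mem_filter, Prod.mk.injEq] at hq hw
          have := g2 i k hik hk
          exact ⟨hcol1 _ _ (by omega), hrow1 _ _ (by omega)⟩) hb hK
      have h3 := (Finset.mem_filter.mp (g1 i hi)).2
      calc _ ≤ _ := h3
        _ ≤ 2 * T.card * (4 * (K + 1) * (HA R n P).card) := Nat.mul_le_mul_left _ hi2
        _ = ρ * (HA R n P).card := by rw [hTc, hρ]; ring
    · have hAP : A ⊆ P := a1.trans (Finset.filter_subset _ _)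
      have hcomb : ∀ A' ⊆ A, ∀ κ : ℕ × ℕ → ℕ, (∀ p ∈ A', ∀ q ∈ A', κ p < κ q → NE p q) →
          (∀ p ∈ P, κ p < 2 * D) → (∀ k, (P.filter (fun p => κ p = k)).card ≤ 2 * M) →
          A'.card ≤ ρ * (8 * b) ^ j * (2 * Phi R n P) := by
        intro A' hA' κ k1 k2 k3
        have hA'P := hA'.trans hAP
        have := group_bound (hg.mono hA'P) κ k1 (2 * D) (fun p hp => k2 p (hA'P hp))
          (ρ * (8 * b) ^ j) (by
            intro k
            refine ih _ (hg.mono ((Finset.filter_subset _ _).trans hA'P)) ?_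
            exact (Finset.card_le_card (Finset.filter_subset_filter _ hA'P)).trans (k3 k))
        refine this.trans (Nat.mul_le_mul_left _ ?_)
        have := Phi_mono (R := R) (n := n) hA'P
        omega
      set A1 := A.filter (fun p => ∃ q ∈ A, row q = row p ∧ col p < col q) with hA1
      set A2 := A.filter (fun p => ¬ ∃ q ∈ A, row q = row p ∧ col p < col q) with hA2
      have hsum : A1.card + A2.card = A.card := Finset.card_filter_add_card_filter_not _
      have c1 := hcomb A1 (Finset.filter_subset _ _) row (by
        intro p hp q hq hpq
        rw [hA1, Finset.mem_filter] at hp hq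
        obtain ⟨hp, p', hp', e1, e2⟩ := hp
        have := a2 q hq.1 p' hp'
        exact ⟨hcol1 _ _ (by omega), hrow1 _ _ hpq⟩) hrow2 hrow3
      have c2 := hcomb A2 (Finset.filter_subset _ _) col (by
        intro p hp q hq hpq
        rw [hA2, Finset.mem_filter] at hp hq
        have h1 := a2 p hp.1 q hq.1
        have h2 : row q ≠ row p := fun h => hp.2 ⟨q, hq.1, h, hpq⟩
        exact ⟨hcol1 _ _ hpq, hrow1 _ _ (by omega)⟩) hcol2 hcol3
      set Y := ρ * (8 * b) ^ j * (2 * Phi R n P) with hY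
      have c3 : A.card ≤ 2 * Y := by omega
      calc P.card ≤ 2 * H.card := hv
        _ ≤ 2 * (b * A.card) := Nat.mul_le_mul_left _ a3
        _ ≤ 2 * (b * (2 * Y)) := Nat.mul_le_mul_left _ (Nat.mul_le_mul_left _ c3)
        _ = _ := by rw [hY, pow_succ]; ring

open Classical in
noncomputable def Ls (R : SimpleGraph ℕ) (n u w : ℕ) : Finset ℕ :=
  (Finset.range n).filter (fun l => Pth R u w (Set.Icc u w) l)

lemma mem_Ls {R : SimpleGraph ℕ} {n u w l : ℕ} (hw : w < n) :
    l ∈ Ls R n u w ↔ Pth R u w (Set.Icc u w) l := by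
  classical
  unfold Ls
  rw [Finset.mem_filter, Finset.mem_range, and_iff_right_iff_imp]
  intro h
  exact h.length_lt (fun x hx => by rw [Set.mem_Icc] at hx; omega)

noncomputable def lamh (R : SimpleGraph ℕ) (n u v : ℕ) : ℕ :=
  if u < v then (Ls R n u (v-1)).card - 1 else 0

lemma lamh_add {R : SimpleGraph ℕ} {n u v w : ℕ} (hR : Ham R n) (huv : u ≤ v) (hvw : v ≤ w)
    (hw : w ≤ n) : lamh R n u v + lamh R n v w ≤ lamh R n u w := by
  rcases huv.eq_or_lt with rfl | h1
  · simp [lamh]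
  rcases hvw.eq_or_lt with rfl | h2
  · simp [lamh]
  unfold lamh
  rw [if_pos h1, if_pos h2, if_pos (h1.trans h2)]
  have n1 : (Ls R n u (v-1)).Nonempty :=
    ⟨_, (mem_Ls (by omega)).mpr (Pth.ivl hR (by omega) (by omega))⟩
  have n2 : (Ls R n v (w-1)).Nonempty :=
    ⟨_, (mem_Ls (by omega)).mpr (Pth.ivl hR (by omega) (by omega))⟩
  have c := cauchy_davenport_add_of_linearOrder_isCancelAdd n1 n2
  have c2 : (Ls R n u (v-1) + Ls R n v (w-1)).card ≤ (Ls R n u (w-1)).card := by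
    refine Finset.card_le_card_of_injOn (fun l => l + 1) ?_ ?_
    · intro l hl
      obtain ⟨l1, k1, l2, k2, rfl⟩ := Finset.mem_add.mp hl
      rw [mem_Ls (by omega)] at k1 k2
      rw [Finset.mem_coe, mem_Ls (by omega)]
      have ha : R.Adj (v-1) v := by
        have := hR (v-1) (by omega)
        rwa [Nat.sub_add_cancel (by omega)] at this
      have := (k1.concat ha k2 (by
        rw [Set.disjoint_left]; intro x hx hy
        simp only [Set.mem_Icc] at *; omega)).mono (T := Set.Icc u (w-1)) (by
        intro x hx
        simp only [Set.mem_union, Set.mem_Icc] at *; omega)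
      convert this using 1
      simp only
      omega
    · intro a _ b _ hab
      simpa using hab
  have := n1.card_pos
  have := n2.card_pos
  omega

lemma lamh_sum {R : SimpleGraph ℕ} {n : ℕ} (hR : Ham R n) (e : ℕ → ℕ) (he : Monotone e)
    (he2 : ∀ i, e i ≤ n) (I : ℕ) :
    ∑ i ∈ Finset.range I, lamh R n (e i) (e (i+1)) ≤ lamh R n (e 0) (e I) := by
  induction I with
  | zero => simp
  | succ I ih =>
    rw [Finset.sum_range_succ]
    exact (Nat.add_le_add_right ih _).trans
      (lamh_add hR (he (Nat.zero_le _)) (he (Nat.le_succ _)) (he2 _))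

lemma block {R : SimpleGraph ℕ} {n m : ℕ} {P : Finset (ℕ × ℕ)} (hg : Good R n m P) {u v : ℕ}
    (hv : v ≤ n) (hu : ∀ p ∈ P, u ≤ p.1) (hpv : ∀ p ∈ P, p.2 < v) :
    Phi R n P ≤ 4 * lamh R n u v := by
  classical
  by_cases he : P = ∅
  · unfold Phi; rw [he, ww_empty, cc_empty]; omega
  obtain ⟨p0, hp0⟩ := Finset.nonempty_iff_ne_empty.mpr he
  have q1 := hu _ hp0
  have q2 := hpv _ hp0
  have q3 := hg.gap _ hp0
  have q4 := hg.lt1 _ hp0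
  have q5 := hg.le2 _ hp0
  unfold lamh
  rw [if_pos (by omega)]
  set w := v - 1 with hw
  have hwn : w < n := by omega
  -- 2 lengths
  have h2 : 2 ≤ (Ls R n u w).card := by
    have m1 : w - u ∈ Ls R n u w := (mem_Ls hwn).mpr (Pth.ivl hg.ham (by omega) hwn)
    have m2 : (p0.1 - u) + 1 + (w - p0.2) ∈ Ls R n u w := by
      rw [mem_Ls hwn]
      refine ((Pth.ivl hg.ham q1 (by omega)).concat (hg.adj _ hp0)
        (Pth.ivl hg.ham (a := p0.2) (b := w) (by omega) hwn) ?_).mono ?_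
      · rw [Set.disjoint_left]; intro x hx hy
        simp only [Set.mem_Icc] at *; omega
      · intro x hx
        simp only [Set.mem_union, Set.mem_Icc] at *; omega
    have : ({w - u, (p0.1 - u) + 1 + (w - p0.2)} : Finset ℕ) ⊆ Ls R n u w := by
      intro x hx
      simp only [Finset.mem_insert, Finset.mem_singleton] at hx
      rcases hx with rfl | rfl
      · exact m1
      · exact m2
    have h3 := Finset.card_le_card this
    rwa [Finset.card_pair (by omega)] at h3
  have h1 : (HA R n P).card ≤ (Ls R n u w).card := by
    rw [← Finset.card_image_of_injective (HA R n P) (add_left_injective ((w:ℤ) - u)),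
      ← Finset.card_image_of_injective (Ls R n u w) (Nat.cast_injective (R := ℤ))]
    apply Finset.card_le_card
    intro x hx
    obtain ⟨z, hz, rfl⟩ := Finset.mem_image.mp hx
    rw [hg.mem_HA] at hz
    obtain ⟨a, ha, b, hb, c, hc, d, hd, l, hab, hcd, q, rfl⟩ := hz
    have x1 := hu _ ha
    have x2 := hpv _ hd
    have x3 := hg.lt1 _ hb
    have x4 := hg.le2 _ hc
    have r1 := (Pth.ivl hg.ham x1 (by omega)).join q (by
      intro x hx hy
      simp only [Set.mem_union, Set.mem_Icc] at *; omega)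
    have r2 := r1.join (Pth.ivl hg.ham (a := d.2) (b := w) (by omega) hwn) (by
      intro x hx hy
      simp only [Set.mem_union, Set.mem_Icc] at *; omega)
    refine Finset.mem_image.mpr ⟨_, (mem_Ls hwn).mpr (r2.mono ?_), ?_⟩
    · intro x hx
      simp only [Set.mem_union, Set.mem_Icc] at *; omega
    · omega
  have h3 : cc P ≤ (Ls R n u w).card + 1 := by
    obtain ⟨C, c1, c2, c3⟩ := cc_exists P
    rw [← c3]
    by_cases hC : C = ∅
    · simp [hC]
    obtain ⟨e, he, he2⟩ := Finset.exists_min_image C Prod.fst (Finset.nonempty_iff_ne_empty.mpr hC)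
    have key : (C.erase e).card ≤ (Ls R n u w).card := by
      refine Finset.card_le_card_of_injOn
        (fun f => (e.1 - u) + 1 + (e.2 - f.1) + 1 + (w - f.2)) ?_ ?_
      · intro f hf
        have hf := Finset.mem_erase.mp hf
        have hef : NE e f := by
          rcases c2 e he f hf.2 hf.1.symm with h | h
          · exact h
          · have := he2 f hf.2
            have := h.1
            omega
        obtain ⟨hef1, hef2⟩ := hef
        have x1 := hu _ (c1 he)
        have x2 := hpv _ (c1 hf.2)
        have x3 := hg.lt1 _ (c1 hf.2)
        have x4 := hg.le2 _ (c1 he)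
        rw [Finset.mem_coe, mem_Ls hwn]
        have r1 := (Pth.ivl hg.ham x1 (by omega)).concat (hg.adj _ (c1 he))
          (Pth.ivl hg.ham (a := f.1) (b := e.2) (by omega) (by omega)).symm (by
            rw [Set.disjoint_left]; intro x hx hy
            simp only [Set.mem_Icc] at *; omega)
        have r2 := r1.concat (hg.adj _ (c1 hf.2))
          (Pth.ivl hg.ham (a := f.2) (b := w) (by omega) hwn) (by
            rw [Set.disjoint_left]; intro x hx hy
            simp only [Set.mem_union, Set.mem_Icc] at *; omega)
        refine r2.mono ?_
        intro x hx
        simp only [Set.mem_union, Set.mem_Icc] at *; omega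
      · intro f hf g hg' hfg
        have hf := Finset.mem_erase.mp hf
        have hg' := Finset.mem_erase.mp hg'
        by_contra hne
        simp only at hfg
        have y1 := hpv _ (c1 hf.2)
        have y2 := hpv _ (c1 hg'.2)
        have y3 := hg.lt1 _ (c1 hf.2)
        have y4 := hg.lt1 _ (c1 hg'.2)
        have y5 := hg.le2 _ (c1 he)
        rcases c2 f hf.2 g hg'.2 hne with h | h
        · obtain ⟨z1, z2⟩ := h
          omega
        · obtain ⟨z1, z2⟩ := h
          omega
    rw [Finset.card_erase_of_mem he] at key
    omega
  unfold Phi ww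
  omega

set_option maxHeartbeats 1000000 in
theorem global_bound {R : SimpleGraph ℕ} {n : ℕ} (hR : Ham R n) (F : Finset ℕ) (φ : ℕ → ℕ)
    (hF : ∀ v ∈ F, v + 2 ≤ φ v ∧ φ v < n ∧ R.Adj v (φ v))
    (D b K J Lg : ℕ) (hD : 0 < D) (hb : 2 * n + 1 < 2 ^ b) (hK : 2 * n ≤ 2 ^ K)
    (hJ : n ≤ 2 * D ^ J) (hLg : n ≤ 2 ^ Lg) :
    F.card ≤ Lg * ((32 * D ^ 2 * (K + 1)) * (8 * b) ^ J * (4 * lamh R n 0 n)) := by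
  classical
  set X := (32 * D ^ 2 * (K + 1)) * (8 * b) ^ J with hX
  have hex : ∀ v ∈ F, ∃ j, v / 2 ^ j = φ v / 2 ^ j := by
    intro v hv
    obtain ⟨h1, h2, h3⟩ := hF v hv
    refine ⟨Lg, ?_⟩
    rw [Nat.div_eq_of_lt (by omega), Nat.div_eq_of_lt (by omega)]
  set lev : ℕ → ℕ := fun v => if h : ∃ j, v / 2 ^ j = φ v / 2 ^ j then Nat.find h - 1 else 0 with hlev
  have hl : ∀ v ∈ F, lev v < Lg ∧ v / 2 ^ (lev v + 1) = φ v / 2 ^ (lev v + 1) ∧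
      v / 2 ^ (lev v) ≠ φ v / 2 ^ (lev v) := by
    intro v hv
    obtain ⟨h1, h2, h3⟩ := hF v hv
    have h := hex v hv
    have e1 := Nat.find_spec h
    have e2 : Nat.find h ≠ 0 := by
      intro h0
      rw [h0] at e1
      simp at e1
      omega
    have e3 : lev v = Nat.find h - 1 := by simp only [hlev, dif_pos h]
    have e4 : lev v + 1 = Nat.find h := by omega
    refine ⟨?_, ?_, ?_⟩
    · have : Nat.find h ≤ Lg := Nat.find_min' h (by
        rw [Nat.div_eq_of_lt (by omega), Nat.div_eq_of_lt (by omega)])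
      omega
    · rw [e4]; exact e1
    · exact Nat.find_min h (by omega)
  have key : ∀ j ∈ Finset.range Lg, (F.filter (fun v => lev v = j)).card ≤
      X * (4 * lamh R n 0 n) := by
    intro j _
    set Fj := F.filter (fun v => lev v = j) with hFj
    set B := 2 ^ (j+1) with hB
    have hBpos : 0 < B := by positivity
    set e : ℕ → ℕ := fun i => min (i * B) n with hedef
    have hmap : ∀ v ∈ Fj, v / B ∈ Finset.range n := by
      intro v hv
      obtain ⟨h1, h2, h3⟩ := hF v (Finset.mem_filter.mp hv).1
      have := Nat.div_le_self v B
      rw [Finset.mem_range]; omega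
    have hblk : ∀ i ∈ Finset.range n, (Fj.filter (fun v => v / B = i)).card ≤
        X * (4 * lamh R n (e i) (e (i+1))) := by
      intro i _
      set S := Fj.filter (fun v => v / B = i) with hS
      set P := S.image (fun v => (v, φ v)) with hP
      have hPc : P.card = S.card := by
        apply Finset.card_image_of_injective
        intro a b hab
        simp only [Prod.mk.injEq] at hab
        exact hab.1
      have hprop : ∀ v ∈ S, v + 2 ≤ φ v ∧ φ v < n ∧ R.Adj v (φ v) ∧ i * B ≤ v ∧
          v < i * B + 2 ^ j ∧ i * B + 2 ^ j ≤ φ v ∧ φ v < (i + 1) * B := by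
        intro v hv
        rw [hS, Finset.mem_filter, hFj, Finset.mem_filter] at hv
        obtain ⟨⟨v1, v2⟩, v3⟩ := hv
        obtain ⟨h1, h2, h3⟩ := hF v v1
        obtain ⟨l1, l2, l3⟩ := hl v v1
        rw [v2] at l2 l3
        rw [← hB] at l2
        have v4 : φ v / B = i := by rw [← l2, v3]
        have hpow : 0 < 2 ^ j := by positivity
        have hB2 : B = 2 ^ j * 2 := by rw [hB, pow_succ]
        have d1 : v / 2 ^ j / 2 = i := by rw [Nat.div_div_eq_div_mul, ← hB2, v3]
        have d2 : φ v / 2 ^ j / 2 = i := by rw [Nat.div_div_eq_div_mul, ← hB2, v4]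
        have d3 : v / 2 ^ j ≤ φ v / 2 ^ j := Nat.div_le_div_right (by omega)
        have d4 : v / 2 ^ j = 2 * i := by omega
        have d5 : φ v / 2 ^ j = 2 * i + 1 := by omega
        have f1 := Nat.div_mul_le_self v (2 ^ j)
        have f2 := Nat.lt_mul_div_succ v hpow
        have f3 := Nat.div_mul_le_self (φ v) (2 ^ j)
        have f4 := Nat.lt_mul_div_succ (φ v) hpow
        rw [d4] at f1 f2
        rw [d5] at f3 f4
        refine ⟨h1, h2, h3, ?_, ?_, ?_, ?_⟩
        · rw [hB2]; generalize 2 ^ j = k at f1 f2 f3 f4 ⊢; clear * - f1 f2 f3 f4; linarith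
        · rw [hB2]; generalize 2 ^ j = k at f1 f2 f3 f4 ⊢; clear * - f1 f2 f3 f4; linarith
        · rw [hB2]; generalize 2 ^ j = k at f1 f2 f3 f4 ⊢; clear * - f1 f2 f3 f4; linarith
        · rw [hB2]; generalize 2 ^ j = k at f1 f2 f3 f4 ⊢; clear * - f1 f2 f3 f4; linarith
      have hgood : Good R n (i * B + 2 ^ j) P := by
        refine ⟨hR, ?_, ?_, ?_, ?_, ?_, ?_⟩
        · intro p hp
          obtain ⟨v, hv, rfl⟩ := Finset.mem_image.mp hp
          exact (hprop v hv).2.2.1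
        · intro p hp
          obtain ⟨v, hv, rfl⟩ := Finset.mem_image.mp hp
          exact (hprop v hv).2.2.2.2.1
        · intro p hp
          obtain ⟨v, hv, rfl⟩ := Finset.mem_image.mp hp
          exact (hprop v hv).2.2.2.2.2.1
        · intro p hp
          obtain ⟨v, hv, rfl⟩ := Finset.mem_image.mp hp
          exact (hprop v hv).2.1
        · intro p hp
          obtain ⟨v, hv, rfl⟩ := Finset.mem_image.mp hp
          exact (hprop v hv).1
        · intro p hp q hq hpq
          obtain ⟨v, hv, rfl⟩ := Finset.mem_image.mp hp
          obtain ⟨w, hw, rfl⟩ := Finset.mem_image.mp hq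
          simp only at hpq
          rw [hpq]
      have hPn : P.card ≤ n := by
        rw [hPc]
        have : S ⊆ Finset.range n := by
          intro v hv
          have := hprop v hv
          rw [Finset.mem_range]; omega
        have := Finset.card_le_card this
        rwa [Finset.card_range] at this
      have hm := main_ind D b K hD hb hK J P hgood (hPn.trans hJ)
      rw [hPc] at hm
      refine hm.trans (Nat.mul_le_mul_left _ (block hgood ?_ ?_ ?_))
      · exact min_le_right _ _
      · intro p hp
        obtain ⟨v, hv, rfl⟩ := Finset.mem_image.mp hp
        exact (min_le_left _ _).trans (hprop v hv).2.2.2.1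
      · intro p hp
        obtain ⟨v, hv, rfl⟩ := Finset.mem_image.mp hp
        exact lt_min (hprop v hv).2.2.2.2.2.2 (hprop v hv).2.1
    rw [Finset.card_eq_sum_card_fiberwise hmap]
    refine (Finset.sum_le_sum hblk).trans ?_
    rw [← Finset.mul_sum, ← Finset.mul_sum]
    refine Nat.mul_le_mul_left _ (Nat.mul_le_mul_left _ ?_)
    have hs := lamh_sum hR e (by
      intro a b hab
      exact min_le_min_right _ (Nat.mul_le_mul_right _ hab)) (fun i => min_le_right _ _) n
    have e0 : e 0 = 0 := by simp [hedef]
    have en : e n = n := by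
      simp only [hedef]
      exact min_eq_right (Nat.le_mul_of_pos_right _ hBpos)
    rwa [e0, en] at hs
  rw [Finset.card_eq_sum_card_fiberwise (t := Finset.range Lg) (f := lev)
    (fun v hv => Finset.mem_coe.mpr (Finset.mem_range.mpr (hl v hv).1))]
  refine (Finset.sum_le_sum key).trans ?_
  simp

def RG {V : Type} (G : SimpleGraph V) (vt : ℕ → V) (n : ℕ) : SimpleGraph ℕ where
  Adj i j := i < n ∧ j < n ∧ i ≠ j ∧ G.Adj (vt i) (vt j) ∧ ¬ (i = 0 ∧ j = n - 1) ∧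
    ¬ (j = 0 ∧ i = n - 1)
  symm := ⟨fun _ _ h => ⟨h.2.1, h.1, h.2.2.1.symm, h.2.2.2.1.symm, h.2.2.2.2.2, h.2.2.2.2.1⟩⟩
  loopless := ⟨fun _ h => h.2.2.1 rfl⟩

def RGhom {V : Type} (G : SimpleGraph V) (vt : ℕ → V) (n : ℕ) : RG G vt n →g G :=
  ⟨vt, fun h => h.2.2.2.1⟩

lemma cycle_of_Ls {V : Type} (G : SimpleGraph V) (vt : ℕ → V) (n : ℕ) (hn : 4 ≤ n)
    (inj : ∀ i < n, ∀ j < n, vt i = vt j → i = j) (close : G.Adj (vt (n-1)) (vt 0))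
    {l : ℕ} (hl : l ∈ Ls (RG G vt n) n 0 (n-1)) :
    ∃ (v : V) (p : G.Walk v v), p.IsCycle ∧ p.length = l + 1 := by
  rw [mem_Ls (by omega)] at hl
  obtain ⟨p, p1, p2, p3⟩ := hl
  have hsup : ∀ w ∈ p.support, w < n := by
    intro w hw
    have := p2 w hw
    rw [Set.mem_Icc] at this
    omega
  obtain ⟨q, hq1, hq2, hq3⟩ : ∃ q : G.Walk (vt 0) (vt (n-1)), q.support = p.support.map vt ∧
      q.edges = p.edges.map (Sym2.map vt) ∧ q.length = p.length :=
    ⟨p.map (RGhom G vt n), SimpleGraph.Walk.support_map _ _, SimpleGraph.Walk.edges_map _ _,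
      SimpleGraph.Walk.length_map _ _⟩
  refine ⟨vt (n-1), SimpleGraph.Walk.cons close q, ?_, ?_⟩
  · rw [SimpleGraph.Walk.cons_isCycle_iff]
    refine ⟨?_, ?_⟩
    · rw [SimpleGraph.Walk.isPath_def, hq1]
      refine List.Nodup.map_on ?_ p1.support_nodup
      intro x hx y hy hxy
      exact inj x (hsup x hx) y (hsup y hy) hxy
    · rw [hq2]
      intro h
      obtain ⟨e, he, he2⟩ := List.mem_map.mp h
      have he3 := p.edges_subset_edgeSet he
      induction e with
      | h x y =>
        rw [SimpleGraph.mem_edgeSet] at he3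
        have : s(vt x, vt y) = s(vt (n-1), vt 0) := he2
        rw [Sym2.eq_iff] at this
        obtain ⟨a1, a2, a3, a4, a5, a6⟩ := he3
        rcases this with ⟨h1, h2⟩ | ⟨h1, h2⟩
        · have := inj _ a1 _ (by omega) h1
          have := inj _ a2 _ (by omega) h2
          omega
        · have := inj _ a1 _ (by omega) h1
          have := inj _ a2 _ (by omega) h2
          omega
  · rw [SimpleGraph.Walk.length_cons, hq3, p3]

def cycLens {V : Type} (G : SimpleGraph V) : Set ℕ :=
  { l : ℕ | ∃ (v : V) (p : G.Walk v v), p.IsCycle ∧ p.length = l }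

lemma cycLens_finite {V : Type} [Fintype V] (G : SimpleGraph V) : (cycLens G).Finite := by
  classical
  refine (Set.finite_Iic (Fintype.card V)).subset ?_
  rintro l ⟨v, p, hp, rfl⟩
  have h1 := hp.support_nodup
  have h2 := List.Nodup.length_le_card h1
  rw [List.length_tail, SimpleGraph.Walk.length_support] at h2
  rw [Set.mem_Iic]
  omega

lemma lamh_le_cyc {V : Type} [Fintype V] (G : SimpleGraph V) (vt : ℕ → V) (n : ℕ) (hn : 4 ≤ n)
    (inj : ∀ i < n, ∀ j < n, vt i = vt j → i = j) (close : G.Adj (vt (n-1)) (vt 0)) :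
    lamh (RG G vt n) n 0 n ≤ (cycLens G).ncard := by
  unfold lamh
  rw [if_pos (by omega)]
  have h1 : (((Ls (RG G vt n) n 0 (n-1)).image (fun l => l + 1) : Finset ℕ) : Set ℕ) ⊆ cycLens G := by
    intro x hx
    rw [Finset.mem_coe] at hx
    obtain ⟨l, hl, rfl⟩ := Finset.mem_image.mp hx
    exact cycle_of_Ls G vt n hn inj close hl
  have h2 := Set.ncard_le_ncard h1 (cycLens_finite G)
  rw [Set.ncard_coe_finset, Finset.card_image_of_injective _ (add_left_injective 1)] at h2
  omega

lemma core {V : Type} [Fintype V] (G : SimpleGraph V) (vt : ℕ → V) (n : ℕ) (hn : 4 ≤ n)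
    (inj : ∀ i < n, ∀ j < n, vt i = vt j → i = j)
    (hadj : ∀ i, i + 1 < n → G.Adj (vt i) (vt (i+1)))
    (close : G.Adj (vt (n-1)) (vt 0)) (F : Finset ℕ) (φ : ℕ → ℕ)
    (hF : ∀ v ∈ F, v + 2 ≤ φ v ∧ φ v < n ∧ G.Adj (vt v) (vt (φ v)) ∧ ¬ (v = 0 ∧ φ v = n - 1))
    (D b K J Lg : ℕ) (hD : 0 < D) (hb : 2 * n + 1 < 2 ^ b) (hK : 2 * n ≤ 2 ^ K)
    (hJ : n ≤ 2 * D ^ J) (hLg : n ≤ 2 ^ Lg) :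
    F.card ≤ Lg * ((32 * D ^ 2 * (K + 1)) * (8 * b) ^ J * (4 * (cycLens G).ncard)) := by
  have hR : Ham (RG G vt n) n := by
    intro i hi
    exact ⟨by omega, hi, by omega, hadj i hi, by omega, by omega⟩
  refine (global_bound hR F φ ?_ D b K J Lg hD hb hK hJ hLg).trans ?_
  · intro v hv
    obtain ⟨h1, h2, h3, h4⟩ := hF v hv
    exact ⟨h1, h2, by omega, h2, by omega, h3, h4, by omega⟩
  · exact Nat.mul_le_mul_left _ (Nat.mul_le_mul_left _ (Nat.mul_le_mul_left _
      (lamh_le_cyc G vt n hn inj close)))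

theorem combi {V : Type} [Fintype V] [DecidableEq V] (G : SimpleGraph V) (n : ℕ) (hn : 4 ≤ n)
    (hcard : Fintype.card V = n) (hH : ∃ (v : V) (p : G.Walk v v), p.IsHamiltonianCycle)
    (hdeg : ∀ v : V, 3 ≤ (G.neighborSet v).ncard)
    (D b K J Lg : ℕ) (hD : 0 < D) (hb : 2 * n + 1 < 2 ^ b) (hK : 2 * n ≤ 2 ^ K)
    (hJ : n ≤ 2 * D ^ J) (hLg : n ≤ 2 ^ Lg) :
    n ≤ 2 * (Lg * ((32 * D ^ 2 * (K + 1)) * (8 * b) ^ J * (4 * (cycLens G).ncard))) := by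
  classical
  obtain ⟨v0, p, hp⟩ := hH
  have hlen : p.length = n := by rw [hp.length_eq, hcard]
  set vt : ℕ → V := p.getVert with hvt
  have inj : ∀ i < n, ∀ j < n, vt i = vt j → i = j := by
    intro i hi j hj hij
    exact hp.isCycle.getVert_injOn' (by simp; omega) (by simp; omega) hij
  have hadj : ∀ i, i + 1 < n → G.Adj (vt i) (vt (i+1)) := fun i hi =>
    p.adj_getVert_succ (by omega)
  have hv0 : vt n = vt 0 := by
    rw [hvt, ← hlen, SimpleGraph.Walk.getVert_length, SimpleGraph.Walk.getVert_zero]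
  have close : G.Adj (vt (n-1)) (vt 0) := by
    have := p.adj_getVert_succ (i := n-1) (by omega)
    rw [Nat.sub_add_cancel (by omega)] at this
    rw [← hv0]; exact this
  have surj : ∀ w : V, ∃ i < n, vt i = w := by
    have himg : (Finset.range n).image vt = Finset.univ := by
      apply Finset.eq_univ_of_card
      rw [Finset.card_image_of_injOn, Finset.card_range, hcard]
      intro i hi j hj hij
      exact inj i (by simpa using hi) j (by simpa using hj) hij
    intro w
    have := Finset.mem_univ w
    rw [← himg, Finset.mem_image] at this
    obtain ⟨i, hi, h⟩ := this
    exact ⟨i, by simpa using hi, h⟩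
  have hchord : ∀ v, ∃ w, v < n → (w < n ∧ G.Adj (vt v) (vt w) ∧ w ≠ v ∧ w ≠ v + 1 ∧ v ≠ w + 1 ∧
      ¬ (v = 0 ∧ w = n - 1) ∧ ¬ (w = 0 ∧ v = n - 1)) := by
    intro v
    by_cases hv : v < n
    swap
    · exact ⟨0, fun h => absurd h hv⟩
    set a := if v + 1 = n then 0 else v + 1 with ha
    set b := if v = 0 then n - 1 else v - 1 with hb
    have h3 := hdeg (vt v)
    obtain ⟨x, hx, hx2⟩ : ∃ x ∈ G.neighborSet (vt v), x ∉ ({vt a, vt b} : Set V) := by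
      refine Set.exists_mem_notMem_of_ncard_lt_ncard ?_ (Set.toFinite _)
      have h4 := Set.ncard_insert_le (vt a) {vt b}
      rw [Set.ncard_singleton] at h4
      omega
    obtain ⟨w, hw, rfl⟩ := surj x
    have hadjw : G.Adj (vt v) (vt w) := hx
    have n0 : w ≠ v := by
      rintro rfl
      exact G.loopless.irrefl _ hadjw
    have n1 : w ≠ a := by
      rintro h; apply hx2; rw [h]; simp
    have n2 : w ≠ b := by
      rintro h; apply hx2; rw [h]; simp
    refine ⟨w, fun _ => ⟨hw, hadjw, n0, ?_, ?_, ?_, ?_⟩⟩ <;> 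
    · simp only [ha, hb] at n1 n2
      split_ifs at n1 n2 <;> omega
  choose φ hφ using hchord
  set F1 := (Finset.range n).filter (fun v => v < φ v) with hF1
  set F2 := (Finset.range n).filter (fun v => ¬ v < φ v) with hF2
  have hsum : F1.card + F2.card = n := by
    have := Finset.card_filter_add_card_filter_not (s := Finset.range n) (fun v => v < φ v)
    rwa [Finset.card_range] at this
  have c1 := core G vt n hn inj hadj close F1 φ (by
    intro v hv
    rw [hF1, Finset.mem_filter, Finset.mem_range] at hv
    obtain ⟨h1, h2, h3, h4, h5, h6, h7⟩ := hφ v hv.1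
    exact ⟨by omega, h1, h2, h6⟩) D b K J Lg hD hb hK hJ hLg
  have c2 := core G (fun i => vt (n - 1 - i)) n hn
    (by
      intro i hi j hj hij
      have := inj _ (by omega) _ (by omega) hij
      omega)
    (by
      intro i hi
      have := hadj (n - 1 - (i + 1)) (by omega)
      rw [show n - 1 - (i + 1) + 1 = n - 1 - i by omega] at this
      exact this.symm)
    (by
      simp only [Nat.sub_zero, Nat.sub_self]
      exact close.symm)
    (F2.image (fun v => n - 1 - v)) (fun i => n - 1 - φ (n - 1 - i)) (by
      intro x hx
      obtain ⟨v, hv, rfl⟩ := Finset.mem_image.mp hx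
      rw [hF2, Finset.mem_filter, Finset.mem_range] at hv
      obtain ⟨h1, h2, h3, h4, h5, h6, h7⟩ := hφ v hv.1
      have e1 : n - 1 - (n - 1 - v) = v := by omega
      have e2 : n - 1 - (n - 1 - φ v) = φ v := by omega
      simp only [e1, e2]
      exact ⟨by omega, by omega, h2, by omega⟩) D b K J Lg hD hb hK hJ hLg
  rw [Finset.card_image_of_injOn (by
    intro x hx y hy hxy
    rw [Finset.mem_coe, hF2, Finset.mem_filter, Finset.mem_range] at hx hy
    simp only at hxy
    omega)] at c2
  omega

lemma four_mul_le_two_rpow {y : ℝ} (hy : 4 ≤ y) : 4 * y ≤ (2:ℝ) ^ y := by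
  have h1 : (2:ℝ) ^ y = 16 * (2:ℝ) ^ (y - 4) := by
    rw [Real.rpow_sub (by norm_num)]
    norm_num
    ring
  have h2 : 1 + (y - 4) * Real.log 2 ≤ (2:ℝ) ^ (y - 4) := by
    rw [Real.rpow_def_of_pos (by norm_num)]
    have := Real.add_one_le_exp (Real.log 2 * (y - 4))
    linarith
  have h3 := Real.log_two_gt_d9
  have h4 : (y - 4) * (1/2) ≤ (y - 4) * Real.log 2 :=
    mul_le_mul_of_nonneg_left (by linarith) (by linarith)
  rw [h1]
  linarith

lemma numerics {n N : ℕ} (x y q : ℝ) (hx16 : 16 ≤ x) (hnx : (2:ℝ) ^ x = n) (hy : (2:ℝ) ^ y = x)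
    (hq : q = Real.sqrt (x * y))
    (h : ∀ D b K J Lg : ℕ, 0 < D → 2 * n + 1 < 2 ^ b → 2 * n ≤ 2 ^ K → n ≤ 2 * D ^ J →
      n ≤ 2 ^ Lg → n ≤ 2 * (Lg * ((32 * D ^ 2 * (K + 1)) * (8 * b) ^ J * (4 * N)))) :
    (n : ℝ) ≤ 2048 * (2:ℝ) ^ (6 * q) * N := by
  have hy4 : 4 ≤ y := by
    by_contra hc
    push Not at hc
    have : (2:ℝ) ^ y < 2 ^ (4:ℝ) := Real.rpow_lt_rpow_of_exponent_lt (by norm_num) hc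
    norm_num at this
    linarith
  have h4y : 4 * y ≤ x := by rw [← hy]; exact four_mul_le_two_rpow hy4
  have hxy : 0 < x * y := by positivity
  have hq0 : 0 < q := by rw [hq]; exact Real.sqrt_pos.mpr hxy
  have hqq : q * q = x * y := by rw [hq]; exact Real.mul_self_sqrt hxy.le
  have h2y : 2 * y ≤ q := by
    by_contra hc
    push Not at hc
    nlinarith
  set Lg := ⌈x⌉₊ with hLgd
  set D := ⌈(2:ℝ) ^ q⌉₊ with hDd
  set J := ⌈x / q⌉₊ with hJd
  have hLg1 : x ≤ Lg := Nat.le_ceil x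
  have hLg2 : (Lg:ℝ) < x + 1 := Nat.ceil_lt_add_one (by linarith)
  have hD1 : (2:ℝ) ^ q ≤ D := Nat.le_ceil _
  have hD2 : (D:ℝ) < (2:ℝ) ^ q + 1 := Nat.ceil_lt_add_one (by positivity)
  have hJ1 : x / q ≤ J := Nat.le_ceil _
  have hJ2 : (J:ℝ) < x / q + 1 := Nat.ceil_lt_add_one (by positivity)
  have h2q : 1 ≤ (2:ℝ) ^ q := Real.one_le_rpow (by norm_num) hq0.le
  have hn1 : (1:ℝ) ≤ n := by rw [← hnx]; exact Real.one_le_rpow (by norm_num) (by linarith)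
  have hn1' : 1 ≤ n := by exact_mod_cast hn1
  have hnLg : n ≤ 2 ^ Lg := by
    have : (n:ℝ) ≤ (2:ℝ) ^ (Lg:ℝ) := by
      rw [← hnx]; exact Real.rpow_le_rpow_of_exponent_le (by norm_num) hLg1
    rw [Real.rpow_natCast] at this
    exact_mod_cast this
  have hDpos : 0 < D := by
    have : (0:ℝ) < D := by linarith
    exact_mod_cast this
  have hnJ : n ≤ 2 * D ^ J := by
    have h1 : (n:ℝ) ≤ (D:ℝ) ^ J := by
      calc (n:ℝ) = (2:ℝ) ^ x := hnx.symm
        _ ≤ (2:ℝ) ^ (q * J) := by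
          apply Real.rpow_le_rpow_of_exponent_le (by norm_num)
          rw [div_le_iff₀ hq0] at hJ1
          linarith
        _ = ((2:ℝ) ^ q) ^ J := by rw [Real.rpow_mul (by norm_num), Real.rpow_natCast]
        _ ≤ (D:ℝ) ^ J := pow_le_pow_left₀ (by positivity) hD1 J
    have h2 : n ≤ D ^ J := by exact_mod_cast h1
    omega
  have hmain := h D (Lg + 2) (Lg + 1) J Lg hDpos (by rw [pow_add]; omega)
    (by rw [pow_succ]; omega) hnJ hnLg
  have hmainR : (n:ℝ) ≤ 2 * (Lg * ((32 * (D:ℝ) ^ 2 * ((Lg + 1) + 1)) * (8 * (Lg + 2)) ^ J * (4 * N))) := by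
    exact_mod_cast hmain
  have e1 : (8 * ((Lg:ℝ) + 2)) ^ J ≤ (2:ℝ) ^ (2 * q + 2 * y) := by
    calc (8 * ((Lg:ℝ) + 2)) ^ J ≤ ((2:ℝ) ^ (2 * y)) ^ J := by
          apply pow_le_pow_left₀ (by positivity)
          have : (2:ℝ) ^ (2 * y) = x ^ 2 := by
            rw [mul_comm, Real.rpow_mul (by norm_num), hy]; norm_num
          rw [this]
          nlinarith
      _ = (2:ℝ) ^ (2 * y * J) := by rw [Real.rpow_mul (by norm_num) (2 * y), Real.rpow_natCast]
      _ ≤ (2:ℝ) ^ (2 * q + 2 * y) := by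
          apply Real.rpow_le_rpow_of_exponent_le (by norm_num)
          have h1 : y * (x / q) = q := by
            field_simp
            nlinarith
          have h2 : y * J ≤ y * (x / q + 1) := mul_le_mul_of_nonneg_left hJ2.le (by linarith)
          nlinarith
  have e2 : (D:ℝ) ^ 2 ≤ 4 * (2:ℝ) ^ (2 * q) := by
    have : (2:ℝ) ^ (2 * q) = ((2:ℝ) ^ q) ^ 2 := by
      rw [mul_comm, Real.rpow_mul (by norm_num)]; norm_num
    rw [this]
    have : (D:ℝ) ≤ 2 * (2:ℝ) ^ q := by linarith
    calc (D:ℝ) ^ 2 ≤ (2 * (2:ℝ) ^ q) ^ 2 := pow_le_pow_left₀ (by positivity) this 2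
      _ = _ := by ring
  have e3 : (Lg:ℝ) * ((Lg + 1) + 1) ≤ 2 * (2:ℝ) ^ (2 * y) := by
    have : (2:ℝ) ^ (2 * y) = x ^ 2 := by
      rw [mul_comm, Real.rpow_mul (by norm_num), hy]; norm_num
    rw [this]
    have : (0:ℝ) ≤ Lg := Nat.cast_nonneg _
    nlinarith
  have e4 : ((Lg:ℝ) * ((Lg + 1) + 1)) * (D:ℝ) ^ 2 * (8 * ((Lg:ℝ) + 2)) ^ J ≤
      8 * (2:ℝ) ^ (6 * q) := by
    calc _ ≤ (2 * (2:ℝ) ^ (2 * y)) * (4 * (2:ℝ) ^ (2 * q)) * (2:ℝ) ^ (2 * q + 2 * y) := by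
          gcongr
      _ = 8 * (2:ℝ) ^ (2 * y + 2 * q + (2 * q + 2 * y)) := by
          rw [Real.rpow_add (by norm_num) (2 * y + 2 * q), Real.rpow_add (by norm_num) (2 * y)]
          ring
      _ ≤ 8 * (2:ℝ) ^ (6 * q) := by
          apply mul_le_mul_of_nonneg_left _ (by norm_num)
          apply Real.rpow_le_rpow_of_exponent_le (by norm_num)
          linarith
  calc (n:ℝ) ≤ _ := hmainR
    _ = 256 * (((Lg:ℝ) * ((Lg + 1) + 1)) * (D:ℝ) ^ 2 * (8 * ((Lg:ℝ) + 2)) ^ J) * N := by ring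
    _ ≤ 256 * (8 * (2:ℝ) ^ (6 * q)) * N := by gcongr
    _ = _ := by ring

theorem hamiltonian_min_degree_three_many_cycle_lengths :
    ∃ c : ℝ, 0 < c ∧
      ∀ (n : ℕ) (V : Type) [Fintype V] [DecidableEq V] (G : SimpleGraph V),
        4 ≤ n →
        Fintype.card V = n →
        (∃ (v : V) (p : G.Walk v v), p.IsHamiltonianCycle) →
        (∀ v : V, 3 ≤ (G.neighborSet v).ncard) →
        c * n / 2 ^ (6 * Real.sqrt (Real.logb 2 n * Real.logb 2 (Real.logb 2 n))) ≤
          ({ ℓ : ℕ | ∃ (v : V) (p : G.Walk v v), p.IsCycle ∧ p.length = ℓ } : Set ℕ).ncard := by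
  refine ⟨1 / 65536, by norm_num, ?_⟩
  intro n V _ _ G hn hcard hH hdeg
  change _ ≤ ((cycLens G).ncard : ℝ)
  have hN : 1 ≤ (cycLens G).ncard := by
    obtain ⟨v, p, hp⟩ := hH
    exact (Set.ncard_pos (cycLens_finite G)).mpr ⟨_, v, p, hp.isCycle, rfl⟩
  set q := Real.sqrt (Real.logb 2 n * Real.logb 2 (Real.logb 2 n)) with hq
  have hq0 : 0 ≤ q := Real.sqrt_nonneg _
  have hpow : 1 ≤ (2:ℝ) ^ (6 * q) := Real.one_le_rpow (by norm_num) (by linarith)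
  have hNR : (1:ℝ) ≤ (cycLens G).ncard := by exact_mod_cast hN
  have hn0 : (0:ℝ) < n := by
    have : 0 < n := by omega
    exact_mod_cast this
  rw [div_le_iff₀ (by positivity)]
  by_cases hbig : n < 65536
  · have h1 : (n:ℝ) ≤ 65536 := by exact_mod_cast hbig.le
    nlinarith
  · push Not at hbig
    have hx : (2:ℝ) ^ (Real.logb 2 n) = n := Real.rpow_logb (by norm_num) (by norm_num) hn0
    have hx16 : 16 ≤ Real.logb 2 n := by
      rw [Real.le_logb_iff_rpow_le (by norm_num) hn0]
      norm_num
      exact_mod_cast hbig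
    have hy : (2:ℝ) ^ (Real.logb 2 (Real.logb 2 n)) = Real.logb 2 n :=
      Real.rpow_logb (by norm_num) (by norm_num) (by linarith)
    have := numerics (n := n) (N := (cycLens G).ncard) _ _ q hx16 hx hy hq
      (combi G n hn hcard hH hdeg)
    have hnn : 0 ≤ (2:ℝ) ^ (6 * q) * (cycLens G).ncard := by positivity
    linarith
end

section
/- For every ε > 0 there exists n₀ such that every simple graph G on n ≥ n₀ vertices that contains a Hamilton cycle and in which every vertex has degree at least 3 contains cycles of at least n^{1−ε} distinct lengths. -/
open scoped Pointwise

namespace HamCyc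

/-- Abstract properties of the set of detour gains. -/
structure GainAx (U : Finset (ℤ × ℤ)) (Φ : Finset (ℤ × ℤ) → Finset ℤ) : Prop where
  zero : ∀ P, P ⊆ U → (0 : ℤ) ∈ Φ P
  mono : ∀ P Q, P ⊆ Q → Q ⊆ U → Φ P ⊆ Φ Q
  pair : ∀ P, P ⊆ U → ∀ p ∈ P, ∀ q ∈ P, p.1 < q.1 → p.2 ≠ q.2 →
    |q.2 - p.2| - (q.1 - p.1) + 2 ∈ Φ P
  addI : ∀ P Q, P.Nonempty → Q.Nonempty → P ∪ Q ⊆ U →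
    (∀ p ∈ P, ∀ q ∈ Q, p.1 < q.1 ∧ p.2 < q.2) → Φ P + Φ Q ⊆ Φ (P ∪ Q)
  addD : ∀ P Q, P.Nonempty → Q.Nonempty → P ∪ Q ⊆ U →
    (∀ p ∈ P, ∀ q ∈ Q, p.1 < q.1 ∧ q.2 < p.2) → Φ P + Φ Q ⊆ Φ (P ∪ Q)

/-- Reflection of the second coordinate. -/
def rf (p : ℤ × ℤ) : ℤ × ℤ := (p.1, -p.2)

lemma rf_inj : Function.Injective rf := by
  rintro ⟨a, b⟩ ⟨c, d⟩ h
  simp [rf] at h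
  simp [h]

lemma rf_rf (p : ℤ × ℤ) : rf (rf p) = p := by simp [rf]

lemma image_rf_rf (P : Finset (ℤ × ℤ)) : (P.image rf).image rf = P := by
  rw [Finset.image_image]
  have : rf ∘ rf = id := by funext p; simp [rf_rf]
  rw [this, Finset.image_id]

lemma GainAx.reflect {U : Finset (ℤ × ℤ)} {Φ : Finset (ℤ × ℤ) → Finset ℤ} (h : GainAx U Φ) :
    GainAx (U.image rf) (fun P => Φ (P.image rf)) := by
  have key : ∀ P, P ⊆ U.image rf → P.image rf ⊆ U := by
    intro P hP
    have := Finset.image_subset_image (f := rf) hP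
    rwa [image_rf_rf] at this
  refine ⟨?_, ?_, ?_, ?_, ?_⟩
  · intro P hP
    exact h.zero _ (key P hP)
  · intro P Q hPQ hQ
    exact h.mono _ _ (Finset.image_subset_image hPQ) (key Q hQ)
  · intro P hP p hp q hq h1 h2
    have := h.pair _ (key P hP) (rf p) (Finset.mem_image_of_mem _ hp) (rf q)
      (Finset.mem_image_of_mem _ hq) h1 (by simpa [rf] using h2)
    have e : |(rf q).2 - (rf p).2| = |q.2 - p.2| := by
      rw [← abs_neg]; congr 1; simp only [rf]; ring
    rw [e] at this
    exact this
  · intro P Q hP hQ hU hs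
    have := h.addD (P.image rf) (Q.image rf) (hP.image _) (hQ.image _)
      (by rw [← Finset.image_union]; exact key _ hU)
      (by
        intro p hp q hq
        obtain ⟨p', hp', rfl⟩ := Finset.mem_image.1 hp
        obtain ⟨q', hq', rfl⟩ := Finset.mem_image.1 hq
        have := hs p' hp' q' hq'
        simp only [rf]; omega)
    rw [← Finset.image_union] at this
    exact this
  · intro P Q hP hQ hU hs
    have := h.addI (P.image rf) (Q.image rf) (hP.image _) (hQ.image _)
      (by rw [← Finset.image_union]; exact key _ hU)
      (by
        intro p hp q hq
        obtain ⟨p', hp', rfl⟩ := Finset.mem_image.1 hp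
        obtain ⟨q', hq', rfl⟩ := Finset.mem_image.1 hq
        have := hs p' hp' q' hq'
        simp only [rf]; omega)
    rw [← Finset.image_union] at this
    exact this

lemma threshold {α : Type*} (P : Finset α) (f : α → ℤ) (m : ℕ) (hm : m ≤ P.card) (h0 : 0 < m) :
    ∃ p ∈ P, m ≤ (P.filter (fun q => f q ≤ f p)).card ∧
      (P.filter (fun q => f q < f p)).card < m := by
  classical
  set S := P.filter (fun p => m ≤ (P.filter (fun q => f q ≤ f p)).card) with hS
  have hne : P.Nonempty := Finset.card_pos.1 (by omega)
  have hSne : S.Nonempty := by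
    obtain ⟨p, hp, hmax⟩ := Finset.exists_max_image P f hne
    refine ⟨p, Finset.mem_filter.2 ⟨hp, ?_⟩⟩
    rw [Finset.filter_true_of_mem hmax]; exact hm
  obtain ⟨p, hp, hmin⟩ := Finset.exists_min_image S f hSne
  obtain ⟨hpP, hpm⟩ := Finset.mem_filter.1 hp
  refine ⟨p, hpP, hpm, ?_⟩
  by_contra hcon
  push Not at hcon
  have hne2 : (P.filter (fun q => f q < f p)).Nonempty := Finset.card_pos.1 (by omega)
  obtain ⟨r, hr, hrmax⟩ := Finset.exists_max_image _ f hne2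
  obtain ⟨hrP, hrlt⟩ := Finset.mem_filter.1 hr
  have : r ∈ S := by
    refine Finset.mem_filter.2 ⟨hrP, hcon.trans (Finset.card_le_card ?_)⟩
    intro s hs
    have hs' := Finset.mem_filter.1 hs
    exact Finset.mem_filter.2 ⟨hs'.1, hrmax s hs⟩
  have := hmin r this
  omega

lemma peel (P : Finset (ℤ × ℤ)) (hinj : Set.InjOn Prod.snd (P : Set (ℤ × ℤ))) (N t : ℕ)
    (hN : 0 < N) (hhub : ∀ x, (P.filter (fun p => p.1 = x)).card ≤ N)
    (hP : N + t ≤ P.card)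
    (hsw : ∀ e ∈ P, (P.filter (fun p => p.1 < e.1 ∧ p.2 < e.2)).card ≤ t) :
    ∃ B P' : Finset (ℤ × ℤ), B ⊆ P ∧ P' ⊆ P ∧ B.card = N ∧ P.card ≤ P'.card + 2 * N + t ∧
      ∀ b ∈ B, ∀ p ∈ P', b.1 < p.1 ∧ p.2 < b.2 := by
  classical
  obtain ⟨p0, hp0, h1, h2⟩ := threshold P Prod.fst (N + t) hP (by omega)
  set L := P.filter (fun q => q.1 ≤ p0.1) with hL
  set P' := P.filter (fun q => ¬ q.1 ≤ p0.1) with hP'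
  set B := L.filter (fun b => ∀ p ∈ P', p.2 < b.2) with hB
  have hbad : (L.filter (fun b => ¬ ∀ p ∈ P', p.2 < b.2)).card ≤ t := by
    rcases P'.eq_empty_or_nonempty with he | hne
    · simp [he]
    · obtain ⟨e, he, hemax⟩ := Finset.exists_max_image P' Prod.snd hne
      have heP := (Finset.mem_filter.1 he)
      refine (Finset.card_le_card ?_).trans (hsw e heP.1)
      intro b hb
      obtain ⟨hbL, hbn⟩ := Finset.mem_filter.1 hb
      obtain ⟨hbP, hbx⟩ := Finset.mem_filter.1 hbL
      push Not at hbn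
      obtain ⟨p, hp, hpb⟩ := hbn
      have h3 := hemax p hp
      have h4 : b.2 ≠ e.2 := by
        intro h
        have := hinj (Finset.mem_coe.2 hbP) (Finset.mem_coe.2 heP.1) h
        rw [this] at hbx
        exact heP.2 hbx
      have h5 := heP.2
      refine Finset.mem_filter.2 ⟨hbP, by omega, by omega⟩
  have hBc : N ≤ B.card := by
    have h3 : B.card + (L.filter (fun b => ¬ ∀ p ∈ P', p.2 < b.2)).card = L.card :=
      Finset.card_filter_add_card_filter_not _
    have h1' : N + t ≤ L.card := h1
    omega
  obtain ⟨B', hB', hB'c⟩ := Finset.exists_subset_card_eq hBc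
  refine ⟨B', P', ?_, Finset.filter_subset _ _, hB'c, ?_, ?_⟩
  · exact hB'.trans ((Finset.filter_subset _ _).trans (Finset.filter_subset _ _))
  · have e1 : L.card + P'.card = P.card := Finset.card_filter_add_card_filter_not _
    have e2 : L ⊆ P.filter (fun q => q.1 < p0.1) ∪ P.filter (fun q => q.1 = p0.1) := by
      intro q hq
      obtain ⟨a, b⟩ := Finset.mem_filter.1 hq
      rcases lt_or_eq_of_le b with h | h
      · exact Finset.mem_union_left _ (Finset.mem_filter.2 ⟨a, h⟩)
      · exact Finset.mem_union_right _ (Finset.mem_filter.2 ⟨a, h⟩)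
    have e3 := (Finset.card_le_card e2).trans (Finset.card_union_le _ _)
    have e4 := hhub p0.1
    omega
  · intro b hb p hp
    obtain ⟨hbL, hbb⟩ := Finset.mem_filter.1 (hB' hb)
    have h3 := (Finset.mem_filter.1 hbL).2
    have h4 := (Finset.mem_filter.1 hp).2
    exact ⟨by omega, hbb p hp⟩

lemma card_add_ge (A B : Finset ℤ) (hA : A.Nonempty) (hB : B.Nonempty) :
    A.card + B.card ≤ (A + B).card + 1 := by
  have := cauchy_davenport_add_of_linearOrder_isCancelAdd hA hB
  have := hA.card_pos
  omega

lemma chain {U : Finset (ℤ × ℤ)} {Φ : Finset (ℤ × ℤ) → Finset ℤ} (hΦ : GainAx U Φ)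
    (N t : ℕ) (hN : 0 < N) (g : ℝ) (K : ℕ) :
    ∀ P ⊆ U, Set.InjOn Prod.snd (P : Set (ℤ × ℤ)) →
    (∀ x, (P.filter (fun p => p.1 = x)).card ≤ N) →
    (∀ e ∈ P, (P.filter (fun p => p.1 < e.1 ∧ p.2 < e.2)).card ≤ t) →
    (∀ B ⊆ P, B.card = N → 1 + g ≤ ((Φ B).card : ℝ)) →
    K * (2 * N + t) ≤ P.card → 1 + K * g ≤ ((Φ P).card : ℝ) := by
  classical
  induction K with
  | zero =>
    intro P hP _ _ _ _ _
    have : 0 < (Φ P).card := Finset.card_pos.2 ⟨0, hΦ.zero P hP⟩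
    have : (1 : ℝ) ≤ ((Φ P).card : ℝ) := by exact_mod_cast this
    simpa using this
  | succ K ih =>
    intro P hP hinj hhub hsw hg hcard
    have hc : (K + 1) * (2 * N + t) = K * (2 * N + t) + (2 * N + t) := by ring
    obtain ⟨B, P', hB, hP', hBc, hP'c, hsep⟩ := peel P hinj N t hN hhub (by omega) hsw
    have h1 := hg B hB hBc
    have h2 := ih P' (hP'.trans hP) (hinj.mono (by exact_mod_cast hP'))
      (fun x => (Finset.card_le_card (Finset.filter_subset_filter _ hP')).trans (hhub x))
      (fun e he => (Finset.card_le_card (Finset.filter_subset_filter _ hP')).trans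
        (hsw e (hP' he)))
      (fun C hC => hg C (hC.trans hP')) (by omega)
    have hBne : B.Nonempty := Finset.card_pos.1 (by omega)
    rcases P'.eq_empty_or_nonempty with he | hne
    · subst he
      have h5 : (Φ B).card ≤ (Φ P).card := Finset.card_le_card (hΦ.mono _ _ hB hP)
      have h5' : ((Φ B).card : ℝ) ≤ (Φ P).card := by exact_mod_cast h5
      have hK : K = 0 := by
        simp only [Finset.card_empty] at hP'c
        by_contra hK
        have : 1 * (2 * N + t) ≤ K * (2 * N + t) := Nat.mul_le_mul_right _ (by omega)
        omega
      subst hK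
      push_cast
      linarith
    · have hge := card_add_ge (Φ B) (Φ P') ⟨0, hΦ.zero _ (hB.trans hP)⟩
        ⟨0, hΦ.zero _ (hP'.trans hP)⟩
      have hsub : Φ B + Φ P' ⊆ Φ P :=
        (hΦ.addD B P' hBne hne ((Finset.union_subset hB hP').trans hP) hsep).trans
          (hΦ.mono _ _ (Finset.union_subset hB hP') hP)
      have h4 := Finset.card_le_card hsub
      have h3 : (Φ B).card + (Φ P').card ≤ (Φ P).card + 1 := by omega
      have h3' : ((Φ B).card : ℝ) + (Φ P').card ≤ (Φ P).card + 1 := by exact_mod_cast h3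
      push_cast
      linarith

end HamCyc

open scoped Pointwise

namespace HamCyc

lemma card_filter_image_rf (P : Finset (ℤ × ℤ)) (f : ℤ × ℤ → Prop) [DecidablePred f] :
    ((P.image rf).filter f).card = (P.filter (fun p => f (rf p))).card := by
  rw [Finset.filter_image, Finset.card_image_of_injective _ rf_inj]

lemma chain' {U : Finset (ℤ × ℤ)} {Φ : Finset (ℤ × ℤ) → Finset ℤ} (hΦ : GainAx U Φ)
    (N t : ℕ) (hN : 0 < N) (g : ℝ) (K : ℕ) (P : Finset (ℤ × ℤ)) (hP : P ⊆ U)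
    (hinj : Set.InjOn Prod.snd (P : Set (ℤ × ℤ)))
    (hhub : ∀ x, (P.filter (fun p => p.1 = x)).card ≤ N)
    (hnw : ∀ e ∈ P, (P.filter (fun p => p.1 < e.1 ∧ e.2 < p.2)).card ≤ t)
    (hg : ∀ B ⊆ P, B.card = N → 1 + g ≤ ((Φ B).card : ℝ))
    (hK : K * (2 * N + t) ≤ P.card) : 1 + K * g ≤ ((Φ P).card : ℝ) := by
  classical
  have := chain hΦ.reflect N t hN g K (P.image rf) (Finset.image_subset_image hP)
    (by
      intro a ha b hb hab
      rw [Finset.mem_coe] at ha hb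
      obtain ⟨p, hp, rfl⟩ := Finset.mem_image.1 ha
      obtain ⟨q, hq, rfl⟩ := Finset.mem_image.1 hb
      simp only [rf, neg_inj] at hab
      rw [hinj hp hq hab])
    (by
      intro x
      rw [card_filter_image_rf]
      exact hhub x)
    (by
      intro e he
      obtain ⟨q, hq, rfl⟩ := Finset.mem_image.1 he
      rw [card_filter_image_rf]
      simpa [rf] using hnw q hq)
    (by
      intro B hB hBc
      refine hg _ ?_ ?_
      · have := Finset.image_subset_image (f := rf) hB
        rwa [image_rf_rf] at this
      · rw [Finset.card_image_of_injective _ rf_inj, hBc])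
    (by rwa [Finset.card_image_of_injective _ rf_inj])
  rwa [image_rf_rf] at this

lemma two_le_of_three {U : Finset (ℤ × ℤ)} {Φ : Finset (ℤ × ℤ) → Finset ℤ} (hΦ : GainAx U Φ)
    (P : Finset (ℤ × ℤ)) (hP : P ⊆ U)
    (hinj : Set.InjOn Prod.snd (P : Set (ℤ × ℤ)))
    (p q r : ℤ × ℤ) (hp : p ∈ P) (hq : q ∈ P) (hr : r ∈ P) (h1 : p.1 < q.1) (h2 : q.1 < r.1) :
    2 ≤ (Φ P).card := by
  by_contra hcon
  have hall : ∀ g ∈ Φ P, g = 0 := by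
    intro g hg
    by_contra hg0
    have : ({0, g} : Finset ℤ) ⊆ Φ P := by
      intro x hx
      simp only [Finset.mem_insert, Finset.mem_singleton] at hx
      rcases hx with rfl | rfl
      · exact hΦ.zero P hP
      · exact hg
    have := Finset.card_le_card this
    rw [Finset.card_pair (Ne.symm hg0)] at this
    exact hcon this
  have ne : ∀ a ∈ P, ∀ b ∈ P, a.1 < b.1 → a.2 ≠ b.2 := by
    intro a ha b hb hab h
    have := hinj ha hb h
    rw [this] at hab
    exact lt_irrefl _ hab
  have e1 := hall _ (hΦ.pair P hP p hp q hq h1 (ne p hp q hq h1))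
  have e2 := hall _ (hΦ.pair P hP q hq r hr h2 (ne q hq r hr h2))
  have e3 := hall _ (hΦ.pair P hP p hp r hr (h1.trans h2) (ne p hp r hr (h1.trans h2)))
  have := abs_sub_le r.2 q.2 p.2
  omega

lemma two_le_card {U : Finset (ℤ × ℤ)} {Φ : Finset (ℤ × ℤ) → Finset ℤ} (hΦ : GainAx U Φ)
    (P : Finset (ℤ × ℤ)) (hP : P ⊆ U) (hne : P.Nonempty)
    (hinj : Set.InjOn Prod.snd (P : Set (ℤ × ℤ)))
    (hhub : ∀ x, 100 * (P.filter (fun p => p.1 = x)).card ≤ P.card) :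
    2 ≤ (Φ P).card := by
  classical
  have h0 := hne.card_pos
  have h1 := Finset.card_le_mul_card_image (f := Prod.fst) P (P.card / 100)
    (fun a _ => by
      have := hhub a
      omega)
  have h2 : 2 < (P.image Prod.fst).card := by
    by_contra h
    have h3 : P.card / 100 * (P.image Prod.fst).card ≤ P.card / 100 * 2 :=
      Nat.mul_le_mul_left _ (by omega)
    omega
  obtain ⟨a, ha, b, hb, c, hc, hab, hac, hbc⟩ := Finset.two_lt_card.1 h2
  obtain ⟨p, hp, rfl⟩ := Finset.mem_image.1 ha
  obtain ⟨q, hq, rfl⟩ := Finset.mem_image.1 hb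
  obtain ⟨r, hr, rfl⟩ := Finset.mem_image.1 hc
  have key := two_le_of_three hΦ P hP hinj
  rcases lt_or_gt_of_ne hab with h | h <;> rcases lt_or_gt_of_ne hac with h' | h' <;>
    rcases lt_or_gt_of_ne hbc with h'' | h''
  · exact key p q r hp hq hr h h''
  · exact key p r q hp hr hq h' h''
  · omega
  · exact key r p q hr hp hq h' h
  · exact key q p r hq hp hr h h'
  · omega
  · exact key q r p hq hr hp h'' h'
  · exact key r q p hr hq hp h'' h

lemma star {U : Finset (ℤ × ℤ)} {Φ : Finset (ℤ × ℤ) → Finset ℤ} (hΦ : GainAx U Φ)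
    (P : Finset (ℤ × ℤ)) (hP : P ⊆ U)
    (hinj : Set.InjOn Prod.snd (P : Set (ℤ × ℤ))) (x : ℤ) (q : ℤ × ℤ) (hq : q ∈ P)
    (hqx : q.1 ≠ x) : (P.filter (fun p => p.1 = x)).card ≤ 2 * (Φ P).card := by
  classical
  set S := P.filter (fun p => p.1 = x) with hS
  have hSm : ∀ p ∈ S, p ∈ P ∧ p.1 = x := fun p hp => Finset.mem_filter.1 hp
  have hne : ∀ p ∈ S, p.2 ≠ q.2 := by
    intro p hp h
    have := hinj (hSm p hp).1 hq h
    rw [← this] at hqx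
    exact hqx (hSm p hp).2
  have hsplit : S.card = (S.filter (fun p => p.2 < q.2)).card +
      (S.filter (fun p => ¬ p.2 < q.2)).card := (Finset.card_filter_add_card_filter_not _).symm
  have hmap : ∀ p ∈ S, |q.2 - p.2| - |q.1 - x| + 2 ∈ Φ P := by
    intro p hp
    obtain ⟨h1, h2⟩ := hSm p hp
    rcases lt_or_gt_of_ne hqx with h | h
    · have := hΦ.pair P hP q hq p h1 (by omega) (fun h => hne p hp h.symm)
      rw [abs_sub_comm, h2] at this
      rwa [abs_of_neg (by omega : q.1 - x < 0), show -(q.1 - x) = x - q.1 by ring]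
    · have := hΦ.pair P hP p h1 q hq (by omega) (hne p hp)
      rw [h2] at this
      rwa [abs_of_pos (by omega : 0 < q.1 - x)]
  have c1 : (S.filter (fun p => p.2 < q.2)).card ≤ (Φ P).card := by
    refine Finset.card_le_card_of_injOn (fun p => |q.2 - p.2| - |q.1 - x| + 2) ?_ ?_
    · intro p hp
      exact hmap p (Finset.mem_filter.1 hp).1
    · intro a ha b hb hab
      obtain ⟨a1, a2⟩ := Finset.mem_filter.1 (Finset.mem_coe.1 ha)
      obtain ⟨b1, b2⟩ := Finset.mem_filter.1 (Finset.mem_coe.1 hb)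
      simp only [abs_of_pos (by omega : 0 < q.2 - a.2),
        abs_of_pos (by omega : 0 < q.2 - b.2)] at hab
      exact hinj (hSm a a1).1 (hSm b b1).1 (show a.2 = b.2 by omega)
  have c2 : (S.filter (fun p => ¬ p.2 < q.2)).card ≤ (Φ P).card := by
    refine Finset.card_le_card_of_injOn (fun p => |q.2 - p.2| - |q.1 - x| + 2) ?_ ?_
    · intro p hp
      exact hmap p (Finset.mem_filter.1 hp).1
    · intro a ha b hb hab
      obtain ⟨a1, a2⟩ := Finset.mem_filter.1 (Finset.mem_coe.1 ha)
      obtain ⟨b1, b2⟩ := Finset.mem_filter.1 (Finset.mem_coe.1 hb)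
      have a3 := hne a a1
      have b3 := hne b b1
      simp only [abs_of_neg (by omega : q.2 - a.2 < 0),
        abs_of_neg (by omega : q.2 - b.2 < 0)] at hab
      exact hinj (hSm a a1).1 (hSm b b1).1 (show a.2 = b.2 by omega)
  omega

lemma halve (P : Finset (ℤ × ℤ)) (hne : P.Nonempty)
    (hinj : Set.InjOn Prod.snd (P : Set (ℤ × ℤ)))
    (hhub : ∀ x, 100 * (P.filter (fun p => p.1 = x)).card ≤ P.card) :
    ∃ P1 P2 : Finset (ℤ × ℤ), P1 ⊆ P ∧ P2 ⊆ P ∧ P.card ≤ 8 * P1.card ∧ P.card ≤ 8 * P2.card ∧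
      ((∀ p ∈ P1, ∀ q ∈ P2, p.1 < q.1 ∧ p.2 < q.2) ∨
       (∀ p ∈ P1, ∀ q ∈ P2, p.1 < q.1 ∧ q.2 < p.2)) := by
  classical
  have h100 : 100 ≤ P.card := by
    obtain ⟨p, hp⟩ := hne
    have h1 := hhub p.1
    have : 0 < (P.filter (fun q => q.1 = p.1)).card :=
      Finset.card_pos.2 ⟨p, Finset.mem_filter.2 ⟨hp, rfl⟩⟩
    omega
  obtain ⟨p0, hp0, h1, h2⟩ := threshold P Prod.fst (P.card / 2) (by omega) (by omega)
  set L := P.filter (fun q => q.1 ≤ p0.1) with hL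
  set R := P.filter (fun q => ¬ q.1 ≤ p0.1) with hR
  have e1 : L.card + R.card = P.card := Finset.card_filter_add_card_filter_not _
  have e2 : L ⊆ P.filter (fun q => q.1 < p0.1) ∪ P.filter (fun q => q.1 = p0.1) := by
    intro q hq
    obtain ⟨a, b⟩ := Finset.mem_filter.1 hq
    rcases lt_or_eq_of_le b with h | h
    · exact Finset.mem_union_left _ (Finset.mem_filter.2 ⟨a, h⟩)
    · exact Finset.mem_union_right _ (Finset.mem_filter.2 ⟨a, h⟩)
  have e3 := (Finset.card_le_card e2).trans (Finset.card_union_le _ _)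
  have e4 := hhub p0.1
  have h1' : P.card / 2 ≤ L.card := h1
  obtain ⟨y0, hy0, h3, h4⟩ := threshold L Prod.snd (L.card / 2) (by omega) (by omega)
  have hy0P := (Finset.mem_filter.1 hy0)
  have e5 : (L.filter (fun q => q.2 < y0.2)).card + (L.filter (fun q => ¬ q.2 < y0.2)).card
    = L.card := Finset.card_filter_add_card_filter_not _
  have e6 : (R.filter (fun q => q.2 < y0.2)).card + (R.filter (fun q => ¬ q.2 < y0.2)).card
    = R.card := Finset.card_filter_add_card_filter_not _
  have hRm : ∀ q ∈ R, q ∈ P ∧ p0.1 < q.1 := fun q hq =>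
    ⟨(Finset.mem_filter.1 hq).1, not_le.1 (Finset.mem_filter.1 hq).2⟩
  have hLm : ∀ q ∈ L, q ∈ P ∧ q.1 ≤ p0.1 := fun q hq => Finset.mem_filter.1 hq
  by_cases hc : R.card ≤ 2 * (R.filter (fun q => q.2 < y0.2)).card
  · refine ⟨L.filter (fun q => ¬ q.2 < y0.2), R.filter (fun q => q.2 < y0.2),
      fun q hq => (hLm q (Finset.mem_filter.1 hq).1).1,
      fun q hq => (hRm q (Finset.mem_filter.1 hq).1).1, by omega, by omega, Or.inr ?_⟩
    intro p hp q hq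
    obtain ⟨hp1, hp2⟩ := Finset.mem_filter.1 hp
    obtain ⟨hq1, hq2⟩ := Finset.mem_filter.1 hq
    have := (hLm p hp1).2
    have := (hRm q hq1).2
    omega
  · refine ⟨L.filter (fun q => q.2 ≤ y0.2), R.filter (fun q => ¬ q.2 < y0.2),
      fun q hq => (hLm q (Finset.mem_filter.1 hq).1).1,
      fun q hq => (hRm q (Finset.mem_filter.1 hq).1).1, by omega, by omega, Or.inl ?_⟩
    intro p hp q hq
    obtain ⟨hp1, hp2⟩ := Finset.mem_filter.1 hp
    obtain ⟨hq1, hq2⟩ := Finset.mem_filter.1 hq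
    have i1 := (hLm p hp1).2
    have i2 := (hRm q hq1).2
    have i3 : q.2 ≠ y0.2 := by
      intro h
      have := hinj (hRm q hq1).1 hy0P.1 h
      rw [this] at i2
      omega
    omega

lemma diff_card {U : Finset (ℤ × ℤ)} {Φ : Finset (ℤ × ℤ) → Finset ℤ} (hΦ : GainAx U Φ)
    (Q R : Finset (ℤ × ℤ)) (hQ : Q ⊆ U) (hR : R ⊆ Q)
    (hinj : Set.InjOn Prod.snd (Q : Set (ℤ × ℤ))) (e e' : ℤ × ℤ) (he : e ∈ Q) (he' : e' ∈ Q)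
    (h1 : ∀ p ∈ R, p.1 < e.1 ∧ p.2 < e.2) (h2 : ∀ p ∈ R, p.1 < e'.1 ∧ e'.2 < p.2) :
    R.card ≤ (Φ Q - Φ Q).card := by
  refine Finset.card_le_card_of_injOn (fun p => (p.2 - e'.2 - (e'.1 - p.1) + 2) -
    (e.2 - p.2 - (e.1 - p.1) + 2)) ?_ ?_
  · intro p hp
    have hp : p ∈ R := hp
    obtain ⟨a1, a2⟩ := h1 p hp
    obtain ⟨b1, b2⟩ := h2 p hp
    have g1 := hΦ.pair Q hQ p (hR hp) e he a1 (by omega)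
    have g2 := hΦ.pair Q hQ p (hR hp) e' he' b1 (by omega)
    rw [abs_of_pos (by omega)] at g1
    rw [abs_of_neg (by omega)] at g2
    rw [show -(e'.2 - p.2) = p.2 - e'.2 by ring] at g2
    exact Finset.mem_coe.2 (Finset.sub_mem_sub g2 g1)
  · intro a ha b hb hab
    simp only at hab
    exact hinj (hR ha) (hR hb) (show a.2 = b.2 by omega)

lemma ruzsa_case {U : Finset (ℤ × ℤ)} {Φ : Finset (ℤ × ℤ) → Finset ℤ} (hΦ : GainAx U Φ)
    (P P1 P2 R : Finset (ℤ × ℤ)) (hP : P ⊆ U) (hP1 : P1 ⊆ P) (hP2 : P2 ⊆ P)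
    (hn1 : P1.Nonempty) (hn2 : P2.Nonempty)
    (hsep : (∀ p ∈ P1, ∀ q ∈ P2, p.1 < q.1 ∧ p.2 < q.2) ∨
       (∀ p ∈ P1, ∀ q ∈ P2, p.1 < q.1 ∧ q.2 < p.2))
    (hR : R.card ≤ (Φ P1 - Φ P1).card) :
    R.card * (Φ P2).card ≤ (Φ P).card * (Φ P).card := by
  have hU : P1 ∪ P2 ⊆ U := (Finset.union_subset hP1 hP2).trans hP
  have hsub : Φ P1 + Φ P2 ⊆ Φ P := by
    refine Finset.Subset.trans ?_ (hΦ.mono _ _ (Finset.union_subset hP1 hP2) hP)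
    rcases hsep with h | h
    · exact hΦ.addI _ _ hn1 hn2 hU h
    · exact hΦ.addD _ _ hn1 hn2 hU h
  have h1 := Finset.card_le_card hsub
  have h2 := Finset.ruzsa_triangle_inequality_sub_add_add (Φ P1) (Φ P2) (Φ P1)
  calc R.card * (Φ P2).card ≤ (Φ P1 - Φ P1).card * (Φ P2).card := Nat.mul_le_mul_right _ hR
    _ ≤ _ := h2
    _ ≤ _ := Nat.mul_le_mul h1 h1

end HamCyc

open scoped Pointwise

namespace HamCyc

/-- The inductive growth claim with exponent `θ`. -/
def Claim (θ : ℝ) : Prop :=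
  ∃ c : ℝ, 0 < c ∧ ∀ (U : Finset (ℤ × ℤ)) (Φ : Finset (ℤ × ℤ) → Finset ℤ), GainAx U Φ →
    ∀ P ⊆ U, Set.InjOn Prod.snd (P : Set (ℤ × ℤ)) → P.Nonempty →
      (∀ x, 100 * (P.filter (fun p => p.1 = x)).card ≤ P.card) →
      1 + c * (P.card : ℝ) ^ θ ≤ ((Φ P).card : ℝ)

lemma claim_zero : Claim 0 := by
  refine ⟨1, one_pos, ?_⟩
  intro U Φ hΦ P hP hinj hne hhub
  have := two_le_card hΦ P hP hne hinj hhub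
  have : (2 : ℝ) ≤ ((Φ P).card : ℝ) := by exact_mod_cast this
  rw [Real.rpow_zero]
  linarith

lemma exists_K (δ D : ℝ) (hδ : 0 < δ) : ∃ K : ℕ, 0 < K ∧ D ≤ (K : ℝ) ^ δ := by
  have h := (tendsto_rpow_atTop hδ).comp (tendsto_natCast_atTop_atTop (R := ℝ))
  have h1 := h.eventually_ge_atTop D
  obtain ⟨K, hK, hK'⟩ := (h1.and (Filter.eventually_gt_atTop 0)).exists
  exact ⟨K, hK', hK⟩

lemma chain_real (θ D p : ℝ) (K N : ℕ) (hK : 0 < K) (h0 : 0 ≤ θ) (h1 : θ ≤ 1) (hD : 1 ≤ D)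
    (hp : 0 ≤ p) (hpN : p ≤ D * K * N) (hKD : D ≤ (K : ℝ) ^ (1 - θ)) :
    p ^ θ ≤ K * (N : ℝ) ^ θ := by
  have hK' : (0 : ℝ) < K := by exact_mod_cast hK
  calc p ^ θ ≤ (D * K * N) ^ θ := Real.rpow_le_rpow hp hpN h0
    _ = D ^ θ * (K : ℝ) ^ θ * (N : ℝ) ^ θ := by
        rw [Real.mul_rpow (by positivity) (by positivity),
          Real.mul_rpow (by positivity) (by positivity)]
    _ ≤ D * (K : ℝ) ^ θ * (N : ℝ) ^ θ := by
        gcongr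
        calc D ^ θ ≤ D ^ (1 : ℝ) := Real.rpow_le_rpow_of_exponent_le hD h1
          _ = D := Real.rpow_one D
    _ ≤ (K : ℝ) ^ (1 - θ) * (K : ℝ) ^ θ * (N : ℝ) ^ θ := by gcongr
    _ = K * (N : ℝ) ^ θ := by
        rw [← Real.rpow_add hK', show 1 - θ + θ = 1 by ring, Real.rpow_one]

lemma rpow_le_self_nat (θ : ℝ) (h1 : θ ≤ 1) (p : ℕ) (hp : 0 < p) : (p : ℝ) ^ θ ≤ p := by
  have : (1 : ℝ) ≤ p := by exact_mod_cast hp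
  calc (p : ℝ) ^ θ ≤ (p : ℝ) ^ (1 : ℝ) := Real.rpow_le_rpow_of_exponent_le this h1
    _ = p := Real.rpow_one _

lemma floor_bound (q K : ℕ) (hK : 0 < K) (hq : 8 * K ≤ q) :
    q ≤ 8 * K * (q / (4 * K)) ∧ K * (3 * (q / (4 * K))) ≤ q ∧ 0 < q / (4 * K) := by
  have h1 := Nat.div_add_mod q (4 * K)
  have h2 := Nat.mod_lt q (show 4 * K > 0 by omega)
  have h3 : 2 ≤ q / (4 * K) := (Nat.le_div_iff_mul_le (by omega)).2 (by omega)
  set N := q / (4 * K)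
  have h4 : 4 * K * 2 ≤ 4 * K * N := Nat.mul_le_mul_left _ h3
  refine ⟨?_, ?_, by omega⟩
  · nlinarith
  · have h5 : K * (3 * N) = 3 * (K * N) := by ring
    have h6 : 4 * K * N = 4 * (K * N) := by ring
    omega

set_option maxHeartbeats 1000000 in
lemma step (θ : ℝ) (h0 : 0 ≤ θ) (h1 : θ < 1) (hc : Claim θ) : Claim ((1 + θ) / 2) := by
  classical
  obtain ⟨c0, hc0, hC⟩ := hc
  set τ := (1 + θ) / 2 with hτ
  have hτ0 : 0 ≤ τ := by rw [hτ]; linarith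
  have hτ1 : τ < 1 := by rw [hτ]; linarith
  obtain ⟨K1, hK1, hK1'⟩ := exists_K (1 - τ) 64 (by linarith)
  obtain ⟨K2, hK2, hK2'⟩ := exists_K (1 - τ) (512 * K1) (by linarith)
  set M : ℕ := 51200 * K1 * K2 with hM
  have hKK : 0 < K1 * K2 := Nat.mul_pos hK1 hK2
  have hMK : M = 51200 * (K1 * K2) := by rw [hM]; ring
  have hMpos : 0 < M := by omega
  have hKR : (1 : ℝ) ≤ (K1 * K2 : ℕ) := by exact_mod_cast hKK
  obtain ⟨c, hcpos, hcM, hcc, hc1⟩ : ∃ c : ℝ, 0 < c ∧ c * (4 * M) ≤ 1 ∧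
      c * (16384 * (K1 * K2 : ℕ)) ≤ c0 ∧ c ≤ 1 := by
    have hMR : (0 : ℝ) < 4 * M := by have : (0 : ℝ) < M := by exact_mod_cast hMpos
                                     linarith
    have hKR' : (0 : ℝ) < 16384 * (K1 * K2 : ℕ) := by linarith
    refine ⟨min (1 / (4 * M)) (min (c0 / (16384 * (K1 * K2 : ℕ))) 1), ?_, ?_, ?_, ?_⟩
    · positivity
    · rw [← le_div_iff₀ hMR]; exact min_le_left _ _
    · rw [← le_div_iff₀ hKR']; exact (min_le_right _ _).trans (min_le_left _ _)
    · exact (min_le_right _ _).trans (min_le_right _ _)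
  refine ⟨c, hcpos, ?_⟩
  intro U Φ hΦ
  have main : ∀ p : ℕ, ∀ P ⊆ U, P.card = p → Set.InjOn Prod.snd (P : Set (ℤ × ℤ)) →
      P.Nonempty → (∀ x, 100 * (P.filter (fun p => p.1 = x)).card ≤ P.card) →
      1 + c * (P.card : ℝ) ^ τ ≤ ((Φ P).card : ℝ) := by
    intro p
    induction p using Nat.strong_induction_on with
    | _ p ih =>
    intro P hP hPp hinj hne hhub
    have hpos := hne.card_pos
    have h2 := two_le_card hΦ P hP hne hinj hhub
    have h2R : (2 : ℝ) ≤ ((Φ P).card : ℝ) := by exact_mod_cast h2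
    have hself := rpow_le_self_nat τ hτ1.le P.card hpos
    have hMR : (0 : ℝ) < M := by exact_mod_cast hMpos
    by_cases hsmall : P.card ≤ M
    · have : (P.card : ℝ) ≤ M := by exact_mod_cast hsmall
      nlinarith
    push Not at hsmall
    by_cases hst : ∃ x, P.card < (P.filter (fun p => p.1 = x)).card * M
    · obtain ⟨x, hx⟩ := hst
      obtain ⟨q, hq, hqx⟩ : ∃ q ∈ P, q.1 ≠ x := by
        by_contra hcon
        push Not at hcon
        have := hhub x
        rw [Finset.filter_true_of_mem hcon] at this
        omega
      have hs := star hΦ P hP hinj x q hq hqx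
      have hsR : ((P.filter (fun p => p.1 = x)).card : ℝ) ≤ 2 * (Φ P).card := by
        exact_mod_cast hs
      have hxR : (P.card : ℝ) ≤ (P.filter (fun p => p.1 = x)).card * M := by
        exact_mod_cast hx.le
      set m := ((P.filter (fun p => p.1 = x)).card : ℝ) with hm
      have hm0 : 0 ≤ m := by positivity
      have : c * (P.card : ℝ) ^ τ ≤ m / 4 := by
        calc c * (P.card : ℝ) ^ τ ≤ c * (m * M) := by
              gcongr; exact hself.trans hxR
          _ = (c * (4 * M)) * (m / 4) := by ring
          _ ≤ 1 * (m / 4) := by gcongr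
          _ = m / 4 := one_mul _
      linarith
    push Not at hst
    obtain ⟨P1, P2, hP1, hP2, hc1', hc2', hsep⟩ := halve P hne hinj hhub
    have hn1 : P1.Nonempty := Finset.card_pos.1 (by omega)
    have hn2 : P2.Nonempty := Finset.card_pos.1 (by omega)
    have hst' : ∀ S ⊆ P, ∀ x,
        (S.filter (fun p => p.1 = x)).card * (51200 * (K1 * K2)) ≤ P.card := by
      intro S hS x
      rw [← hMK]
      exact (Nat.mul_le_mul_right _
        (Finset.card_le_card (Finset.filter_subset_filter _ hS))).trans (hst x)
    have hk1 : K1 ≤ K1 * K2 := Nat.le_mul_of_pos_right _ hK2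
    have hk2 : K2 ≤ K1 * K2 := Nat.le_mul_of_pos_left _ hK1
    obtain ⟨f1, f2, f3⟩ := floor_bound P1.card K1 hK1 (by omega)
    set N1 := P1.card / (4 * K1) with hN1
    have g1 : P.card ≤ 64 * K1 * N1 := by
      calc P.card ≤ 8 * P1.card := hc1'
        _ ≤ 8 * (8 * K1 * N1) := by omega
        _ = _ := by ring
    have hP1P : P1.card ≤ P.card := Finset.card_le_card hP1
    have hN1lt : N1 < P.card := by
      have : 3 * N1 ≤ K1 * (3 * N1) := Nat.le_mul_of_pos_left _ hK1
      omega
    -- hubs are small with respect to `N1`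
    have hubN1 : ∀ S ⊆ P, ∀ x, 100 * (S.filter (fun p => p.1 = x)).card ≤ N1 := by
      intro S hS x
      have a1 := hst' S hS x
      set m := (S.filter (fun p => p.1 = x)).card
      by_contra hcon
      push Not at hcon
      have a2 : 64 * K1 * N1 < 64 * K1 * (100 * m) :=
        Nat.mul_lt_mul_of_pos_left hcon (by omega)
      have a3 : 64 * K1 * (100 * m) ≤ m * (51200 * (K1 * K2)) := by nlinarith
      omega
    have mono1 : ((Φ P1).card : ℝ) ≤ (Φ P).card := by
      exact_mod_cast Finset.card_le_card (hΦ.mono _ _ hP1 hP)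
    by_cases hsw : ∀ e ∈ P1, (P1.filter (fun p => p.1 < e.1 ∧ p.2 < e.2)).card ≤ N1
    · have hch := chain hΦ N1 N1 f3 (c * (N1 : ℝ) ^ τ) K1 P1 (hP1.trans hP)
        (hinj.mono (by exact_mod_cast hP1)) (fun x => by have := hubN1 P1 hP1 x; omega) hsw
        (by
          intro B hB hBc
          have := ih N1 (by omega) B ((hB.trans hP1).trans hP) hBc
            (hinj.mono (by exact_mod_cast hB.trans hP1)) (Finset.card_pos.1 (by omega))
            (by rw [hBc]; exact hubN1 B (hB.trans hP1))
          rwa [hBc] at this)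
        (by rw [show 2 * N1 + N1 = 3 * N1 by ring]; exact f2)
      have hr := chain_real τ 64 P.card K1 N1 hK1 hτ0 hτ1.le (by norm_num) (by positivity)
        (by exact_mod_cast g1) hK1'
      have : c * (P.card : ℝ) ^ τ ≤ K1 * (c * (N1 : ℝ) ^ τ) := by
        calc c * (P.card : ℝ) ^ τ ≤ c * (K1 * (N1 : ℝ) ^ τ) := by gcongr
          _ = _ := by ring
      linarith
    push Not at hsw
    obtain ⟨e, he, hR⟩ := hsw
    set R := P1.filter (fun p => p.1 < e.1 ∧ p.2 < e.2) with hRdef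
    have hR1 : R ⊆ P1 := Finset.filter_subset _ _
    have hRP : R ⊆ P := hR1.trans hP1
    have hRbig : 8 * K2 ≤ R.card := by
      by_contra hcon
      push Not at hcon
      have a1 : 64 * K1 * N1 ≤ 64 * K1 * (8 * K2) := Nat.mul_le_mul_left _ (by omega)
      have a2 : 64 * K1 * (8 * K2) = 512 * (K1 * K2) := by ring
      omega
    obtain ⟨f1', f2', f3'⟩ := floor_bound R.card K2 hK2 hRbig
    set N2 := R.card / (4 * K2) with hN2
    have g2 : P.card ≤ 512 * K1 * K2 * N2 := by
      calc P.card ≤ 64 * K1 * N1 := g1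
        _ ≤ 64 * K1 * (8 * K2 * N2) := Nat.mul_le_mul_left _ (by omega)
        _ = _ := by ring
    have hRPc : R.card ≤ P.card := Finset.card_le_card hRP
    have hN2lt : N2 < P.card := by
      have : 3 * N2 ≤ K2 * (3 * N2) := Nat.le_mul_of_pos_left _ hK2
      omega
    have hubN2 : ∀ S ⊆ P, ∀ x, 100 * (S.filter (fun p => p.1 = x)).card ≤ N2 := by
      intro S hS x
      have a1 := hst' S hS x
      set m := (S.filter (fun p => p.1 = x)).card
      by_contra hcon
      push Not at hcon
      have a2 : 512 * K1 * K2 * N2 < 512 * K1 * K2 * (100 * m) :=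
        Nat.mul_lt_mul_of_pos_left hcon (by positivity)
      have a3 : 512 * K1 * K2 * (100 * m) = m * (51200 * (K1 * K2)) := by ring
      omega
    by_cases hnw : ∀ e' ∈ R, (R.filter (fun p => p.1 < e'.1 ∧ e'.2 < p.2)).card ≤ N2
    · have hch := chain' hΦ N2 N2 f3' (c * (N2 : ℝ) ^ τ) K2 R (hRP.trans hP)
        (hinj.mono (by exact_mod_cast hRP)) (fun x => by have := hubN2 R hRP x; omega) hnw
        (by
          intro B hB hBc
          have := ih N2 (by omega) B ((hB.trans hRP).trans hP) hBc
            (hinj.mono (by exact_mod_cast hB.trans hRP)) (Finset.card_pos.1 (by omega))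
            (by rw [hBc]; exact hubN2 B (hB.trans hRP))
          rwa [hBc] at this)
        (by rw [show 2 * N2 + N2 = 3 * N2 by ring]; exact f2')
      have hK1R : (1 : ℝ) ≤ K1 := by exact_mod_cast hK1
      have hr := chain_real τ (512 * K1) P.card K2 N2 hK2 hτ0 hτ1.le (by linarith)
        (by positivity) (by exact_mod_cast g2) hK2'
      have : c * (P.card : ℝ) ^ τ ≤ K2 * (c * (N2 : ℝ) ^ τ) := by
        calc c * (P.card : ℝ) ^ τ ≤ c * (K2 * (N2 : ℝ) ^ τ) := by gcongr
          _ = _ := by ring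
      have mono2 : ((Φ R).card : ℝ) ≤ (Φ P).card := by
        exact_mod_cast Finset.card_le_card (hΦ.mono _ _ hRP hP)
      linarith
    push Not at hnw
    obtain ⟨e', he', hR'⟩ := hnw
    set R' := R.filter (fun p => p.1 < e'.1 ∧ e'.2 < p.2) with hR'def
    have hd := diff_card hΦ P1 R' (hP1.trans hP) ((Finset.filter_subset _ _).trans hR1)
      (hinj.mono (by exact_mod_cast hP1)) e e' he (hR1 he')
      (fun p hp => (Finset.mem_filter.1 (Finset.mem_filter.1 hp).1).2)
      (fun p hp => (Finset.mem_filter.1 hp).2)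
    have hrz := ruzsa_case hΦ P P1 P2 R' hP hP1 hP2 hn1 hn2 hsep hd
    have hA := hC U Φ hΦ P2 (hP2.trans hP) (hinj.mono (by exact_mod_cast hP2)) hn2
      (by
        intro x
        have a1 := hst' P2 hP2 x
        set m := (P2.filter (fun p => p.1 = x)).card
        have a3 : m * (51200 * 1) ≤ m * (51200 * (K1 * K2)) :=
          Nat.mul_le_mul_left _ (by omega)
        omega)
    have hrzR : (R'.card : ℝ) * (Φ P2).card ≤ (Φ P).card * (Φ P).card := by exact_mod_cast hrz
    have hpR : (0 : ℝ) < P.card := by exact_mod_cast hpos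
    have b1 : (P.card : ℝ) ≤ 512 * (K1 * K2 : ℕ) * R'.card := by
      have : P.card ≤ 512 * (K1 * K2) * R'.card := by
        calc P.card ≤ 512 * K1 * K2 * N2 := g2
          _ ≤ 512 * K1 * K2 * R'.card := Nat.mul_le_mul_left _ hR'.le
          _ = _ := by ring
      exact_mod_cast this
    have b2 : c0 * (P.card : ℝ) ^ θ ≤ 8 * (Φ P2).card := by
      have a1 : (P.card : ℝ) ≤ 8 * P2.card := by exact_mod_cast hc2'
      have a2 : (P.card : ℝ) ^ θ ≤ 8 * (P2.card : ℝ) ^ θ := by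
        calc (P.card : ℝ) ^ θ ≤ (8 * P2.card : ℝ) ^ θ := Real.rpow_le_rpow hpR.le a1 h0
          _ = (8 : ℝ) ^ θ * (P2.card : ℝ) ^ θ := Real.mul_rpow (by norm_num) (by positivity)
          _ ≤ 8 * (P2.card : ℝ) ^ θ := by
            gcongr
            calc (8 : ℝ) ^ θ ≤ (8 : ℝ) ^ (1 : ℝ) :=
                  Real.rpow_le_rpow_of_exponent_le (by norm_num) h1.le
              _ = 8 := Real.rpow_one _
      nlinarith
    have b3 : (P.card : ℝ) ^ τ * (P.card : ℝ) ^ τ = P.card * (P.card : ℝ) ^ θ := by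
      rw [← Real.rpow_add hpR, show τ + τ = 1 + θ by rw [hτ]; ring, Real.rpow_add hpR,
        Real.rpow_one]
    have b4 : c0 * ((P.card : ℝ) ^ τ * (P.card : ℝ) ^ τ) ≤
        4096 * (K1 * K2 : ℕ) * ((Φ P).card * (Φ P).card) := by
      rw [b3]
      calc c0 * (P.card * (P.card : ℝ) ^ θ) = P.card * (c0 * (P.card : ℝ) ^ θ) := by ring
        _ ≤ (512 * (K1 * K2 : ℕ) * R'.card) * (8 * (Φ P2).card) := by gcongr
        _ = 4096 * (K1 * K2 : ℕ) * (R'.card * (Φ P2).card) := by ring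
        _ ≤ _ := by gcongr
    have b5 : (2 * c * (P.card : ℝ) ^ τ) ^ 2 ≤ ((Φ P).card : ℝ) ^ 2 := by
      set X := (P.card : ℝ) ^ τ with hX
      have hX0 : 0 ≤ X := by positivity
      set k : ℝ := ((K1 * K2 : ℕ) : ℝ) with hk
      have hk0 : 0 < k := by linarith
      set F : ℝ := ((Φ P).card : ℝ)
      have d1 : c * (16384 * k) * (X * X) ≤ c0 * (X * X) := by gcongr
      have d2 : c * c * (16384 * k) * (X * X) ≤ c * (16384 * k) * (X * X) := by
        have : c * c ≤ c * 1 := by gcongr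
        have : c * c ≤ c := by linarith
        gcongr
      have d3 : 4096 * k * (2 * c * X) ^ 2 ≤ 4096 * k * F ^ 2 := by nlinarith
      exact le_of_mul_le_mul_left d3 (by positivity)
    have b6 := abs_le_of_sq_le_sq' b5 (by positivity)
    linarith [b6.2]
  intro P hP hinj hne hhub
  exact main P.card P hP rfl hinj hne hhub

lemma claim_lt (θ : ℝ) (h1 : θ < 1) : ∃ τ : ℝ, θ ≤ τ ∧ 0 ≤ τ ∧ τ < 1 ∧ Claim τ := by
  have key : ∀ k : ℕ, Claim (1 - (1 / 2) ^ k) := by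
    intro k
    induction k with
    | zero => simpa using claim_zero
    | succ k ih =>
      have e : (1 : ℝ) - (1 / 2) ^ (k + 1) = (1 + (1 - (1 / 2) ^ k)) / 2 := by
        rw [pow_succ]; ring
      rw [e]
      refine step _ ?_ ?_ ih
      · have : ((1 : ℝ) / 2) ^ k ≤ 1 := pow_le_one₀ (by norm_num) (by norm_num)
        linarith
      · have : (0 : ℝ) < (1 / 2) ^ k := by positivity
        linarith
  obtain ⟨k, hk⟩ := exists_pow_lt_of_lt_one (show (0 : ℝ) < 1 - θ by linarith)
    (show (1 / 2 : ℝ) < 1 by norm_num)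
  refine ⟨1 - (1 / 2) ^ k, by linarith, ?_, ?_, key k⟩
  · have : ((1 : ℝ) / 2) ^ k ≤ 1 := pow_le_one₀ (by norm_num) (by norm_num)
    linarith
  · have : (0 : ℝ) < (1 / 2) ^ k := by positivity
    linarith

end HamCyc

open scoped Pointwise

namespace HamCyc

/-- `HP A s a b l`: there is a path of length `l` from `a` to `b` inside `s`. -/
inductive HP (A : ℤ → ℤ → Prop) : Finset ℤ → ℤ → ℤ → ℤ → Prop
  | single (a : ℤ) : HP A {a} a a 0
  | append {s t : Finset ℤ} {a b c d k l : ℤ} : HP A s a b k → A b c → HP A t c d l →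
      Disjoint s t → HP A (s ∪ t) a d (k + 1 + l)
  | mono {s t : Finset ℤ} {a b k : ℤ} : HP A s a b k → s ⊆ t → HP A t a b k

lemma HP.bounds {A : ℤ → ℤ → Prop} {s : Finset ℤ} {a b l : ℤ} (h : HP A s a b l) :
    0 ≤ l ∧ l + 1 ≤ s.card := by
  induction h with
  | single a => simp
  | append _ _ _ hd i1 i2 =>
    rw [Finset.card_union_of_disjoint hd]
    push_cast
    omega
  | mono _ hs i =>
    have := Finset.card_le_card hs
    omega

lemma HP.app {A : ℤ → ℤ → Prop} {s t r : Finset ℤ} {a b c d k l m : ℤ} (h1 : HP A s a b k)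
    (hA : A b c) (h2 : HP A t c d l) (hd : Disjoint s t) (hr : s ∪ t ⊆ r) (hm : m = k + 1 + l) :
    HP A r a d m := by
  subst hm
  exact (HP.append h1 hA h2 hd).mono hr

lemma HP.up {A : ℤ → ℤ → Prop} (hA : ∀ i, A i (i + 1)) (a b : ℤ) (hab : a ≤ b) :
    HP A (Finset.Icc a b) a b (b - a) := by
  induction b, hab using Int.leInduction with
  | base => simpa using HP.single a
  | succ b hab ih =>
    refine ih.app (hA b) (HP.single (b + 1)) ?_ ?_ (by ring)
    · simp
    · intro x hx
      simp only [Finset.mem_union, Finset.mem_Icc, Finset.mem_singleton] at hx ⊢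
      omega

lemma HP.down {A : ℤ → ℤ → Prop} (hA : ∀ i, A i (i + 1)) (hs : ∀ i j, A i j → A j i)
    (a b : ℤ) (hab : a ≤ b) : HP A (Finset.Icc a b) b a (b - a) := by
  induction b, hab using Int.leInduction with
  | base => simpa using HP.single a
  | succ b hab ih =>
    refine (HP.single (b + 1)).app (hs _ _ (hA b)) ih ?_ ?_ (by ring)
    · simp
    · intro x hx
      simp only [Finset.mem_union, Finset.mem_Icc, Finset.mem_singleton] at hx ⊢
      omega

lemma HP.extL {A : ℤ → ℤ → Prop} (hA : ∀ i, A i (i + 1)) {s r : Finset ℤ} {a b l m : ℤ}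
    (h : HP A s a b l) (a0 : ℤ) (ha : a0 ≤ a) (hd : Disjoint (Finset.Icc a0 (a - 1)) s)
    (hr : Finset.Icc a0 (a - 1) ∪ s ⊆ r) (hm : m = l + (a - a0)) : HP A r a0 b m := by
  rcases eq_or_lt_of_le ha with he | hl
  · subst he
    have : m = l := by omega
    subst this
    exact h.mono (Finset.subset_union_right.trans hr)
  · refine (HP.up hA a0 (a - 1) (by omega)).app (c := a) ?_ h hd hr (by omega)
    have := hA (a - 1)
    rwa [sub_add_cancel] at this

lemma HP.extR {A : ℤ → ℤ → Prop} (hA : ∀ i, A i (i + 1)) {s r : Finset ℤ} {a b l m : ℤ}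
    (h : HP A s a b l) (b0 : ℤ) (hb : b ≤ b0) (hd : Disjoint s (Finset.Icc (b + 1) b0))
    (hr : s ∪ Finset.Icc (b + 1) b0 ⊆ r) (hm : m = l + (b0 - b)) : HP A r a b0 m := by
  rcases eq_or_lt_of_le hb with he | hl
  · subst he
    have : m = l := by omega
    subst this
    exact h.mono (Finset.subset_union_left.trans hr)
  · exact h.app (hA b) (HP.up hA (b + 1) b0 (by omega)) hd hr (by omega)

/-- membership of a set of chords in a box -/
def InBox (P : Finset (ℤ × ℤ)) (a b c d : ℤ) : Prop :=
  ∀ p ∈ P, a ≤ p.1 ∧ p.1 ≤ b ∧ c ≤ p.2 ∧ p.2 ≤ d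

lemma InBox.subset {P Q : Finset (ℤ × ℤ)} {a b c d : ℤ} (h : InBox Q a b c d) (hPQ : P ⊆ Q) :
    InBox P a b c d := fun p hp => h p (hPQ hp)

/-- The property defining gains. -/
def IsGain (A : ℤ → ℤ → Prop) (P : Finset (ℤ × ℤ)) (g : ℤ) : Prop :=
  ∀ a b c d, a ≤ b → b < c → InBox P a b c d →
    HP A (Finset.Icc a b ∪ Finset.Icc c d) a b (b - a + g)

open Classical in
/-- The finite set of gains. -/
noncomputable def gains (A : ℤ → ℤ → Prop) (N : ℤ) (P : Finset (ℤ × ℤ)) : Finset ℤ :=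
  (Finset.Icc (-N) N).filter (fun g => IsGain A P g)

lemma mem_gains {A : ℤ → ℤ → Prop} {P : Finset (ℤ × ℤ)} {a0 b0 c0 d0 : ℤ}
    (h1 : a0 ≤ b0) (h2 : b0 < c0) (h3 : c0 ≤ d0) (hP : InBox P a0 b0 c0 d0) (g : ℤ) :
    g ∈ gains A ((b0 - a0) + (d0 - c0) + 2) P ↔ IsGain A P g := by
  classical
  unfold gains
  rw [Finset.mem_filter, and_iff_right_iff_imp]
  intro h
  have := (h a0 b0 c0 d0 h1 h2 hP).bounds
  have hc := Finset.card_union_le (Finset.Icc a0 b0) (Finset.Icc c0 d0)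
  rw [Int.card_Icc, Int.card_Icc] at hc
  rw [Finset.mem_Icc]
  omega

lemma gainAx {A : ℤ → ℤ → Prop} (hA : ∀ i, A i (i + 1)) (hs : ∀ i j, A i j → A j i)
    (U : Finset (ℤ × ℤ)) (a0 b0 c0 d0 : ℤ)
    (h1 : a0 ≤ b0) (h2 : b0 < c0) (h3 : c0 ≤ d0) (hU : InBox U a0 b0 c0 d0)
    (hch : ∀ p ∈ U, A p.1 p.2) :
    GainAx U (gains A ((b0 - a0) + (d0 - c0) + 2)) := by
  classical
  have key : ∀ P ⊆ U, ∀ g, g ∈ gains A ((b0 - a0) + (d0 - c0) + 2) P ↔ IsGain A P g :=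
    fun P hP g => mem_gains h1 h2 h3 (hU.subset hP) g
  refine ⟨?_, ?_, ?_, ?_, ?_⟩
  · intro P hP
    rw [key P hP]
    intro a b c d hab hbc _
    rw [add_zero]
    exact (HP.up hA a b hab).mono Finset.subset_union_left
  · intro P Q hPQ hQ g hg
    rw [key P (hPQ.trans hQ)] at hg
    rw [key Q hQ]
    intro a b c d hab hbc hbox
    exact hg a b c d hab hbc (hbox.subset hPQ)
  · intro P hP p hp q hq hpq hne
    rw [key P hP]
    intro a b c d hab hbc hbox
    obtain ⟨p1, p2, p3, p4⟩ := hbox p hp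
    obtain ⟨q1, q2, q3, q4⟩ := hbox q hq
    have hAp := hch p (hP hp)
    have hAq := hs _ _ (hch q (hP hq))
    have hmid : ∃ m : Finset ℤ, m ⊆ Finset.Icc c d ∧ HP A m p.2 q.2 |q.2 - p.2| := by
      rcases lt_or_gt_of_ne hne with h | h
      · refine ⟨Finset.Icc p.2 q.2, Finset.Icc_subset_Icc p3 q4, ?_⟩
        rw [abs_of_pos (by omega)]
        exact HP.up hA _ _ h.le
      · refine ⟨Finset.Icc q.2 p.2, Finset.Icc_subset_Icc q3 p4, ?_⟩
        rw [abs_of_neg (by omega), show -(q.2 - p.2) = p.2 - q.2 by ring]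
        exact HP.down hA hs _ _ h.le
    obtain ⟨m, hm, hmp⟩ := hmid
    have hm' : ∀ x ∈ m, c ≤ x ∧ x ≤ d := fun x hx => Finset.mem_Icc.1 (hm hx)
    have s1 := HP.app (HP.up hA a p.1 p1) hAp hmp (r := Finset.Icc a p.1 ∪ m)
      (by
        rw [Finset.disjoint_left]
        intro x hx hx'
        have := hm' x hx'
        rw [Finset.mem_Icc] at hx
        omega) (Finset.Subset.refl _) rfl
    refine HP.app s1 hAq (HP.up hA q.1 b q2) ?_ ?_ (by ring)
    · rw [Finset.disjoint_left]
      intro x hx hx'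
      rw [Finset.mem_union] at hx
      rw [Finset.mem_Icc] at hx hx'
      rcases hx with hx | hx
      · omega
      · have := hm' x hx
        omega
    · intro x hx
      simp only [Finset.mem_union, Finset.mem_Icc] at hx ⊢
      rcases hx with (hx | hx) | hx
      · omega
      · exact Or.inr (hm' x hx)
      · omega
  · intro P Q hPn hQn hPQ hsep g hg
    obtain ⟨g1, hg1, g2, hg2, rfl⟩ := Finset.mem_add.1 hg
    rw [key P (Finset.subset_union_left.trans hPQ)] at hg1
    rw [key Q (Finset.subset_union_right.trans hPQ)] at hg2
    rw [key _ hPQ]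
    intro a b c d hab hbc hbox
    obtain ⟨e, he, hemax⟩ := Finset.exists_max_image P Prod.fst hPn
    obtain ⟨f, hf, hfmax⟩ := Finset.exists_max_image P Prod.snd hPn
    obtain ⟨q, hq⟩ := hQn
    have be := hbox e (Finset.mem_union_left _ he)
    have bf := hbox f (Finset.mem_union_left _ hf)
    have bq := hbox q (Finset.mem_union_right _ hq)
    have sq := hsep e he q hq
    have sf := hsep f hf q hq
    have r1 := hg1 a e.1 c f.2 (by omega) (by omega) (by
      intro p hp
      have := hbox p (Finset.mem_union_left _ hp)
      have i1 : p.1 ≤ e.1 := hemax p hp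
      have i2 : p.2 ≤ f.2 := hfmax p hp
      omega)
    have r2 := hg2 (e.1 + 1) b (f.2 + 1) d (by omega) (by omega) (by
      intro p hp
      have := hbox p (Finset.mem_union_right _ hp)
      have i1 := hsep e he p hp
      have i2 := hsep f hf p hp
      omega)
    refine HP.app r1 (hA e.1) r2 ?_ ?_ (by ring)
    · rw [Finset.disjoint_left]
      intro x hx hx'
      simp only [Finset.mem_union, Finset.mem_Icc] at hx hx'
      omega
    · intro x hx
      simp only [Finset.mem_union, Finset.mem_Icc] at hx ⊢
      omega
  · intro P Q hPn hQn hPQ hsep g hg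
    obtain ⟨g1, hg1, g2, hg2, rfl⟩ := Finset.mem_add.1 hg
    rw [key P (Finset.subset_union_left.trans hPQ)] at hg1
    rw [key Q (Finset.subset_union_right.trans hPQ)] at hg2
    rw [key _ hPQ]
    intro a b c d hab hbc hbox
    obtain ⟨e, he, hemax⟩ := Finset.exists_max_image P Prod.fst hPn
    obtain ⟨f, hf, hfmax⟩ := Finset.exists_max_image Q Prod.snd hQn
    have be := hbox e (Finset.mem_union_left _ he)
    have bf := hbox f (Finset.mem_union_right _ hf)
    have sf := hsep e he f hf
    have r1 := hg1 a e.1 (f.2 + 1) d (by omega) (by omega) (by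
      intro p hp
      have := hbox p (Finset.mem_union_left _ hp)
      have i1 : p.1 ≤ e.1 := hemax p hp
      have i2 := hsep p hp f hf
      omega)
    have r2 := hg2 (e.1 + 1) b c f.2 (by omega) (by omega) (by
      intro p hp
      have := hbox p (Finset.mem_union_right _ hp)
      have i1 := hsep e he p hp
      have i2 : p.2 ≤ f.2 := hfmax p hp
      omega)
    refine HP.app r1 (hA e.1) r2 ?_ ?_ (by ring)
    · rw [Finset.disjoint_left]
      intro x hx hx'
      simp only [Finset.mem_union, Finset.mem_Icc] at hx hx'
      omega
    · intro x hx
      simp only [Finset.mem_union, Finset.mem_Icc] at hx ⊢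
      omega

open Classical in
/-- The set of path lengths. -/
noncomputable def Len (A : ℤ → ℤ → Prop) (s : Finset ℤ) (a b : ℤ) : Finset ℤ :=
  (Finset.Icc 0 (s.card : ℤ)).filter (fun l => HP A s a b l)

lemma mem_Len {A : ℤ → ℤ → Prop} {s : Finset ℤ} {a b l : ℤ} :
    l ∈ Len A s a b ↔ HP A s a b l := by
  classical
  unfold Len
  rw [Finset.mem_filter, and_iff_right_iff_imp]
  intro h
  have := h.bounds
  rw [Finset.mem_Icc]
  omega

/-- The set of path lengths in a two interval box. -/
noncomputable def Bx (A : ℤ → ℤ → Prop) (a b c d : ℤ) : Finset ℤ :=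
  Len A (Finset.Icc a b ∪ Finset.Icc c d) a d

lemma chord_mem {A : ℤ → ℤ → Prop} (hA : ∀ i, A i (i + 1)) {a b c d : ℤ} (hbc : b < c)
    (x y : ℤ) (h1 : a ≤ x) (h2 : x ≤ b) (h3 : c ≤ y) (h4 : y ≤ d) (hxy : A x y) :
    x - a + 1 + (d - y) ∈ Bx A a b c d := by
  rw [Bx, mem_Len]
  refine HP.app (HP.up hA a x h1) hxy (HP.up hA y d h4) ?_ ?_ rfl
  · rw [Finset.disjoint_left]
    intro z hx hx'
    simp only [Finset.mem_Icc] at hx hx'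
    omega
  · intro z hx
    simp only [Finset.mem_union, Finset.mem_Icc] at hx ⊢
    omega

lemma star_Bx {A : ℤ → ℤ → Prop} (hA : ∀ i, A i (i + 1)) {a b c d : ℤ} (hbc : b < c)
    (P : Finset (ℤ × ℤ)) (hch : ∀ p ∈ P, A p.1 p.2) (hbox : InBox P a b c d)
    (hinj : Set.InjOn Prod.snd (P : Set (ℤ × ℤ))) (x : ℤ) :
    (P.filter (fun p => p.1 = x)).card ≤ (Bx A a b c d).card := by
  refine Finset.card_le_card_of_injOn (fun p => p.1 - a + 1 + (d - p.2)) ?_ ?_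
  · intro p hp
    have hp' := (Finset.mem_filter.1 (Finset.mem_coe.1 hp)).1
    obtain ⟨h1, h2, h3, h4⟩ := hbox p hp'
    exact chord_mem hA hbc p.1 p.2 h1 h2 h3 h4 (hch p hp')
  · intro p hp q hq hpq
    obtain ⟨p1, p2⟩ := Finset.mem_filter.1 (Finset.mem_coe.1 hp)
    obtain ⟨q1, q2⟩ := Finset.mem_filter.1 (Finset.mem_coe.1 hq)
    simp only at hpq
    exact hinj p1 q1 (show p.2 = q.2 by omega)

lemma split_Bx {A : ℤ → ℤ → Prop} (hA : ∀ i, A i (i + 1)) {a b c d m y : ℤ} (hbc : b < c)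
    (h1 : a ≤ m) (h2 : m + 1 ≤ b) (h3 : c ≤ y) (h4 : y + 1 ≤ d) :
    (Bx A a m (y + 1) d).card + (Bx A (m + 1) b c y).card ≤ (Bx A a b c d).card := by
  classical
  set T := (Bx A (m + 1) b c y).image (fun l => l + ((m + 1 - a) + (d - y))) with hT
  have hTc : T.card = (Bx A (m + 1) b c y).card :=
    Finset.card_image_of_injective _ (add_left_injective _)
  have hdis : Disjoint (Bx A a m (y + 1) d) T := by
    rw [Finset.disjoint_left]
    intro l hl hl'
    obtain ⟨k, hk, rfl⟩ := Finset.mem_image.1 hl'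
    rw [Bx, mem_Len] at hl hk
    have b1 := hl.bounds
    have b2 := hk.bounds
    have hc := Finset.card_union_le (Finset.Icc a m) (Finset.Icc (y + 1) d)
    rw [Int.card_Icc, Int.card_Icc] at hc
    omega
  rw [← hTc, ← Finset.card_union_of_disjoint hdis]
  refine Finset.card_le_card (Finset.union_subset ?_ ?_)
  · intro l hl
    rw [Bx, mem_Len] at hl ⊢
    refine hl.mono ?_
    intro z hx
    simp only [Finset.mem_union, Finset.mem_Icc] at hx ⊢
    omega
  · intro l hl
    obtain ⟨k, hk, rfl⟩ := Finset.mem_image.1 hl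
    rw [Bx, mem_Len] at hk ⊢
    have e1 := HP.extL hA hk a (by omega) (r := Finset.Icc a b ∪ Finset.Icc c y)
      (m := k + (m + 1 - a))
      (by
        rw [Finset.disjoint_left]
        intro z hx hx'
        simp only [Finset.mem_union, Finset.mem_Icc] at hx hx'
        omega)
      (by
        intro z hx
        simp only [Finset.mem_union, Finset.mem_Icc] at hx ⊢
        omega) rfl
    refine HP.extR hA e1 d (by omega) ?_ ?_ (by ring)
    · rw [Finset.disjoint_left]
      intro z hx hx'
      simp only [Finset.mem_union, Finset.mem_Icc] at hx hx'
      omega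
    · intro z hx
      simp only [Finset.mem_union, Finset.mem_Icc] at hx ⊢
      omega

lemma gain_Bx {A : ℤ → ℤ → Prop} (hA : ∀ i, A i (i + 1)) {a b c d : ℤ} (hbc : b < c)
    (R : Finset (ℤ × ℤ)) (hne : R.Nonempty) (hbox : InBox R a b c d) (e : ℤ × ℤ)
    (he : A e.1 e.2) (heb : e.1 ≤ b) (hed : e.2 ≤ d)
    (hR : ∀ p ∈ R, p.1 < e.1 ∧ p.2 < e.2) (T : Finset ℤ) (hT : ∀ g ∈ T, IsGain A R g) :
    T.card ≤ (Bx A a b c d).card := by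
  refine Finset.card_le_card_of_injOn (fun g => (e.1 - 1 - a + g) + 1 + 1 + (d - e.2)) ?_ ?_
  · intro g hg
    obtain ⟨r, hr⟩ := hne
    have br := hbox r hr
    have hr' := hR r hr
    have g1 := hT g hg a (e.1 - 1) c (e.2 - 1) (by omega) (by omega) (by
      intro p hp
      have := hbox p hp
      have := hR p hp
      omega)
    have hA' := hA (e.1 - 1)
    rw [sub_add_cancel] at hA'
    have s2 : HP A (Finset.Icc e.1 e.1 ∪ Finset.Icc e.2 d) e.1 d (0 + 1 + (d - e.2)) := by
      refine HP.app (HP.up hA e.1 e.1 le_rfl) he (HP.up hA e.2 d hed) ?_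
        (Finset.Subset.refl _) (by ring)
      rw [Finset.disjoint_left]
      intro z hx hx'
      simp only [Finset.mem_Icc] at hx hx'
      omega
    refine Finset.mem_coe.2 ?_
    rw [Bx, mem_Len]
    refine HP.app g1 hA' s2 ?_ ?_ (by ring)
    · rw [Finset.disjoint_left]
      intro z hx hx'
      simp only [Finset.mem_union, Finset.mem_Icc] at hx hx'
      omega
    · intro z hx
      simp only [Finset.mem_union, Finset.mem_Icc] at hx ⊢
      omega
  · intro g _ g' _ h
    simp only at h
    omega

end HamCyc

open scoped Pointwise

namespace HamCyc

lemma chain_Bx {A : ℤ → ℤ → Prop} (hA : ∀ i, A i (i + 1)) (N t : ℕ) (hN : 0 < N) (g : ℝ)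
    (K : ℕ) : ∀ (P : Finset (ℤ × ℤ)) (a b c d : ℤ), b < c →
    InBox P a b c d → Set.InjOn Prod.snd (P : Set (ℤ × ℤ)) →
    (∀ x, (P.filter (fun p => p.1 = x)).card ≤ N) →
    (∀ e ∈ P, (P.filter (fun p => p.1 < e.1 ∧ p.2 < e.2)).card ≤ t) →
    (∀ B ⊆ P, B.card = N → ∀ a b c d : ℤ, b < c → InBox B a b c d →
      g ≤ ((Bx A a b c d).card : ℝ)) →
    K * (2 * N + t) ≤ P.card → K * g ≤ ((Bx A a b c d).card : ℝ) := by
  classical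
  induction K with
  | zero =>
    intro P a b c d _ _ _ _ _ _ _
    simp
  | succ K ih =>
    intro P a b c d hbc hbox hinj hhub hsw hg hcard
    have hc : (K + 1) * (2 * N + t) = K * (2 * N + t) + (2 * N + t) := by ring
    obtain ⟨B, P', hB, hP', hBc, hP'c, hsep⟩ := peel P hinj N t hN hhub (by omega) hsw
    have hBne : B.Nonempty := Finset.card_pos.1 (by omega)
    rcases P'.eq_empty_or_nonempty with he | hne
    · subst he
      have hK : K = 0 := by
        simp only [Finset.card_empty] at hP'c
        by_contra hK
        have : 1 * (2 * N + t) ≤ K * (2 * N + t) := Nat.mul_le_mul_right _ (by omega)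
        omega
      subst hK
      have := hg B hB hBc a b c d hbc (hbox.subset hB)
      push_cast
      linarith
    · obtain ⟨e, he, hemax⟩ := Finset.exists_max_image B Prod.fst hBne
      obtain ⟨f, hf, hfmax⟩ := Finset.exists_max_image P' Prod.snd hne
      have be := hbox e (hB he)
      have bf := hbox f (hP' hf)
      have sf := hsep e he f hf
      have h1 := hg B hB hBc a e.1 (f.2 + 1) d (by omega) (by
        intro p hp
        have := hbox p (hB hp)
        have i1 : p.1 ≤ e.1 := hemax p hp
        have i2 := hsep p hp f hf
        omega)
      have h2 := ih P' (e.1 + 1) b c f.2 hbc (by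
          intro p hp
          have := hbox p (hP' hp)
          have i1 := hsep e he p hp
          have i2 : p.2 ≤ f.2 := hfmax p hp
          omega)
        (hinj.mono (by exact_mod_cast hP'))
        (fun x => (Finset.card_le_card (Finset.filter_subset_filter _ hP')).trans (hhub x))
        (fun e he => (Finset.card_le_card (Finset.filter_subset_filter _ hP')).trans
          (hsw e (hP' he)))
        (fun C hC => hg C (hC.trans hP')) (by omega)
      have h3 := split_Bx hA (a := a) (b := b) (c := c) (d := d) (m := e.1) (y := f.2) hbc
        (by omega) (by omega) (by omega) (by omega)
      have h3' : ((Bx A a e.1 (f.2 + 1) d).card : ℝ) + (Bx A (e.1 + 1) b c f.2).card ≤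
        (Bx A a b c d).card := by exact_mod_cast h3
      push_cast
      linarith

lemma cross (τ : ℝ) (h0 : 0 ≤ τ) (h1 : τ < 1) (hcl : Claim τ) :
    ∃ κ : ℝ, 0 < κ ∧ ∀ (A : ℤ → ℤ → Prop), (∀ i, A i (i + 1)) → (∀ i j, A i j → A j i) →
      ∀ (P : Finset (ℤ × ℤ)) (a b c d : ℤ), b < c → P.Nonempty →
      InBox P a b c d → Set.InjOn Prod.snd (P : Set (ℤ × ℤ)) → (∀ p ∈ P, A p.1 p.2) →
      κ * (P.card : ℝ) ^ τ ≤ ((Bx A a b c d).card : ℝ) := by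
  classical
  obtain ⟨c0, hc0, hC⟩ := hcl
  obtain ⟨K, hK, hK'⟩ := exists_K (1 - τ) 8 (by linarith)
  have hKR : (1 : ℝ) ≤ K := by exact_mod_cast hK
  obtain ⟨κ, hκ, hκ1, hκ2⟩ : ∃ κ : ℝ, 0 < κ ∧ κ * (800 * K) ≤ 1 ∧ κ * (8 * K) ≤ c0 := by
    refine ⟨min (1 / (800 * K)) (c0 / (8 * K)), by positivity, ?_, ?_⟩
    · rw [← le_div_iff₀ (by positivity)]; exact min_le_left _ _
    · rw [← le_div_iff₀ (by positivity)]; exact min_le_right _ _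
  refine ⟨κ, hκ, ?_⟩
  intro A hA hs
  have main : ∀ n : ℕ, ∀ (P : Finset (ℤ × ℤ)) (a b c d : ℤ), P.card = n → b < c → P.Nonempty →
      InBox P a b c d → Set.InjOn Prod.snd (P : Set (ℤ × ℤ)) → (∀ p ∈ P, A p.1 p.2) →
      κ * (P.card : ℝ) ^ τ ≤ ((Bx A a b c d).card : ℝ) := by
    intro n
    induction n using Nat.strong_induction_on with
    | _ n ih =>
    intro P a b c d hPn hbc hne hbox hinj hch
    have hpos := hne.card_pos
    have hself := rpow_le_self_nat τ h1.le P.card hpos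
    by_cases hst : ∃ x, P.card < (P.filter (fun p => p.1 = x)).card * (800 * K)
    · obtain ⟨x, hx⟩ := hst
      have hsx := star_Bx hA hbc P hch hbox hinj x
      have hxR : (P.card : ℝ) ≤ (P.filter (fun p => p.1 = x)).card * (800 * K) := by
        exact_mod_cast hx.le
      have hsR : ((P.filter (fun p => p.1 = x)).card : ℝ) ≤ (Bx A a b c d).card := by
        exact_mod_cast hsx
      set m := ((P.filter (fun p => p.1 = x)).card : ℝ) with hm
      have hm0 : 0 ≤ m := by positivity
      calc κ * (P.card : ℝ) ^ τ ≤ κ * (m * (800 * K)) := by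
              gcongr; exact hself.trans hxR
        _ = (κ * (800 * K)) * m := by ring
        _ ≤ 1 * m := by gcongr
        _ ≤ _ := by linarith
    push Not at hst
    have hbig : 8 * K ≤ P.card := by
      obtain ⟨p, hp⟩ := hne
      have a1 : 0 < (P.filter (fun q => q.1 = p.1)).card :=
        Finset.card_pos.2 ⟨p, Finset.mem_filter.2 ⟨hp, rfl⟩⟩
      have a2 := hst p.1
      have a3 : 1 * (800 * K) ≤ (P.filter (fun q => q.1 = p.1)).card * (800 * K) :=
        Nat.mul_le_mul_right _ a1
      omega
    obtain ⟨f1, f2, f3⟩ := floor_bound P.card K hK hbig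
    set N := P.card / (4 * K) with hN
    have hubN : ∀ S ⊆ P, ∀ x, 100 * (S.filter (fun p => p.1 = x)).card ≤ N := by
      intro S hS x
      have a0 := Finset.card_le_card (Finset.filter_subset_filter (fun p => p.1 = x) hS)
      have a1 := hst x
      by_contra hcon
      push Not at hcon
      have a2 : 8 * K * N < 8 * K * (100 * (P.filter (fun p => p.1 = x)).card) :=
        Nat.mul_lt_mul_of_pos_left (by omega) (by omega)
      have a3 : 8 * K * (100 * (P.filter (fun p => p.1 = x)).card) =
        (P.filter (fun p => p.1 = x)).card * (800 * K) := by ring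
      omega
    have hNlt : N < P.card := by
      have : 3 * N ≤ K * (3 * N) := Nat.le_mul_of_pos_left _ hK
      omega
    by_cases hsw : ∀ e ∈ P, (P.filter (fun p => p.1 < e.1 ∧ p.2 < e.2)).card ≤ N
    · have hcn := chain_Bx hA N N f3 (κ * (N : ℝ) ^ τ) K P a b c d hbc hbox hinj
        (fun x => by have := hubN P (Finset.Subset.refl _) x; omega) hsw
        (by
          intro B hB hBc a b c d hbc hbx
          have := ih N (by omega) B a b c d hBc hbc (Finset.card_pos.1 (by omega)) hbx
            (hinj.mono (by exact_mod_cast hB)) (fun p hp => hch p (hB hp))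
          rwa [hBc] at this)
        (by rw [show 2 * N + N = 3 * N by ring]; exact f2)
      have hr := chain_real τ 8 P.card K N hK h0 h1.le (by norm_num) (by positivity)
        (by exact_mod_cast f1) hK'
      calc κ * (P.card : ℝ) ^ τ ≤ κ * (K * (N : ℝ) ^ τ) := by gcongr
        _ = K * (κ * (N : ℝ) ^ τ) := by ring
        _ ≤ _ := hcn
    push Not at hsw
    obtain ⟨e, he, hR⟩ := hsw
    set R := P.filter (fun p => p.1 < e.1 ∧ p.2 < e.2) with hRdef
    have hRP : R ⊆ P := Finset.filter_subset _ _
    have hRne : R.Nonempty := Finset.card_pos.1 (by omega)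
    have be := hbox e he
    have hbR := hbox.subset hRP
    have hax := gainAx hA hs R a b c d (by omega) hbc (by omega) hbR
      (fun p hp => hch p (hRP hp))
    have hG := hC R _ hax R (Finset.Subset.refl _) (hinj.mono (by exact_mod_cast hRP)) hRne
      (fun x => (hubN R hRP x).trans hR.le)
    have hgb := gain_Bx hA hbc R hRne hbR e (hch e he) (by omega) (by omega)
      (fun p hp => (Finset.mem_filter.1 hp).2) _
      (fun g hg => (mem_gains (by omega) hbc (by omega) hbR g).1 hg)
    have hgbR : ((gains A (b - a + (d - c) + 2) R).card : ℝ) ≤ (Bx A a b c d).card := by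
      exact_mod_cast hgb
    have hp1 : (P.card : ℝ) ^ τ ≤ 8 * K * (R.card : ℝ) ^ τ := by
      have a1 : (P.card : ℝ) ≤ 8 * K * R.card := by
        have : P.card ≤ 8 * K * R.card := f1.trans (Nat.mul_le_mul_left _ hR.le)
        exact_mod_cast this
      calc (P.card : ℝ) ^ τ ≤ (8 * K * R.card : ℝ) ^ τ :=
            Real.rpow_le_rpow (by positivity) a1 h0
        _ = (8 * K : ℝ) ^ τ * (R.card : ℝ) ^ τ := Real.mul_rpow (by positivity) (by positivity)
        _ ≤ (8 * K) * (R.card : ℝ) ^ τ := by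
          gcongr
          calc (8 * K : ℝ) ^ τ ≤ (8 * K : ℝ) ^ (1 : ℝ) :=
                Real.rpow_le_rpow_of_exponent_le (by linarith) h1.le
            _ = 8 * K := Real.rpow_one _
    have : κ * (P.card : ℝ) ^ τ ≤ c0 * (R.card : ℝ) ^ τ := by
      calc κ * (P.card : ℝ) ^ τ ≤ κ * (8 * K * (R.card : ℝ) ^ τ) := by gcongr
        _ = κ * (8 * K) * (R.card : ℝ) ^ τ := by ring
        _ ≤ _ := by gcongr
    linarith
  intro P a b c d hbc hne hbox hinj hch
  exact main P.card P a b c d rfl hbc hne hbox hinj hch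

/-- Path lengths across one interval. -/
noncomputable def Iv (A : ℤ → ℤ → Prop) (lo hi : ℤ) : Finset ℤ :=
  Len A (Finset.Icc lo hi) lo hi

lemma base_mem_Iv {A : ℤ → ℤ → Prop} (hA : ∀ i, A i (i + 1)) (lo hi : ℤ) (h : lo ≤ hi) :
    hi - lo ∈ Iv A lo hi := by
  rw [Iv, mem_Len]
  exact HP.up hA lo hi h

lemma Iv_add {A : ℤ → ℤ → Prop} (hA : ∀ i, A i (i + 1)) (lo mid hi : ℤ) (h1 : lo ≤ mid)
    (h2 : mid + 1 ≤ hi) :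
    (Iv A lo mid).card + (Iv A (mid + 1) hi).card ≤ (Iv A lo hi).card + 1 := by
  classical
  have h3 := card_add_ge (Iv A lo mid) (Iv A (mid + 1) hi) ⟨_, base_mem_Iv hA lo mid h1⟩
    ⟨_, base_mem_Iv hA (mid + 1) hi h2⟩
  have h4 : (Iv A lo mid + Iv A (mid + 1) hi).card ≤ (Iv A lo hi).card := by
    refine Finset.card_le_card_of_injOn (fun l => l + 1) ?_ (fun a _ b _ h => by simpa using h)
    intro l hl
    obtain ⟨k, hk, m, hm, rfl⟩ := Finset.mem_add.1 (Finset.mem_coe.1 hl)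
    rw [Iv, mem_Len] at hk hm
    refine Finset.mem_coe.2 ?_
    rw [Iv, mem_Len]
    refine HP.app hk (hA mid) hm ?_ ?_ (by ring)
    · rw [Finset.disjoint_left]
      intro z hx hx'
      simp only [Finset.mem_Icc] at hx hx'
      omega
    · intro z hx
      simp only [Finset.mem_union, Finset.mem_Icc] at hx ⊢
      omega
  omega

lemma interval (τ : ℝ) (h0 : 0 ≤ τ) (h1 : τ < 1) (hcl : Claim τ) :
    ∃ κ : ℝ, 0 < κ ∧ ∀ (A : ℤ → ℤ → Prop), (∀ i, A i (i + 1)) → (∀ i j, A i j → A j i) →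
      ∀ (n : ℕ) (D : ℕ) (P : Finset (ℤ × ℤ)) (lo hi : ℤ), lo ≤ hi → hi - lo + 1 ≤ 2 ^ D →
      P.card ≤ n → (∀ p ∈ P, lo ≤ p.1 ∧ p.1 + 2 ≤ p.2 ∧ p.2 ≤ hi) →
      Set.InjOn Prod.snd (P : Set (ℤ × ℤ)) → (∀ p ∈ P, A p.1 p.2) →
      κ * (n : ℝ) ^ (τ - 1) * P.card ≤ D * (((Iv A lo hi).card : ℝ) - 1) := by
  classical
  obtain ⟨κ, hκ, hX⟩ := cross τ h0 h1 hcl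
  refine ⟨κ / 2, by positivity, ?_⟩
  intro A hA hs n D
  have hge1 : ∀ lo hi : ℤ, lo ≤ hi → (1 : ℝ) ≤ (Iv A lo hi).card := by
    intro lo hi h
    have : 0 < (Iv A lo hi).card := Finset.card_pos.2 ⟨_, base_mem_Iv hA lo hi h⟩
    exact_mod_cast this
  set μ := κ / 2 * (n : ℝ) ^ (τ - 1) with hμ
  have hμ0 : 0 ≤ μ := by positivity
  induction D with
  | zero =>
    intro P lo hi hlo hD _ hP _ _
    have : P = ∅ := by
      rw [Finset.eq_empty_iff_forall_notMem]
      intro p hp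
      have := hP p hp
      simp only [pow_zero] at hD
      omega
    subst this
    simp
  | succ D ih =>
    intro P lo hi hlo hD hPn hP hinj hch
    have hpow : (2 : ℤ) ^ (D + 1) = 2 * 2 ^ D := by ring
    have hpow1 : (1 : ℤ) ≤ 2 ^ D := one_le_pow₀ (by norm_num)
    by_cases hsm : hi - lo + 1 ≤ 2 ^ D
    · have := ih P lo hi hlo hsm hPn hP hinj hch
      have := hge1 lo hi hlo
      push_cast
      linarith
    push Not at hsm
    obtain ⟨mid, hmid⟩ : ∃ mid : ℤ, mid = lo + 2 ^ D - 1 := ⟨_, rfl⟩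
    set P1 := P.filter (fun p => p.2 ≤ mid) with hP1
    set P2 := (P.filter (fun p => ¬ p.2 ≤ mid)).filter (fun p => mid < p.1) with hP2
    set P3 := (P.filter (fun p => ¬ p.2 ≤ mid)).filter (fun p => ¬ mid < p.1) with hP3
    have s1 : P1 ⊆ P := Finset.filter_subset _ _
    have s2 : P2 ⊆ P := (Finset.filter_subset _ _).trans (Finset.filter_subset _ _)
    have s3 : P3 ⊆ P := (Finset.filter_subset _ _).trans (Finset.filter_subset _ _)
    have e1 : P1.card + (P.filter (fun p => ¬ p.2 ≤ mid)).card = P.card :=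
      Finset.card_filter_add_card_filter_not _
    have e2 : P2.card + P3.card = (P.filter (fun p => ¬ p.2 ≤ mid)).card :=
      Finset.card_filter_add_card_filter_not _
    have e3 : (P.card : ℝ) = P1.card + P2.card + P3.card := by
      have : P.card = P1.card + P2.card + P3.card := by omega
      exact_mod_cast this
    have i1 := ih P1 lo mid (by omega) (by omega) ((Finset.card_le_card s1).trans hPn)
      (by
        intro p hp
        have := hP p (s1 hp)
        have := (Finset.mem_filter.1 hp).2
        omega) (hinj.mono (by exact_mod_cast s1)) (fun p hp => hch p (s1 hp))
    have i2 := ih P2 (mid + 1) hi (by omega) (by omega) ((Finset.card_le_card s2).trans hPn)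
      (by
        intro p hp
        have := hP p (s2 hp)
        have := (Finset.mem_filter.1 hp).2
        omega) (hinj.mono (by exact_mod_cast s2)) (fun p hp => hch p (s2 hp))
    have hadd := Iv_add hA lo mid hi (by omega) (by omega)
    have haddR : ((Iv A lo mid).card : ℝ) + (Iv A (mid + 1) hi).card ≤ (Iv A lo hi).card + 1 := by
      exact_mod_cast hadd
    have i3 : μ * P3.card ≤ ((Iv A lo hi).card : ℝ) - 1 := by
      rcases P3.eq_empty_or_nonempty with he | hne
      · rw [he]
        have := hge1 lo hi hlo
        simp only [Finset.card_empty, Nat.cast_zero, mul_zero]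
        linarith
      · have hb3 : InBox P3 lo mid (mid + 1) hi := by
          intro p hp
          have := hP p (s3 hp)
          have h5 := (Finset.mem_filter.1 hp)
          have := h5.2
          have := (Finset.mem_filter.1 h5.1).2
          omega
        have hBI : Bx A lo mid (mid + 1) hi = Iv A lo hi := by
          have : Finset.Icc lo mid ∪ Finset.Icc (mid + 1) hi = Finset.Icc lo hi := by
            ext z
            simp only [Finset.mem_union, Finset.mem_Icc]
            omega
          rw [Bx, Iv, this]
        have hx := hX A hA hs P3 lo mid (mid + 1) hi (by omega) hne hb3
          (hinj.mono (by exact_mod_cast s3)) (fun p hp => hch p (s3 hp))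
        rw [hBI] at hx
        have htwo : (2 : ℝ) ≤ (Iv A lo hi).card := by
          obtain ⟨p, hp⟩ := hne
          obtain ⟨b1, b2, b3, b4⟩ := hb3 p hp
          have hm := chord_mem hA (a := lo) (b := mid) (c := mid + 1) (d := hi) (by omega)
            p.1 p.2 b1 b2 b3 b4 (hch p (s3 hp))
          rw [hBI] at hm
          have hm2 := base_mem_Iv hA lo hi hlo
          have hne' : p.1 - lo + 1 + (hi - p.2) ≠ hi - lo := by
            have := hP p (s3 hp)
            omega
          have : 1 < (Iv A lo hi).card := Finset.one_lt_card.2 ⟨_, hm, _, hm2, hne'⟩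
          exact_mod_cast this
        have hp3 : (0 : ℝ) < P3.card := by exact_mod_cast hne.card_pos
        have hp3n : (P3.card : ℝ) ≤ n := by
          exact_mod_cast (Finset.card_le_card s3).trans hPn
        have hanti : (n : ℝ) ^ (τ - 1) ≤ (P3.card : ℝ) ^ (τ - 1) :=
          Real.rpow_le_rpow_of_nonpos hp3 hp3n (by linarith)
        have : μ * P3.card ≤ κ / 2 * (P3.card : ℝ) ^ τ := by
          calc μ * P3.card ≤ κ / 2 * (P3.card : ℝ) ^ (τ - 1) * P3.card := by
                rw [hμ]; gcongr
            _ = κ / 2 * ((P3.card : ℝ) ^ (τ - 1) * P3.card) := by ring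
            _ = _ := by
                rw [← Real.rpow_add_one hp3.ne', sub_add_cancel]
        linarith
    have hD0 : (0 : ℝ) ≤ D := by positivity
    rw [e3]
    push_cast
    nlinarith

end HamCyc

open scoped Pointwise

namespace HamCyc

lemma HP.toWalk {V : Type} {G : SimpleGraph V} (v : ℤ → V) {s : Finset ℤ} {a b l : ℤ}
    (h : HP (fun i j => G.Adj (v i) (v j)) s a b l) (hv : Set.InjOn v (s : Set ℤ)) :
    ∃ p : G.Walk (v a) (v b), p.IsPath ∧ (p.length : ℤ) = l ∧
      ∀ u ∈ p.support, ∃ i ∈ s, v i = u := by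
  induction h with
  | single a => exact ⟨SimpleGraph.Walk.nil, by simp, by simp, by simp⟩
  | @append s t a b c d k l _ hbc _ hd i1 i2 =>
    obtain ⟨p, hp, hpl, hps⟩ := i1 (hv.mono (by simp))
    obtain ⟨q, hq, hql, hqs⟩ := i2 (hv.mono (by simp))
    refine ⟨p.append (SimpleGraph.Walk.cons hbc q), ?_, ?_, ?_⟩
    · rw [SimpleGraph.Walk.isPath_def, SimpleGraph.Walk.support_append,
        SimpleGraph.Walk.support_cons, List.tail_cons]
      refine List.Nodup.append hp.support_nodup hq.support_nodup ?_
      intro u hu hu'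
      obtain ⟨i, hi, rfl⟩ := hps u hu
      obtain ⟨j, hj, hij⟩ := hqs _ hu'
      have := hv (Finset.mem_coe.2 (Finset.mem_union_right _ hj))
        (Finset.mem_coe.2 (Finset.mem_union_left _ hi)) hij
      subst this
      exact Finset.disjoint_left.1 hd hi hj
    · rw [SimpleGraph.Walk.length_append, SimpleGraph.Walk.length_cons]
      push_cast
      omega
    · intro u hu
      rw [SimpleGraph.Walk.support_append, SimpleGraph.Walk.support_cons, List.tail_cons,
        List.mem_append] at hu
      rcases hu with hu | hu
      · obtain ⟨i, hi, h⟩ := hps u hu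
        exact ⟨i, Finset.mem_union_left _ hi, h⟩
      · obtain ⟨i, hi, h⟩ := hqs u hu
        exact ⟨i, Finset.mem_union_right _ hi, h⟩
  | mono _ hs i1 =>
    obtain ⟨p, hp, hpl, hps⟩ := i1 (hv.mono (by exact_mod_cast hs))
    exact ⟨p, hp, hpl, fun u hu => by
      obtain ⟨i, hi, h⟩ := hps u hu
      exact ⟨i, hs hi, h⟩⟩

lemma cycles_finite {V : Type} [Fintype V] (G : SimpleGraph V) :
    ({ l : ℕ | ∃ (v : V) (p : G.Walk v v), p.IsCycle ∧ p.length = l } : Set ℕ).Finite := by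
  refine (Set.finite_Iic (Fintype.card V)).subset ?_
  rintro l ⟨v, p, hp, rfl⟩
  have := hp.support_nodup.length_le_card
  rw [List.length_tail, SimpleGraph.Walk.length_support] at this
  exact this

lemma cycles_card {V : Type} [Fintype V] (G : SimpleGraph V) (v : ℤ → V) (n : ℕ)
    (hinj : Set.InjOn v (Set.Ico (0 : ℤ) n)) (hclose : G.Adj (v (n - 1)) (v 0)) :
    (Iv (fun i j => G.Adj (v i) (v j)) 0 (n - 1)).card ≤
      ({ l : ℕ | ∃ (v : V) (p : G.Walk v v), p.IsCycle ∧ p.length = l } : Set ℕ).ncard + 1 := by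
  classical
  set I := Iv (fun i j => G.Adj (v i) (v j)) 0 (n - 1) with hI
  set T := (I.erase 1).image (fun l : ℤ => (l + 1).toNat) with hT
  have hpos : ∀ l ∈ I, 0 ≤ l := by
    intro l hl
    rw [hI, Iv, mem_Len] at hl
    exact hl.bounds.1
  have hTc : T.card = (I.erase 1).card := by
    refine Finset.card_image_of_injOn ?_
    intro a ha b hb hab
    have := hpos a (Finset.mem_of_mem_erase ha)
    have := hpos b (Finset.mem_of_mem_erase hb)
    simp only at hab
    omega
  have hsub : (T : Set ℕ) ⊆
      { l : ℕ | ∃ (v : V) (p : G.Walk v v), p.IsCycle ∧ p.length = l } := by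
    intro k hk
    obtain ⟨l, hl, rfl⟩ := Finset.mem_image.1 (Finset.mem_coe.1 hk)
    obtain ⟨hl1, hlI⟩ := Finset.mem_erase.1 hl
    have hl0 := hpos l hlI
    rw [hI, Iv, mem_Len] at hlI
    obtain ⟨p, hp, hpl, -⟩ := HP.toWalk v hlI (hinj.mono (by
      intro x hx
      rw [Finset.mem_coe, Finset.mem_Icc] at hx
      rw [Set.mem_Ico]
      omega))
    refine ⟨_, SimpleGraph.Walk.cons hclose p, ?_, ?_⟩
    · rw [SimpleGraph.Walk.cons_isCycle_iff]
      refine ⟨hp, fun he => ?_⟩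
      rw [Sym2.eq_swap] at he
      have := hp.length_eq_one_of_mem_edges he
      omega
    · rw [SimpleGraph.Walk.length_cons]
      omega
  have h1 := Set.ncard_le_ncard hsub (cycles_finite G)
  rw [Set.ncard_coe_finset, hTc] at h1
  have h2 := Finset.pred_card_le_card_erase (s := I) (a := 1)
  omega

lemma labelling {V : Type} [Fintype V] [DecidableEq V] (G : SimpleGraph V) (n : ℕ)
    (hn : Fintype.card V = n) (u : V) (p : G.Walk u u) (hp : p.IsHamiltonianCycle) :
    ∃ v : ℤ → V, (∀ i, G.Adj (v i) (v (i + 1))) ∧ Set.InjOn v (Set.Ico (0 : ℤ) n) ∧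
      (∀ w, ∃ i : ℤ, 0 ≤ i ∧ i < n ∧ v i = w) ∧ v n = v 0 ∧ v (-1) = v (n - 1) := by
  have hlen : p.length = n := hp.length_eq.trans hn
  have h3 := hp.isCycle.three_le_length
  have hn0 : (0 : ℤ) < n := by omega
  refine ⟨fun i => p.getVert (i % n).toNat, ?_, ?_, ?_, ?_, ?_⟩
  · intro i
    have b1 := Int.emod_nonneg i hn0.ne'
    have b2 := Int.emod_lt_of_pos i hn0
    by_cases hlast : i % n + 1 < n
    · have e : (i + 1) % n = i % n + 1 := by
        rw [← Int.emod_add_emod]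
        exact Int.emod_eq_of_lt (by omega) hlast
      have e2 : ((i + 1) % (n : ℤ)).toNat = (i % n).toNat + 1 := by omega
      show G.Adj (p.getVert _) (p.getVert _)
      rw [e2]
      exact p.adj_getVert_succ (by omega)
    · have e0 : i % n + 1 = n := by omega
      have e : (i + 1) % n = 0 := by
        rw [← Int.emod_add_emod, e0, Int.emod_self]
      show G.Adj (p.getVert _) (p.getVert _)
      rw [e]
      have := p.adj_getVert_succ (i := (i % n).toNat) (by omega)
      rw [show (i % (n : ℤ)).toNat + 1 = p.length by omega, p.getVert_length] at this
      simpa using this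
  · intro i hi j hj hij
    rw [Set.mem_Ico] at hi hj
    simp only [Int.emod_eq_of_lt hi.1 hi.2, Int.emod_eq_of_lt hj.1 hj.2] at hij
    have := hp.isCycle.getVert_injOn' (x₁ := i.toNat) (x₂ := j.toNat)
      (by rw [Set.mem_ofPred_eq]; omega) (by rw [Set.mem_ofPred_eq]; omega) hij
    omega
  · intro w
    obtain ⟨k, hk, hkl⟩ := SimpleGraph.Walk.mem_support_iff_exists_getVert.1 (hp.mem_support w)
    by_cases hkn : k = n
    · refine ⟨0, le_rfl, hn0, ?_⟩
      rw [hkn, ← hlen, p.getVert_length] at hk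
      simpa using hk
    · refine ⟨k, by omega, by omega, ?_⟩
      have : (k : ℤ) % n = k := Int.emod_eq_of_lt (by omega) (by omega)
      simp only [this, Int.toNat_natCast]
      exact hk
  · simp
  · have e1 : (-1 : ℤ) % n = n - 1 := by
      rw [← Int.add_emod_right, show (-1 : ℤ) + n = n - 1 by ring]
      exact Int.emod_eq_of_lt (by omega) (by omega)
    have e2 : ((n : ℤ) - 1) % n = n - 1 := Int.emod_eq_of_lt (by omega) (by omega)
    simp only [e1, e2]

lemma exists_chord {V : Type} [Fintype V] [DecidableEq V] (G : SimpleGraph V) (n : ℕ)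
    (v : ℤ → V) (hv3 : ∀ w, ∃ i : ℤ, 0 ≤ i ∧ i < n ∧ v i = w)
    (hn1 : v n = v 0) (hdeg : ∀ v : V, 3 ≤ (G.neighborSet v).ncard) (i : ℤ) :
    ∃ j : ℤ, 0 ≤ j ∧ j < n ∧ G.Adj (v i) (v j) ∧ j ≠ i ∧ j ≠ i - 1 ∧ j ≠ i + 1 := by
  classical
  obtain ⟨w, hw, hw1⟩ : ∃ w ∈ G.neighborSet (v i), w ∉ ({v (i - 1), v (i + 1)} : Set V) := by
    refine Set.exists_mem_notMem_of_ncard_lt_ncard ?_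
    have := hdeg (v i)
    have h2 := Set.ncard_insert_le (v (i - 1)) ({v (i + 1)} : Set V)
    rw [Set.ncard_singleton] at h2
    omega
  obtain ⟨j, hj0, hjn, rfl⟩ := hv3 w
  simp only [Set.mem_insert_iff, Set.mem_singleton_iff, not_or] at hw1
  rw [SimpleGraph.mem_neighborSet] at hw
  refine ⟨j, hj0, hjn, hw, ?_, ?_, ?_⟩
  · rintro rfl; exact hw.ne rfl
  · rintro rfl; exact hw1.1 rfl
  · rintro rfl; exact hw1.2 rfl

lemma arith (κ τ ε : ℝ) (hκ : 0 < κ) (hε : 0 < ε) (hτ : 1 - ε / 2 ≤ τ) :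
    ∃ n₀ : ℕ, 3 ≤ n₀ ∧ ∀ n : ℕ, n₀ ≤ n → ∀ (m : ℕ) (X : ℝ), n ≤ 2 * m →
      κ * (n : ℝ) ^ (τ - 1) * m ≤ (Nat.log 2 n + 1 : ℕ) * X → (n : ℝ) ^ (1 - ε) ≤ X := by
  have hlo := isLittleO_log_rpow_atTop (show 0 < ε / 2 by linarith)
  have hb := hlo.bound (show 0 < κ / 6 by positivity)
  have hb' := (tendsto_natCast_atTop_atTop (R := ℝ)).eventually hb
  obtain ⟨n₀, hn₀⟩ := Filter.eventually_atTop.1 hb'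
  refine ⟨max n₀ 3, le_max_right _ _, ?_⟩
  intro n hn m X hm hX
  have h3 : 3 ≤ n := (le_max_right _ _).trans hn
  have hn3 : (3 : ℝ) ≤ n := by exact_mod_cast h3
  have hnpos : (0 : ℝ) < n := by linarith
  have hlog1 : 1 ≤ Real.log n := by
    rw [Real.le_log_iff_exp_le hnpos]
    linarith [Real.exp_one_lt_d9]
  have hbn := hn₀ n ((le_max_left _ _).trans hn)
  rw [Real.norm_of_nonneg (by linarith), Real.norm_of_nonneg (by positivity)] at hbn
  have hD : ((Nat.log 2 n + 1 : ℕ) : ℝ) ≤ 3 * Real.log n := by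
    have h4 : 2 ^ Nat.log 2 n ≤ n := Nat.pow_log_le_self 2 (by omega)
    have h5 : (2 : ℝ) ^ Nat.log 2 n ≤ n := by exact_mod_cast h4
    have h6 := Real.log_le_log (by positivity) h5
    rw [Real.log_pow] at h6
    have h7 := Real.log_two_gt_d9
    have h8 : (0 : ℝ) ≤ (Nat.log 2 n : ℝ) := by positivity
    push_cast
    nlinarith
  set D : ℝ := ((Nat.log 2 n + 1 : ℕ) : ℝ) with hDdef
  have hDpos : 0 < D := by rw [hDdef]; positivity
  have hmR : (n : ℝ) ≤ 2 * m := by exact_mod_cast hm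
  have k1 : κ * (n : ℝ) ^ τ ≤ 2 * (D * X) := by
    calc κ * (n : ℝ) ^ τ = κ * ((n : ℝ) ^ (τ - 1) * n) := by
          rw [← Real.rpow_add_one hnpos.ne', sub_add_cancel]
      _ ≤ κ * ((n : ℝ) ^ (τ - 1) * (2 * m)) := by gcongr
      _ = 2 * (κ * (n : ℝ) ^ (τ - 1) * m) := by ring
      _ ≤ _ := by linarith
  have k2 : (n : ℝ) ^ (1 - ε / 2) ≤ (n : ℝ) ^ τ :=
    Real.rpow_le_rpow_of_exponent_le (by linarith) hτ
  have k3 : (n : ℝ) ^ (1 - ε) * (n : ℝ) ^ (ε / 2) = (n : ℝ) ^ (1 - ε / 2) := by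
    rw [← Real.rpow_add hnpos]; congr 1; ring
  have k4 : 2 * D ≤ κ * (n : ℝ) ^ (ε / 2) := by linarith
  have k5 : 2 * D * (n : ℝ) ^ (1 - ε) ≤ 2 * D * X := by
    calc 2 * D * (n : ℝ) ^ (1 - ε) ≤ κ * (n : ℝ) ^ (ε / 2) * (n : ℝ) ^ (1 - ε) := by gcongr
      _ = κ * ((n : ℝ) ^ (1 - ε) * (n : ℝ) ^ (ε / 2)) := by ring
      _ = κ * (n : ℝ) ^ (1 - ε / 2) := by rw [k3]
      _ ≤ κ * (n : ℝ) ^ τ := by gcongr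
      _ ≤ _ := by linarith
  exact le_of_mul_le_mul_left k5 (by positivity)

end HamCyc

open HamCyc
theorem hamiltonian_min_degree_three_cycle_lengths_asymptotic :
    ∀ ε : ℝ, 0 < ε →
      ∃ n₀ : ℕ, ∀ (n : ℕ) (V : Type) [Fintype V] [DecidableEq V] (G : SimpleGraph V),
        n₀ ≤ n → Fintype.card V = n →
        (∃ (v : V) (p : G.Walk v v), p.IsHamiltonianCycle) →
        (∀ v : V, 3 ≤ (G.neighborSet v).ncard) →
        (n : ℝ) ^ ((1 : ℝ) - ε) ≤
          ({ ℓ : ℕ | ∃ (v : V) (p : G.Walk v v), p.IsCycle ∧ p.length = ℓ } : Set ℕ).ncard := by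
  intro ε hε
  classical
  obtain ⟨τ, hτ, hτ0, hτ1, hcl⟩ := claim_lt (1 - ε / 2) (by linarith)
  obtain ⟨κ, hκ, hI⟩ := interval τ hτ0 hτ1 hcl
  obtain ⟨n₀, hn₀3, hn₀⟩ := arith κ τ ε hκ hε hτ
  refine ⟨n₀, ?_⟩
  intro n V _ _ G hn hcard hham hdeg
  obtain ⟨u, p, hp⟩ := hham
  obtain ⟨v, hv1, hv2, hv3, hv4, hv5⟩ := labelling G n hcard u p hp
  have hch := fun i => exists_chord G n v hv3 hv4 hdeg i
  choose f hf0 hfn hfadj hfi hfm hfp using hch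
  have hn3 : 3 ≤ n := hn₀3.trans hn
  have hpow : ((n : ℤ) - 1) - 0 + 1 ≤ 2 ^ (Nat.log 2 n + 1) := by
    have : n < 2 ^ (Nat.log 2 n + 1) := Nat.lt_pow_succ_log_self (by norm_num) n
    have : (n : ℤ) < 2 ^ (Nat.log 2 n + 1) := by exact_mod_cast this
    omega
  -- the conclusion for a labelling with many chords going left
  have fin : ∀ (w : ℤ → V), (∀ i, G.Adj (w i) (w (i + 1))) → Set.InjOn w (Set.Ico (0 : ℤ) n) →
      G.Adj (w (n - 1)) (w 0) → ∀ (S : Finset ℤ) (g : ℤ → ℤ), n ≤ 2 * S.card → S.card ≤ n →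
      (∀ i ∈ S, 0 ≤ g i ∧ g i + 2 ≤ i ∧ i < n ∧ G.Adj (w (g i)) (w i)) →
      (n : ℝ) ^ ((1 : ℝ) - ε) ≤
          ({ ℓ : ℕ | ∃ (v : V) (p : G.Walk v v), p.IsCycle ∧ p.length = ℓ } : Set ℕ).ncard := by
    intro w hw1 hw2 hw3 S g hS hSn hg
    set P := S.image (fun i => (g i, i)) with hP
    have hPc : P.card = S.card :=
      Finset.card_image_of_injective _ (fun a b h => (Prod.ext_iff.1 h).2)
    have hmem : ∀ q ∈ P, q.2 ∈ S ∧ q.1 = g q.2 := by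
      intro q hq
      obtain ⟨i, hi, rfl⟩ := Finset.mem_image.1 hq
      exact ⟨hi, rfl⟩
    have key := hI (fun i j => G.Adj (w i) (w j)) hw1 (fun i j h => h.symm) n
      (Nat.log 2 n + 1) P 0 (n - 1) (by omega) hpow (by omega)
      (by
        intro q hq
        obtain ⟨h1, h2⟩ := hmem q hq
        have := hg q.2 h1
        rw [h2]
        omega)
      (by
        intro a ha b hb hab
        obtain ⟨_, h2⟩ := hmem a ha
        obtain ⟨_, h4⟩ := hmem b hb
        exact Prod.ext (by rw [h2, h4]; exact congrArg g hab) hab)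
      (by
        intro q hq
        obtain ⟨h1, h2⟩ := hmem q hq
        have := (hg q.2 h1).2.2.2
        rw [h2]
        exact this)
    have hcc := cycles_card G w n hw2 hw3
    have h9 := hn₀ n hn S.card _ hS (by rw [← hPc]; exact key)
    refine h9.trans ?_
    rw [sub_le_iff_le_add]
    exact_mod_cast hcc
  have hclose : G.Adj (v (n - 1)) (v 0) := by
    have := hv1 (n - 1)
    rwa [sub_add_cancel, hv4] at this
  set J := Finset.Ico (0 : ℤ) n with hJ
  have hJc : J.card = n := by rw [hJ, Int.card_Ico]; omega
  have hsplit : (J.filter (fun i => f i < i)).card + (J.filter (fun i => ¬ f i < i)).card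
      = J.card := Finset.card_filter_add_card_filter_not _
  by_cases hbig : n ≤ 2 * (J.filter (fun i => f i < i)).card
  · refine fin v hv1 hv2 hclose (J.filter (fun i => f i < i)) f hbig (by omega) ?_
    intro i hi
    obtain ⟨hi1, hi2⟩ := Finset.mem_filter.1 hi
    rw [hJ, Finset.mem_Ico] at hi1
    have := hfm i
    exact ⟨hf0 i, by omega, by omega, (hfadj i).symm⟩
  · have hrc : ((J.filter (fun i => ¬ f i < i)).image (fun i => (n : ℤ) - 1 - i)).card =
        (J.filter (fun i => ¬ f i < i)).card :=
      Finset.card_image_of_injective _ (sub_right_injective)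
    refine fin (fun i => v (n - 1 - i)) ?_ ?_ ?_
      ((J.filter (fun i => ¬ f i < i)).image (fun i => (n : ℤ) - 1 - i))
      (fun i => n - 1 - f (n - 1 - i)) (by omega) (by omega) ?_
    · intro i
      have := (hv1 (n - 1 - (i + 1))).symm
      rwa [show (n : ℤ) - 1 - (i + 1) + 1 = n - 1 - i by ring] at this
    · intro a ha b hb hab
      rw [Set.mem_Ico] at ha hb
      have := hv2 (x₁ := (n : ℤ) - 1 - a) (x₂ := (n : ℤ) - 1 - b)
        (by rw [Set.mem_Ico]; omega) (by rw [Set.mem_Ico]; omega) hab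
      omega
    · have := hclose.symm
      simpa using this
    · intro i hi
      obtain ⟨k, hk, rfl⟩ := Finset.mem_image.1 hi
      obtain ⟨hk1, hk2⟩ := Finset.mem_filter.1 hk
      rw [hJ, Finset.mem_Ico] at hk1
      have e : (n : ℤ) - 1 - (n - 1 - k) = k := by ring
      have := hfp k
      have := hfi k
      have := hfn k
      simp only [e]
      refine ⟨by omega, by omega, by omega, ?_⟩
      rw [show (n : ℤ) - 1 - (n - 1 - f k) = f k by ring]
      exact (hfadj k).symm
end
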